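/- arXiv:1207.6535 — 3 statements merged into one kernel-verified Lean document; each statement's English description precedes it below -/
import Mathlib

section
/- Supersolution inequality at a transition vertex along an edge with nonpositive outgoing slopes (Lemma 5.5). Assume the Hamiltonian H = (H^j) satisfies (H0)–(H6) and β_{ij} > 0 for all i ∈ I_T, j ∈ Inc_i. Let ε_n > 0 with ε_n → 0 and let u_n ∈ C²_{*,β}(Γ) satisfy −ε_n ∂²_j u_n + H^j(x, u_n, ∂_j u_n) = 0 on (0,l_j) for all j ∈ J and S^i_β u_n = 0 for all i ∈ I_T; assume (u_n) and (∂_j u_n) are uniformly bounded on Γ and u_n → u uniformly on Γ with u ∈ C(Γ). Fix i ∈ I_T and j ∈ Inc_i, and assume a_{ij} ∂_j u_n(v_i) ≤ 0 for infinitely many n ∈ ℕ. Suppose φ ∈ C²(Γ) is such that u − φ has a local minimum at v_i (with respect to the network, i.e., u^k − φ^k has a local minimum at y_i^k for every k ∈ Inc_i). Then H^j(y_i^j, u(v_i), ∂_j φ(v_i)) ≥ 0. -/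
open Set

noncomputable section

/-- A finite connected topological network. -/
structure Network where
  I : Type
  J : Type
  finI : Fintype I
  finJ : Fintype J
  neI : Nonempty I
  neJ : Nonempty J
  l : J → ℝ
  l_pos : ∀ j, 0 < l j
  s : J → I
  t : J → I
  st_ne : ∀ j, s j ≠ t j
  conn : ∀ i i' : I,
    Relation.ReflTransGen (fun a b => ∃ j, (s j = a ∧ t j = b) ∨ (s j = b ∧ t j = a)) i i'
  IB : Set I
  IB_ne : IB.Nonempty
  deg_one_bd : ∀ i : I, ({j : J | s j = i ∨ t j = i} : Set J).ncard = 1 → i ∈ IB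

attribute [instance] Network.finI Network.finJ Network.neI Network.neJ

namespace Network

open scoped Classical

variable (N : Network)

/-- The set of edges incident to the vertex `i`. -/
def Inc (i : N.I) : Set N.J := {j | N.s j = i ∨ N.t j = i}

/-- The set of transition vertices. -/
def IT : Set N.I := N.IBᶜ

/-- The signed incidence `a_{ij}`. -/
def sgn (i : N.I) (j : N.J) : ℝ := if N.s j = i then 1 else -1

/-- The parameter `y_i^j` of the vertex `i` on the edge `j`. -/
def param (i : N.I) (j : N.J) : ℝ := if N.s j = i then 0 else N.l j

/-- The edge `j` as a parameter interval. -/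
def edge (j : N.J) : Set ℝ := Icc 0 (N.l j)

/-- A family `(u^j)` of functions on the edges defines a function on the network iff
the values at each vertex agree. -/
def Compat (u : N.J → ℝ → ℝ) : Prop :=
  ∀ i : N.I, ∀ j ∈ N.Inc i, ∀ k ∈ N.Inc i, u j (N.param i j) = u k (N.param i k)

/-- `u ∈ C(Γ)`. -/
def IsCont (u : N.J → ℝ → ℝ) : Prop :=
  N.Compat u ∧ ∀ j, ContinuousOn (u j) (N.edge j)

/-- `u ∈ C²(Γ)`. -/
def IsC2 (u : N.J → ℝ → ℝ) : Prop :=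
  N.Compat u ∧ ∀ j, ContDiffOn ℝ 2 (u j) (N.edge j)

/-- First derivative `∂_j u` along the edge `j`. -/
def pd (u : N.J → ℝ → ℝ) (j : N.J) (x : ℝ) : ℝ := derivWithin (u j) (N.edge j) x

/-- Second derivative `∂²_j u` along the edge `j`. -/
def pd2 (u : N.J → ℝ → ℝ) (j : N.J) (x : ℝ) : ℝ := derivWithin (N.pd u j) (N.edge j) x

/-- Sum over the edges incident to `i`. -/
def incSum (i : N.I) (f : N.J → ℝ) : ℝ := ∑ j : N.J, if j ∈ N.Inc i then f j else 0

/-- The Kirchhoff sum `S^i_β u`. -/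
def kir (β : N.I → N.J → ℝ) (u : N.J → ℝ → ℝ) (i : N.I) : ℝ :=
  N.incSum i (fun j => β i j * N.sgn i j * N.pd u j (N.param i j))

/-- `u ∈ C²_{*,β}(Γ)`. -/
def IsC2Star (β : N.I → N.J → ℝ) (u : N.J → ℝ → ℝ) : Prop :=
  N.IsC2 u ∧ ∀ i ∈ N.IT, N.kir β u i = 0

/-- (H0): continuity of each `H^j`. -/
def H0 (H : N.J → ℝ → ℝ → ℝ → ℝ) : Prop :=
  ∀ j, ContinuousOn (fun q : ℝ × ℝ × ℝ => H j q.1 q.2.1 q.2.2)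
    ((N.edge j) ×ˢ (univ : Set ℝ) ×ˢ (univ : Set ℝ))

/-- (H1): `r ↦ H^j(x,r,p)` is nondecreasing. -/
def H1 (H : N.J → ℝ → ℝ → ℝ → ℝ) : Prop :=
  ∀ j, ∀ x ∈ N.edge j, ∀ p : ℝ, Monotone fun r => H j x r p

/-- (H3): `p ↦ H^j(v_i,r,p)` is nondecreasing on `(0,∞)` at transition vertices. -/
def H3 (H : N.J → ℝ → ℝ → ℝ → ℝ) : Prop :=
  ∀ i ∈ N.IT, ∀ j ∈ N.Inc i, ∀ r : ℝ,
    MonotoneOn (fun p => H j (N.param i j) r p) (Ioi (0 : ℝ))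

/-- (H4): coercivity in `p`, uniform on bounded `r`-sets. -/
def H4 (H : N.J → ℝ → ℝ → ℝ → ℝ) : Prop :=
  ∀ j, ∀ R : ℝ, 0 < R → ∀ A : ℝ, ∃ M : ℝ, ∀ x ∈ N.edge j, ∀ r : ℝ, |r| ≤ R →
    ∀ p : ℝ, M < |p| → A < H j x r p

/-- (H5): continuity of `H` at the transition vertices. -/
def H5 (H : N.J → ℝ → ℝ → ℝ → ℝ) : Prop :=
  ∀ i ∈ N.IT, ∀ j ∈ N.Inc i, ∀ k ∈ N.Inc i, ∀ r p : ℝ,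
    H j (N.param i j) r p = H k (N.param i k) r p

/-- (H6): symmetry of `H` in `p` at the transition vertices. -/
def H6 (H : N.J → ℝ → ℝ → ℝ → ℝ) : Prop :=
  ∀ i ∈ N.IT, ∀ j ∈ N.Inc i, ∀ r p : ℝ,
    H j (N.param i j) r p = H j (N.param i j) r (-p)

end Network

open Filter Topology in
/-- A slope that decreases at rate larger than `K / τ` as long as it lies in `[-K, 0]` and starts
nonpositive drops below `-K` by time `τ`, so its primitive decreases at rate `K` after `τ`. -/
theorem sub_le_of_slope_decreasing {a K τ : ℝ} {w g g' : ℝ → ℝ} (hτ : 0 < τ)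
    (hK : 0 < K) (hw : ∀ x ∈ Icc 0 a, HasDerivWithinAt w (g x) (Icc 0 a) x)
    (hg : ∀ x ∈ Icc 0 a, HasDerivWithinAt g (g' x) (Icc 0 a) x)
    (hg' : ∀ x ∈ Icc 0 a, |g x| ≤ K → g' x < -(K / τ)) (h0 : g 0 ≤ 0)
    {x : ℝ} (hx : x ∈ Icc τ a) : w x - w 0 ≤ -K * (x - τ) := by
  have hKτ : 0 < K / τ := div_pos hK hτ
  have hτa : τ ≤ a := hx.1.trans hx.2
  have right_deriv : ∀ {f f' : ℝ → ℝ}, (∀ y ∈ Icc 0 a, HasDerivWithinAt f (f' y) (Icc 0 a) y) →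
      ∀ y ∈ Ico 0 a, HasDerivWithinAt f (f' y) (Ici y) y := fun hf y hy =>
    (hf y ⟨hy.1, hy.2.le⟩).mono_of_mem_nhdsWithin
      (mem_of_superset (Icc_mem_nhdsGE hy.2) (Icc_subset_Icc_left hy.1))
  have hgc : ContinuousOn g (Icc 0 a) := fun y hy => (hg y hy).continuousWithinAt
  have hwc : ContinuousOn w (Icc 0 a) := fun y hy => (hw y hy).continuousWithinAt
  have early : ∀ y ∈ Icc 0 τ, g y ≤ -(K / τ) * y := by
    refine image_le_of_deriv_right_lt_deriv_boundary (f := g) (f' := g')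
      (B := fun y => -(K / τ) * y) (B' := fun _ => -(K / τ))
      (hgc.mono (Icc_subset_Icc_right hτa))
      (fun y hy => right_deriv hg y ⟨hy.1, hy.2.trans_le hτa⟩) (by simpa using h0)
      (fun y => by simpa using (hasDerivAt_id y).const_mul (-(K / τ))) ?_
    intro y hy hyB
    refine hg' y ⟨hy.1, hy.2.le.trans hτa⟩ ?_
    have h1 : 0 ≤ K / τ * y := mul_nonneg hKτ.le hy.1
    have h2 : K / τ * y ≤ K / τ * τ := mul_le_mul_of_nonneg_left hy.2.le hKτ.le
    rw [div_mul_cancel₀ _ hτ.ne'] at h2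
    rw [hyB, neg_mul, abs_neg, abs_of_nonneg h1]
    exact h2
  have late : ∀ y ∈ Icc τ a, g y ≤ -K := by
    refine image_le_of_deriv_right_lt_deriv_boundary (f := g) (f' := g')
      (B := fun _ => -K) (B' := fun _ => 0)
      (hgc.mono (Icc_subset_Icc_left hτ.le))
      (fun y hy => right_deriv hg y ⟨hτ.le.trans hy.1, hy.2⟩) ?_
      (fun y => hasDerivAt_const y _) ?_
    · have := early τ ⟨hτ.le, le_rfl⟩
      rwa [neg_mul, div_mul_cancel₀ _ hτ.ne'] at this
    · intro y hy hyB
      have := hg' y ⟨hτ.le.trans hy.1, hy.2.le⟩ (by rw [hyB, abs_neg, abs_of_pos hK])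
      linarith
  have hw1 : w τ ≤ w 0 := by
    refine image_le_of_deriv_right_le_deriv_boundary (f := w) (f' := g) (a := 0) (b := τ)
      (B := fun _ => w 0) (B' := fun _ => 0) (hwc.mono (Icc_subset_Icc_right hτa))
      (fun y hy => right_deriv hw y ⟨hy.1, hy.2.trans_le hτa⟩) le_rfl continuousOn_const
      (fun y _ => hasDerivWithinAt_const _ _ _) ?_ ⟨hτ.le, le_rfl⟩
    intro y hy
    have := early y ⟨hy.1, hy.2.le⟩
    nlinarith [mul_nonneg hKτ.le hy.1]
  have hw2 : w x ≤ w τ + -K * (x - τ) := by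
    refine image_le_of_deriv_right_le_deriv_boundary (f := w) (f' := g) (a := τ) (b := a)
      (B := fun y => w τ + -K * (y - τ)) (B' := fun _ => -K)
      (hwc.mono (Icc_subset_Icc_left hτ.le))
      (fun y hy => right_deriv hw y ⟨hτ.le.trans hy.1, hy.2⟩) (by simp) (by fun_prop)
      (fun y _ => ?_) (fun y hy => late y ⟨hy.1, hy.2.le⟩) hx
    simpa using ((((hasDerivAt_id y).sub_const τ).const_mul (-K)).const_add (w τ)).hasDerivWithinAt
  linarith

open Filter Topology in
/-- If a Hamiltonian that is even and nondecreasing in `|p|` at the endpoint `0` is negative at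
slope `q`, then it is bounded away from zero near the endpoint for slopes in an interval strictly
larger than `[-|q|, |q|]`. -/
theorem exists_neg_bound_near_endpoint {l r₀ q : ℝ} {F : ℝ → ℝ → ℝ → ℝ} (hl : 0 < l)
    (hF : ContinuousOn (fun z : ℝ × ℝ × ℝ => F z.1 z.2.1 z.2.2) (Icc 0 l ×ˢ univ ×ˢ univ))
    (hmono : MonotoneOn (F 0 r₀) (Ioi 0)) (heven : ∀ p, F 0 r₀ p = F 0 r₀ (-p))
    (hq : F 0 r₀ q < 0) :
    ∃ K > |q|, ∃ c > 0, ∀ᶠ z : ℝ × ℝ in 𝓝 (0, r₀), ∀ p ∈ Icc (-K) K,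
      z.1 ∈ Icc 0 l → F z.1 z.2 p < -c := by
  have hcont : Continuous (F 0 r₀) :=
    hF.comp_continuous (f := fun p : ℝ => ((0 : ℝ), r₀, p)) (by fun_prop)
      (fun p => ⟨⟨le_rfl, hl.le⟩, mem_univ _, mem_univ _⟩)
  have habs : ∀ p, F 0 r₀ |p| = F 0 r₀ p := fun p => by
    rcases abs_choice p with h | h <;> rw [h]
    exact (heven p).symm
  obtain ⟨K, hFK, hqK⟩ : ∃ K, F 0 r₀ K < 0 ∧ |q| < K := by
    have h : ∀ᶠ p in 𝓝 |q|, F 0 r₀ p < 0 :=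
      hcont.continuousAt.eventually_lt_const (by rwa [habs])
    exact ((h.filter_mono nhdsWithin_le_nhds).and (self_mem_nhdsWithin (s := Ioi |q|))).exists
  have hK : 0 < K := (abs_nonneg q).trans_lt hqK
  have hle : ∀ p ∈ Icc 0 K, F 0 r₀ p ≤ F 0 r₀ K := by
    have hcl : closure (Ioc 0 K) = Icc 0 K := closure_Ioc hK.ne
    intro p hp
    exact (isClosed_le hcont continuous_const).closure_subset_iff.2
      (fun y hy => hmono hy.1 hK hy.2) (hcl ▸ hp)
  refine ⟨K, hqK, -F 0 r₀ K / 2, by linarith, ?_⟩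
  refine isCompact_Icc.eventually_forall_of_forall_eventually (fun p hp => ?_)
  have hp0 : F 0 r₀ p < -(-F 0 r₀ K / 2) := by
    have := hle |p| ⟨abs_nonneg p, abs_le.2 hp⟩
    rw [habs] at this
    linarith
  have hev := (hF (0, r₀, p) ⟨⟨le_rfl, hl.le⟩, mem_univ _, mem_univ _⟩).eventually_lt_const hp0
  rw [eventually_nhdsWithin_iff] at hev
  have hassoc : Tendsto (fun z : (ℝ × ℝ) × ℝ => (z.1.1, z.1.2, z.2)) (𝓝 ((0, r₀), p))
      (𝓝 (0, r₀, p)) := Continuous.tendsto (by fun_prop) _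
  filter_upwards [hassoc.eventually hev] with z hz hz1
  exact hz ⟨hz1, mem_univ _, mem_univ _⟩

open Filter Topology in
/-- The supersolution inequality at the endpoint `0` of an interval, for vanishing viscosity limits
of solutions having nonpositive slope at `0` infinitely often. -/
theorem nonneg_hamiltonian_at_endpoint {l q : ℝ} {F : ℝ → ℝ → ℝ → ℝ} (hl : 0 < l)
    (hF : ContinuousOn (fun z : ℝ × ℝ × ℝ => F z.1 z.2.1 z.2.2) (Icc 0 l ×ˢ univ ×ˢ univ))
    (hmono : ∀ r, MonotoneOn (F 0 r) (Ioi 0)) (heven : ∀ r p, F 0 r p = F 0 r (-p))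
    {ε : ℕ → ℝ} (hεpos : ∀ n, 0 < ε n) (hεlim : Tendsto ε atTop (𝓝 0))
    {w g g' : ℕ → ℝ → ℝ}
    (hw : ∀ n, ∀ x ∈ Icc 0 l, HasDerivWithinAt (w n) (g n x) (Icc 0 l) x)
    (hg : ∀ n, ∀ x ∈ Icc 0 l, HasDerivWithinAt (g n) (g' n x) (Icc 0 l) x)
    (hode : ∀ n, ∀ x ∈ Icc 0 l, ε n * g' n x = F x (w n x) (g n x))
    {v : ℝ → ℝ} (hv : ContinuousOn v (Icc 0 l))
    (hconv : TendstoUniformlyOn w v atTop (Icc 0 l))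
    (hslope : ∃ᶠ n in atTop, g n 0 ≤ 0)
    {φ : ℝ → ℝ} (hφ : HasDerivWithinAt φ q (Icc 0 l) 0)
    (hmin : ∀ᶠ x in 𝓝[>] 0, v 0 - φ 0 ≤ v x - φ x) :
    0 ≤ F 0 (v 0) q := by
  by_contra! hneg
  obtain ⟨K, hqK, c, hc, hnear⟩ :=
    exists_neg_bound_near_endpoint hl hF (hmono (v 0)) (heven (v 0)) hneg
  have hK : 0 < K := (abs_nonneg q).trans_lt hqK
  have h0 : (0 : ℝ) ∈ Icc 0 l := ⟨le_rfl, hl.le⟩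
  obtain ⟨ρ, hρ, hball⟩ := Metric.eventually_nhds_iff.1 hnear
  obtain ⟨δ, hδ, hvδ⟩ := Metric.continuousWithinAt_iff.1 (hv 0 h0) (ρ / 2) (by positivity)
  obtain ⟨a, ha, hamin⟩ := exists_between (lt_min hl (lt_min hδ hρ))
  simp only [lt_min_iff] at hamin
  obtain ⟨hal, haδ, haρ⟩ := hamin
  have hsub : Icc 0 a ⊆ Icc 0 l := Icc_subset_Icc_right hal.le
  have hclose : ∀ᶠ n in atTop, ∀ x ∈ Icc 0 a, ∀ p ∈ Icc (-K) K, F x (w n x) p < -c := by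
    filter_upwards [Metric.tendstoUniformlyOn_iff.1 hconv (ρ / 2) (by positivity)]
      with n hn x hx p hp
    have hxabs : dist x 0 = x := by rw [Real.dist_0_eq_abs, abs_of_nonneg hx.1]
    refine hball (y := (x, w n x)) ?_ p hp (hsub hx)
    rw [Prod.dist_eq, max_lt_iff]
    refine ⟨by simpa only [hxabs] using hx.2.trans_lt haρ, ?_⟩
    have h1 := hn x (hsub hx)
    have h2 := hvδ (hsub hx) (hxabs.trans_lt (hx.2.trans_lt haδ))
    rw [dist_comm] at h1
    linarith [dist_triangle (w n x) (v x) (v 0)]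
  have hvτ : ∀ x ∈ Ioc 0 a, ∀ τ ∈ Ioo 0 x, v x - v 0 ≤ -K * (x - τ) := by
    intro x hx τ hτ
    have hlim : Tendsto (fun n => w n x - w n 0) atTop (𝓝 (v x - v 0)) :=
      (hconv.tendsto_at (hsub ⟨hx.1.le, hx.2⟩)).sub (hconv.tendsto_at h0)
    have hεsmall : ∀ᶠ n in atTop, ε n < c * τ / K :=
      hεlim.eventually_lt_const (div_pos (mul_pos hc hτ.1) hK)
    refine le_of_tendsto_of_frequently hlim ?_
    refine (hslope.and_eventually (hclose.and hεsmall)).mono ?_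
    rintro n ⟨hn0, hnF, hnε⟩
    refine sub_le_of_slope_decreasing hτ.1 hK (g' := g' n)
      (fun y hy => (hw n y (hsub hy)).mono hsub) (fun y hy => (hg n y (hsub hy)).mono hsub)
      (fun y hy hyK => ?_) hn0 ⟨hτ.2.le, hx.2⟩
    have h1 := hnF y hy _ (abs_le.1 hyK)
    rw [← hode n y (hsub hy)] at h1
    rw [lt_div_iff₀ hK] at hnε
    rw [lt_neg, div_lt_iff₀ hτ.1]
    by_contra! hcon
    nlinarith [hεpos n, hτ.1, mul_le_mul_of_nonneg_left hcon (hεpos n).le]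
  have hvx : ∀ x ∈ Ioc 0 a, v x - v 0 ≤ -K * x := by
    intro x hx
    have hlim : Tendsto (fun τ : ℝ => -K * (x - τ)) (𝓝[>] 0) (𝓝 (-K * (x - 0))) :=
      (Continuous.tendsto (by fun_prop) 0).mono_left nhdsWithin_le_nhds
    rw [sub_zero] at hlim
    refine ge_of_tendsto hlim ?_
    filter_upwards [Ioo_mem_nhdsGT hx.1] with τ hτ using hvτ x hx τ hτ
  have hφ' : Tendsto (slope φ 0) (𝓝[>] 0) (𝓝 q) := by
    have : HasDerivWithinAt φ q (Ioi 0) 0 :=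
      (hφ.mono_of_mem_nhdsWithin (Icc_mem_nhdsGE hl)).mono Ioi_subset_Ici_self
    rwa [hasDerivWithinAt_iff_tendsto_slope' self_notMem_Ioi] at this
  have hqle : q ≤ -K := by
    refine le_of_tendsto hφ' ?_
    filter_upwards [hmin, Ioo_mem_nhdsGT ha] with x hx hxa
    rw [slope_def_field, sub_zero, div_le_iff₀ hxa.1]
    linarith [hvx x ⟨hxa.1, hxa.2.le⟩]
  linarith [neg_abs_le q]

namespace Network

variable {N : Network}

theorem IsC2.hasDerivWithinAt {u : N.J → ℝ → ℝ} (hu : N.IsC2 u) (j : N.J) {x : ℝ}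
    (hx : x ∈ N.edge j) : HasDerivWithinAt (u j) (N.pd u j x) (N.edge j) x :=
  ((hu.2 j).differentiableOn (by norm_num) x hx).hasDerivWithinAt

theorem IsC2.contDiffOn_pd {u : N.J → ℝ → ℝ} (hu : N.IsC2 u) (j : N.J) :
    ContDiffOn ℝ 1 (N.pd u j) (N.edge j) :=
  (hu.2 j).derivWithin (uniqueDiffOn_Icc (N.l_pos j)) (by norm_num)

theorem IsC2.hasDerivWithinAt_pd {u : N.J → ℝ → ℝ} (hu : N.IsC2 u) (j : N.J) {x : ℝ}
    (hx : x ∈ N.edge j) : HasDerivWithinAt (N.pd u j) (N.pd2 u j x) (N.edge j) x :=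
  ((hu.contDiffOn_pd j).differentiableOn (by norm_num) x hx).hasDerivWithinAt

/-- A `C²` solution of the viscous equation in the interior of an edge solves it up to the
endpoints. -/
theorem IsC2.viscous_eq_on_edge {H : N.J → ℝ → ℝ → ℝ → ℝ} (hH0 : N.H0 H) {u : N.J → ℝ → ℝ}
    (hu : N.IsC2 u) {ε : ℝ} {j : N.J}
    (hsol : ∀ x ∈ Ioo (0 : ℝ) (N.l j), -ε * N.pd2 u j x + H j x (u j x) (N.pd u j x) = 0) :
    ∀ x ∈ N.edge j, ε * N.pd2 u j x = H j x (u j x) (N.pd u j x) := by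
  have hpd2 : ContinuousOn (N.pd2 u j) (N.edge j) :=
    (hu.contDiffOn_pd j).continuousOn_derivWithin (uniqueDiffOn_Icc (N.l_pos j)) le_rfl
  have hHc : ContinuousOn (fun x => H j x (u j x) (N.pd u j x)) (N.edge j) :=
    (hH0 j).comp (f := fun x => (x, u j x, N.pd u j x))
      (continuousOn_id.prodMk ((hu.2 j).continuousOn.prodMk (hu.contDiffOn_pd j).continuousOn))
      (fun x hx => ⟨hx, mem_univ _, mem_univ _⟩)
  have heq : EqOn (fun x => ε * N.pd2 u j x) (fun x => H j x (u j x) (N.pd u j x))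
      (Ioo 0 (N.l j)) := fun x hx => by
    have := hsol x hx
    simp only
    linarith
  exact heq.of_subset_closure (continuousOn_const.mul hpd2) hHc Ioo_subset_Icc_self
    (closure_Ioo (N.l_pos j).ne).ge

end Network

open Network in
/-- **Lemma 5.5** (supersolution inequality at a transition vertex along an edge with
nonpositive outgoing slopes). -/
theorem supersolution_inequality_at_vertex
    (N : Network) (H : N.J → ℝ → ℝ → ℝ → ℝ)
    (hH0 : N.H0 H) (hH1 : N.H1 H) (hH3 : N.H3 H) (hH4 : N.H4 H)
    (hH5 : N.H5 H) (hH6 : N.H6 H)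
    (β : N.I → N.J → ℝ)
    (hβ : ∀ i ∈ N.IT, ∀ j ∈ N.Inc i, 0 < β i j)
    (ε : ℕ → ℝ) (hεpos : ∀ n, 0 < ε n)
    (hεlim : Filter.Tendsto ε Filter.atTop (nhds 0))
    (u : ℕ → N.J → ℝ → ℝ)
    (hsol : ∀ n, N.IsC2Star β (u n) ∧
      ∀ j, ∀ x ∈ Set.Ioo (0 : ℝ) (N.l j),
        -(ε n) * N.pd2 (u n) j x + H j x (u n j x) (N.pd (u n) j x) = 0)
    (hbd : ∃ C : ℝ, ∀ n, ∀ j, ∀ x ∈ N.edge j,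
      |u n j x| ≤ C ∧ |N.pd (u n) j x| ≤ C)
    (v : N.J → ℝ → ℝ) (hv : N.IsCont v)
    (hconv : ∀ j, TendstoUniformlyOn (fun n => u n j) (v j) Filter.atTop (N.edge j))
    (i : N.I) (hi : i ∈ N.IT) (j : N.J) (hj : j ∈ N.Inc i)
    (hslope : ∀ n₀ : ℕ, ∃ n ≥ n₀, N.sgn i j * N.pd (u n) j (N.param i j) ≤ 0)
    (φ : N.J → ℝ → ℝ) (hφ : N.IsC2 φ)
    (hmin : ∀ k ∈ N.Inc i, ∃ δ > 0, ∀ x ∈ N.edge k, |x - N.param i k| < δ →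
      v k (N.param i k) - φ k (N.param i k) ≤ v k x - φ k x) :
    0 ≤ H j (N.param i j) (v j (N.param i j)) (N.pd φ j (N.param i j)) := by
  have hl := N.l_pos j
  have hode := fun n => (hsol n).1.1.viscous_eq_on_edge hH0 ((hsol n).2 j)
  have hfreq : ∃ᶠ n in Filter.atTop, N.sgn i j * N.pd (u n) j (N.param i j) ≤ 0 :=
    Filter.frequently_atTop.2 hslope
  obtain ⟨δ, hδ, hδmin⟩ := hmin j hj
  have hmono := hH3 i hi j hj
  have heven := hH6 i hi j hj
  have hsmall : ∀ᶠ x in nhdsWithin (0 : ℝ) (Ioi 0), x ∈ Ioo 0 (min (N.l j) δ) :=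
    Ioo_mem_nhdsGT (lt_min hl hδ)
  by_cases hs : N.s j = i
  · simp only [sgn, param, if_pos hs, one_mul] at *
    refine nonneg_hamiltonian_at_endpoint hl (hH0 j) hmono heven hεpos hεlim
      (fun n x hx => (hsol n).1.1.hasDerivWithinAt j hx)
      (fun n x hx => (hsol n).1.1.hasDerivWithinAt_pd j hx) hode (hv.2 j) (hconv j) hfreq
      (hφ.hasDerivWithinAt j ⟨le_rfl, hl.le⟩) ?_
    filter_upwards [hsmall] with x hx
    refine hδmin x ⟨hx.1.le, (hx.2.trans_le (min_le_left _ _)).le⟩ ?_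
    rw [sub_zero, abs_of_pos hx.1]
    exact hx.2.trans_le (min_le_right _ _)
  · simp only [sgn, param, if_neg hs, neg_mul, one_mul] at *
    have hmaps : MapsTo (fun x => N.l j - x) (Icc 0 (N.l j)) (N.edge j) := fun x hx =>
      ⟨sub_nonneg.2 hx.2, sub_le_self _ hx.1⟩
    have hrefl : ∀ {f : ℝ → ℝ} {d x : ℝ}, HasDerivWithinAt f d (N.edge j) (N.l j - x) →
        HasDerivWithinAt (fun y => f (N.l j - y)) (-d) (Icc 0 (N.l j)) x := fun {f d x} hf => by
      simpa [Function.comp_def] using HasDerivWithinAt.comp x hf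
        ((hasDerivAt_id x).const_sub (N.l j)).hasDerivWithinAt hmaps
    have hFc : ContinuousOn (fun z : ℝ × ℝ × ℝ => H j (N.l j - z.1) z.2.1 (-z.2.2))
        (Icc 0 (N.l j) ×ˢ univ ×ˢ univ) :=
      (hH0 j).comp (f := fun z : ℝ × ℝ × ℝ => (N.l j - z.1, z.2.1, -z.2.2)) (by fun_prop)
        (fun z hz => ⟨hmaps hz.1, mem_univ _, mem_univ _⟩)
    have key := nonneg_hamiltonian_at_endpoint (F := fun x r p => H j (N.l j - x) r (-p)) hl hFc
      (fun r => by simpa only [sub_zero, ← heven] using hmono r)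
      (fun r p => by simpa only [sub_zero] using heven r (-p)) hεpos hεlim
      (w := fun n x => u n j (N.l j - x)) (g := fun n x => -N.pd (u n) j (N.l j - x))
      (g' := fun n x => N.pd2 (u n) j (N.l j - x)) (v := fun x => v j (N.l j - x))
      (φ := fun x => φ j (N.l j - x))
      (fun n x hx => hrefl ((hsol n).1.1.hasDerivWithinAt j (hmaps hx)))
      (fun n x hx => by
        simpa [Pi.neg_def] using (hrefl ((hsol n).1.1.hasDerivWithinAt_pd j (hmaps hx))).neg)
      (fun n x hx => by simpa using hode n _ (hmaps hx))
      ((hv.2 j).comp (by fun_prop) hmaps) (((hconv j).comp _).mono hmaps)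
      (by simpa using hfreq)
      (hrefl (hφ.hasDerivWithinAt j (hmaps ⟨le_rfl, hl.le⟩))) ?_
    · simpa using key
    filter_upwards [hsmall] with x hx
    simp only [sub_zero]
    refine hδmin _ (hmaps ⟨hx.1.le, (hx.2.trans_le (min_le_left _ _)).le⟩) ?_
    rw [sub_sub_cancel_left, abs_neg, abs_of_pos hx.1]
    exact hx.2.trans_le (min_le_right _ _)
end
end

section
/- ODE propagation of large slopes (claim (3.11) in the proof of Theorem 4.3). Let t₀ > 0, θ > 0, M > 0, C₁ > 0 and 0 < ε < 1. Let h : [0,t₀]×ℝ×ℝ → ℝ be continuous and satisfy h(t,r,p) > θ whenever t ∈ [0,t₀], r ≥ −C₁ and |p| > M. Let f ∈ C²([0,t₀]) satisfy ε f''(t) = h(t, f(t), f'(t)) for all t ∈ [0,t₀], f(t) ≥ −C₁ for all t ∈ [0,t₀], and f'(0) > M. Then f'(t) > M and f''(t) > θ for every t ∈ [0,t₀]; in particular f(t) ≥ f(0) + f'(0) t + (θ/2) t² for all t ∈ [0,t₀]. -/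
open Set

/-- A function whose derivative within `[a, c]` is nonnegative on `(a, b)`, where `a ≤ b ≤ c`,
satisfies `F a ≤ F b`. -/
theorem apply_left_le_of_hasDerivWithinAt_nonneg {F F' : ℝ → ℝ} {a b c : ℝ} (hab : a ≤ b)
    (hbc : b ≤ c) (hF : ∀ t ∈ Icc a c, HasDerivWithinAt F (F' t) (Icc a c) t)
    (hF' : ∀ t ∈ Ioo a b, 0 ≤ F' t) : F a ≤ F b := by
  have hsub : Icc a b ⊆ Icc a c := Icc_subset_Icc_right hbc
  refine monotoneOn_of_hasDerivWithinAt_nonneg (convex_Icc a b) (f' := F')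
    (fun t ht => ((hF t (hsub ht)).mono hsub).continuousWithinAt)
    (fun t ht => (hF t (hsub (interior_subset ht))).mono (interior_subset.trans hsub))
    (fun t ht => hF' t (by rwa [interior_Icc] at ht)) (left_mem_Icc.2 hab) (right_mem_Icc.2 hab) hab

/-- **Claim (3.11)** in the proof of Theorem 4.3 (ODE propagation of large slopes). -/
theorem ode_propagation_of_large_slopes
    (t₀ θ M C₁ ε : ℝ) (ht₀ : 0 < t₀) (hθ : 0 < θ) (hM : 0 < M) (hC₁ : 0 < C₁)
    (hε0 : 0 < ε) (hε1 : ε < 1)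
    (h : ℝ → ℝ → ℝ → ℝ)
    (hcont : ContinuousOn (fun q : ℝ × ℝ × ℝ => h q.1 q.2.1 q.2.2)
      ((Icc 0 t₀) ×ˢ (univ : Set ℝ) ×ˢ (univ : Set ℝ)))
    (hbig : ∀ t ∈ Icc (0 : ℝ) t₀, ∀ r : ℝ, -C₁ ≤ r → ∀ p : ℝ, M < |p| → θ < h t r p)
    (f : ℝ → ℝ) (hf : ContDiffOn ℝ 2 f (Icc 0 t₀))
    (hode : ∀ t ∈ Icc (0 : ℝ) t₀,
      ε * derivWithin (derivWithin f (Icc 0 t₀)) (Icc 0 t₀) t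
        = h t (f t) (derivWithin f (Icc 0 t₀) t))
    (hlow : ∀ t ∈ Icc (0 : ℝ) t₀, -C₁ ≤ f t)
    (hf'0 : M < derivWithin f (Icc 0 t₀) 0) :
    (∀ t ∈ Icc (0 : ℝ) t₀, M < derivWithin f (Icc 0 t₀) t ∧
      θ < derivWithin (derivWithin f (Icc 0 t₀)) (Icc 0 t₀) t) ∧
    (∀ t ∈ Icc (0 : ℝ) t₀,
      f 0 + derivWithin f (Icc 0 t₀) 0 * t + θ / 2 * t ^ 2 ≤ f t) := by
  have hu : UniqueDiffOn ℝ (Icc 0 t₀) := uniqueDiffOn_Icc ht₀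
  have hf1 : ∀ t ∈ Icc 0 t₀, HasDerivWithinAt f (derivWithin f (Icc 0 t₀) t) (Icc 0 t₀) t :=
    fun t ht => (hf.differentiableOn two_ne_zero t ht).hasDerivWithinAt
  have hf2 : ∀ t ∈ Icc 0 t₀, HasDerivWithinAt (derivWithin f (Icc 0 t₀))
      (derivWithin (derivWithin f (Icc 0 t₀)) (Icc 0 t₀) t) (Icc 0 t₀) t := fun t ht =>
    ((hf.derivWithin hu (m := 1) (by norm_num)).differentiableOn one_ne_zero t ht).hasDerivWithinAt
  set g := derivWithin f (Icc 0 t₀)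
  set g' := derivWithin g (Icc 0 t₀)
  have hstep : ∀ t ∈ Icc 0 t₀, M < g t → θ < g' t := by
    intro t ht hgt
    have hlt := hbig t ht (f t) (hlow t ht) (g t) (hgt.trans_le (le_abs_self _))
    rw [← hode t ht] at hlt
    have hpos : 0 < g' t := pos_of_mul_pos_right (hθ.trans hlt) hε0.le
    nlinarith
  have hslope : ∀ t ∈ Icc 0 t₀, M < g t := by
    by_contra! hne
    obtain ⟨t, ht, htM⟩ := hne
    have hclosed : IsClosed (Icc 0 t₀ ∩ g ⁻¹' Iic M) :=
      ContinuousOn.preimage_isClosed_of_isClosed (fun x hx => (hf2 x hx).continuousWithinAt)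
        isClosed_Icc isClosed_Iic
    obtain ⟨s, ⟨hs, hsM⟩, hmin⟩ :=
      (isCompact_Icc.of_isClosed_subset hclosed inter_subset_left).exists_isLeast ⟨t, ht, htM⟩
    refine (hf'0.trans_le ?_).not_ge hsM
    refine apply_left_le_of_hasDerivWithinAt_nonneg hs.1 hs.2 hf2 fun x hx => ?_
    have hxI : x ∈ Icc 0 t₀ := ⟨hx.1.le, hx.2.le.trans hs.2⟩
    refine (hθ.trans (hstep x hxI ?_)).le
    by_contra! hxM
    exact hx.2.not_ge (hmin ⟨hxI, hxM⟩)
  have hcurv : ∀ t ∈ Icc 0 t₀, θ < g' t := fun t ht => hstep t ht (hslope t ht)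
  refine ⟨fun t ht => ⟨hslope t ht, hcurv t ht⟩, fun t ht => ?_⟩
  have hgrow : ∀ x ∈ Icc 0 t₀, g 0 + θ * x ≤ g x := by
    intro x hx
    have := apply_left_le_of_hasDerivWithinAt_nonneg (F := fun y => g y - θ * y) hx.1 hx.2
      (fun y hy => (hf2 y hy).sub ((hasDerivWithinAt_id y _).const_mul θ))
      (fun y hy => by linarith [hcurv y ⟨hy.1.le, hy.2.le.trans hx.2⟩])
    simp only [mul_zero, sub_zero] at this
    linarith
  have := apply_left_le_of_hasDerivWithinAt_nonneg
    (F := fun y => f y - (g 0 * y + θ / 2 * y ^ 2)) ht.1 ht.2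
    (fun y hy => (hf1 y hy).sub (((hasDerivWithinAt_id y _).const_mul (g 0)).add
      (((hasDerivAt_pow 2 y).hasDerivWithinAt).const_mul (θ / 2))))
    (fun y hy => by
      have := hgrow y ⟨hy.1.le, hy.2.le.trans ht.2⟩
      norm_num
      linarith)
  norm_num at this
  linarith
end

section
/- Vanishing viscosity limit for the eikonal equation on a network (Section 6, Facts 2–4). Let f be a function on Γ such that each f^j is Lipschitz continuous on [0,l_j] and f(x) ≥ α for all x, for some constant α > 0. Let β = (β_{ij}) with β_{ij} > 0 for all i ∈ I_T, j ∈ Inc_i. Then: (a) for every ε > 0 there exists a unique classical solution u_ε ∈ C²_{*,β}(Γ) of −ε ∂²_j u_ε(x) + (∂_j u_ε(x))² = (f^j(x))² on (0,l_j) for all j ∈ J, with u_ε(v_i) = 0 for all i ∈ I_B; (b) as ε → 0⁺ the functions u_ε converge uniformly on Γ to the unique viscosity solution u of the eikonal equation |∂u| = f on Γ (i.e., of H^j(x,r,p) := |p| − f^j(x)) satisfying u(v_i) = 0 for all i ∈ I_B. -/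
open Set

noncomputable section

namespace Network

variable (N : Network)

/-- `u ∈ USC(Γ)`. -/
def IsUSC (u : N.J → ℝ → ℝ) : Prop :=
  N.Compat u ∧ ∀ j, UpperSemicontinuousOn (u j) (N.edge j)

/-- `u ∈ LSC(Γ)`. -/
def IsLSC (u : N.J → ℝ → ℝ) : Prop :=
  N.Compat u ∧ ∀ j, LowerSemicontinuousOn (u j) (N.edge j)

/-- `φ` is a `(j,k)`-test function at the transition vertex `i`. -/
def IsTestJK (φ : N.J → ℝ → ℝ) (i : N.I) (j k : N.J) : Prop :=
  N.IsCont φ ∧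
  DifferentiableWithinAt ℝ (φ j) (N.edge j) (N.param i j) ∧
  DifferentiableWithinAt ℝ (φ k) (N.edge k) (N.param i k) ∧
  N.sgn i j * N.pd φ j (N.param i j) + N.sgn i k * N.pd φ k (N.param i k) = 0

/-- `w` has a local maximum at the vertex `i` relative to `ē_j ∪ ē_k`. -/
def LocalMaxVertex (w : N.J → ℝ → ℝ) (i : N.I) (j k : N.J) : Prop :=
  ∃ δ > 0, (∀ x ∈ N.edge j, |x - N.param i j| < δ → w j x ≤ w j (N.param i j)) ∧
           (∀ x ∈ N.edge k, |x - N.param i k| < δ → w k x ≤ w k (N.param i k))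

/-- `w` has a local minimum at the vertex `i` relative to `ē_j ∪ ē_k`. -/
def LocalMinVertex (w : N.J → ℝ → ℝ) (i : N.I) (j k : N.J) : Prop :=
  ∃ δ > 0, (∀ x ∈ N.edge j, |x - N.param i j| < δ → w j (N.param i j) ≤ w j x) ∧
           (∀ x ∈ N.edge k, |x - N.param i k| < δ → w k (N.param i k) ≤ w k x)

/-- `u` is a viscosity subsolution of `H(x,u,∂u) = 0` on `Γ`. -/
def IsSubsol (H : N.J → ℝ → ℝ → ℝ → ℝ) (u : N.J → ℝ → ℝ) : Prop :=
  N.IsUSC u ∧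
  (∀ j : N.J, ∀ y ∈ Ioo 0 (N.l j), ∀ φ : N.J → ℝ → ℝ, N.IsCont φ →
    DifferentiableWithinAt ℝ (φ j) (N.edge j) y →
    (∃ δ > 0, ∀ x ∈ N.edge j, |x - y| < δ → u j x - φ j x ≤ u j y - φ j y) →
    H j y (u j y) (N.pd φ j y) ≤ 0) ∧
  (∀ i ∈ N.IT, ∀ j ∈ N.Inc i, ∀ k ∈ N.Inc i, j ≠ k →
    ∀ φ : N.J → ℝ → ℝ, N.IsTestJK φ i j k →
    N.LocalMaxVertex (fun m x => u m x - φ m x) i j k →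
    H j (N.param i j) (u j (N.param i j)) (N.pd φ j (N.param i j)) ≤ 0)

/-- `u` is a viscosity supersolution of `H(x,u,∂u) = 0` on `Γ`. -/
def IsSupersol (H : N.J → ℝ → ℝ → ℝ → ℝ) (u : N.J → ℝ → ℝ) : Prop :=
  N.IsLSC u ∧
  (∀ j : N.J, ∀ y ∈ Ioo 0 (N.l j), ∀ φ : N.J → ℝ → ℝ, N.IsCont φ →
    DifferentiableWithinAt ℝ (φ j) (N.edge j) y →
    (∃ δ > 0, ∀ x ∈ N.edge j, |x - y| < δ → u j y - φ j y ≤ u j x - φ j x) →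
    0 ≤ H j y (u j y) (N.pd φ j y)) ∧
  (∀ i ∈ N.IT, ∀ j ∈ N.Inc i, ∃ k ∈ N.Inc i, k ≠ j ∧
    ∀ φ : N.J → ℝ → ℝ, N.IsTestJK φ i j k →
    N.LocalMinVertex (fun m x => u m x - φ m x) i j k →
    0 ≤ H j (N.param i j) (u j (N.param i j)) (N.pd φ j (N.param i j)))

/-- `u` is a viscosity solution of `H(x,u,∂u) = 0` on `Γ`. -/
def IsViscSol (H : N.J → ℝ → ℝ → ℝ → ℝ) (u : N.J → ℝ → ℝ) : Prop :=
  N.IsCont u ∧ N.IsSubsol H u ∧ N.IsSupersol H u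

end Network

/-- `u` is a classical solution of the viscous eikonal problem
`-ε ∂²u + (∂u)² = f²` with Kirchhoff conditions and zero boundary data. -/
def Network.EikViscSol (N : Network) (f : N.J → ℝ → ℝ) (β : N.I → N.J → ℝ) (ε : ℝ)
    (u : N.J → ℝ → ℝ) : Prop :=
  N.IsC2Star β u ∧
  (∀ j, ∀ x ∈ Set.Ioo (0 : ℝ) (N.l j),
    -ε * N.pd2 u j x + (N.pd u j x) ^ 2 = (f j x) ^ 2) ∧
  (∀ i ∈ N.IB, ∀ j ∈ N.Inc i, u j (N.param i j) = 0)

/-- A function with nonnegative derivative on `(a, b)` is monotone on `[a, b]`. -/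
lemma monotoneOn_Icc_of_hasDerivAt {h h' : ℝ → ℝ} {a b : ℝ} (hc : ContinuousOn h (Icc a b))
    (hd : ∀ x ∈ Ioo a b, HasDerivAt h (h' x) x) (h0 : ∀ x ∈ Ioo a b, 0 ≤ h' x) :
    MonotoneOn h (Icc a b) :=
  monotoneOn_of_hasDerivWithinAt_nonneg (convex_Icc a b) hc
    (fun x hx => (hd x (by simpa using hx)).hasDerivWithinAt) (fun x hx => h0 x (by simpa using hx))

/-- A function with nonpositive derivative on `(a, b)` is antitone on `[a, b]`. -/
lemma antitoneOn_Icc_of_hasDerivAt {h h' : ℝ → ℝ} {a b : ℝ} (hc : ContinuousOn h (Icc a b))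
    (hd : ∀ x ∈ Ioo a b, HasDerivAt h (h' x) x) (h0 : ∀ x ∈ Ioo a b, h' x ≤ 0) :
    AntitoneOn h (Icc a b) :=
  antitoneOn_of_hasDerivWithinAt_nonpos (convex_Icc a b) hc
    (fun x hx => (hd x (by simpa using hx)).hasDerivWithinAt) (fun x hx => h0 x (by simpa using hx))

/-- A function with negative derivative on `(a, b)` is strictly antitone on `[a, b]`. -/
lemma strictAntiOn_Icc_of_hasDerivAt {h h' : ℝ → ℝ} {a b : ℝ} (hc : ContinuousOn h (Icc a b))
    (hd : ∀ x ∈ Ioo a b, HasDerivAt h (h' x) x) (h0 : ∀ x ∈ Ioo a b, h' x < 0) :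
    StrictAntiOn h (Icc a b) :=
  strictAntiOn_of_hasDerivWithinAt_neg (convex_Icc a b) hc
    (fun x hx => (hd x (by simpa using hx)).hasDerivWithinAt) (fun x hx => h0 x (by simpa using hx))

/-- `w` solves `w'' = q w` on `(a, b)`, where `w` and its derivative `p` extend continuously
to `[a, b]`. -/
structure EdgeSol (q : ℝ → ℝ) (a b : ℝ) (w p : ℝ → ℝ) : Prop where
  contW : ContinuousOn w (Icc a b)
  contP : ContinuousOn p (Icc a b)
  derivW : ∀ x ∈ Ioo a b, HasDerivAt w (p x) x
  derivP : ∀ x ∈ Ioo a b, HasDerivAt p (q x * w x) x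

namespace EdgeSol

variable {q w p w₁ p₁ : ℝ → ℝ} {a b a' b' : ℝ}

lemma mono (h : EdgeSol q a b w p) (ha : a ≤ a') (hb : b' ≤ b) : EdgeSol q a' b' w p :=
  ⟨h.contW.mono (Icc_subset_Icc ha hb), h.contP.mono (Icc_subset_Icc ha hb),
    fun x hx => h.derivW x (Ioo_subset_Ioo ha hb hx),
    fun x hx => h.derivP x (Ioo_subset_Ioo ha hb hx)⟩

lemma reflect (h : EdgeSol q a b w p) :
    EdgeSol (fun x => q (-x)) (-b) (-a) (fun x => w (-x)) (fun x => -p (-x)) := by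
  have hmem : ∀ x ∈ Icc (-b) (-a), -x ∈ Icc a b := fun x hx =>
    ⟨by linarith [hx.2], by linarith [hx.1]⟩
  have hmem' : ∀ x ∈ Ioo (-b) (-a), -x ∈ Ioo a b := fun x hx =>
    ⟨by linarith [hx.2], by linarith [hx.1]⟩
  refine ⟨h.contW.comp continuous_neg.continuousOn hmem,
    (h.contP.comp continuous_neg.continuousOn hmem).neg, fun x hx => ?_, fun x hx => ?_⟩
  · have := (h.derivW _ (hmem' x hx)).comp x (hasDerivAt_neg x)
    simpa [Function.comp_def] using this
  · have := ((h.derivP _ (hmem' x hx)).comp x (hasDerivAt_neg x)).fun_neg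
    simpa [Function.comp_def] using this

lemma neg (h : EdgeSol q a b w p) : EdgeSol q a b (fun x => -w x) (fun x => -p x) :=
  ⟨h.contW.neg, h.contP.neg, fun x hx => (h.derivW x hx).neg,
    fun x hx => by simpa using (h.derivP x hx).fun_neg⟩

lemma lincomb (h : EdgeSol q a b w p) (h₁ : EdgeSol q a b w₁ p₁) (c d : ℝ) :
    EdgeSol q a b (fun x => c * w x + d * w₁ x) (fun x => c * p x + d * p₁ x) :=
  ⟨(h.contW.const_mul c).add (h₁.contW.const_mul d),
    (h.contP.const_mul c).add (h₁.contP.const_mul d),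
    fun x hx => ((h.derivW x hx).const_mul c).add ((h₁.derivW x hx).const_mul d),
    fun x hx => by
      exact (((h.derivP x hx).const_mul c).add ((h₁.derivP x hx).const_mul d)).congr_deriv
        (by ring)⟩

end EdgeSol

/-- The squared positive part is differentiable. -/
lemma hasDerivAt_sq_max_zero (x : ℝ) : HasDerivAt (fun y : ℝ => (max y 0) ^ 2) (2 * max x 0) x := by
  rcases lt_trichotomy x 0 with hx | rfl | hx
  · rw [max_eq_right hx.le, mul_zero]
    refine (hasDerivAt_const x (0 : ℝ)).congr_of_eventuallyEq ?_
    filter_upwards [Iio_mem_nhds hx] with y hy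
    rw [max_eq_right (le_of_lt hy)]; norm_num
  · rw [max_self, mul_zero, hasDerivAt_iff_isLittleO_nhds_zero]
    simp only [zero_add, max_self, smul_zero, sub_zero]
    refine Asymptotics.IsBigO.trans_isLittleO (g := fun y : ℝ => y ^ 2) ?_ ?_
    · refine Asymptotics.IsBigO.of_bound 1 (Filter.Eventually.of_forall fun y => ?_)
      simp only [norm_pow, Real.norm_eq_abs, one_mul, sq_abs]
      rcases le_total y 0 with hy | hy
      · rw [max_eq_right hy]; simpa using sq_nonneg y
      · rw [max_eq_left hy]; simp
    · simpa using Asymptotics.isLittleO_pow_id (𝕜 := ℝ) (n := 2) (by norm_num)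
  · rw [max_eq_left hx.le]
    have : HasDerivAt (fun y : ℝ => y ^ 2) (2 * x) x := by simpa using hasDerivAt_pow 2 x
    refine this.congr_of_eventuallyEq ?_
    filter_upwards [Ioi_mem_nhds hx] with y hy
    rw [max_eq_left (le_of_lt hy)]

namespace EdgeSol

variable {q w p w₁ p₁ : ℝ → ℝ} {a b : ℝ}

/-- Nonpositive initial data propagate forward. -/
lemma nonpos_of_init (h : EdgeSol q a b w p) {Q : ℝ} (hq : ∀ x ∈ Ioo a b, 0 ≤ q x ∧ q x ≤ Q)
    (hw : w a ≤ 0) (hp : p a ≤ 0) : ∀ x ∈ Icc a b, w x ≤ 0 ∧ p x ≤ 0 := by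
  intro x hx
  have hab : a ≤ b := hx.1.trans hx.2
  set E : ℝ → ℝ := fun x => ((max (w x) 0) ^ 2 + (max (p x) 0) ^ 2) * Real.exp (-(1 + Q) * x)
    with hE
  have hder : ∀ x ∈ Ioo a b, HasDerivAt E
      ((2 * max (w x) 0 * p x + 2 * max (p x) 0 * (q x * w x)) * Real.exp (-(1 + Q) * x) +
        ((max (w x) 0) ^ 2 + (max (p x) 0) ^ 2) * (Real.exp (-(1 + Q) * x) * (-(1 + Q)))) x := by
    intro x hx
    have h1 := (hasDerivAt_sq_max_zero (w x)).comp x (h.derivW x hx)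
    have h2 := (hasDerivAt_sq_max_zero (p x)).comp x (h.derivP x hx)
    have h3 : HasDerivAt (fun y => Real.exp (-(1 + Q) * y))
        (Real.exp (-(1 + Q) * x) * (-(1 + Q))) x := by
      simpa using ((hasDerivAt_id x).const_mul (-(1 + Q))).exp
    exact (h1.add h2).mul h3
  have hanti : AntitoneOn E (Icc a b) := by
    refine antitoneOn_Icc_of_hasDerivAt ?_ hder ?_
    · have hmax : Continuous fun y : ℝ => (max y 0) ^ 2 := by fun_prop
      exact ((hmax.comp_continuousOn h.contW).add (hmax.comp_continuousOn h.contP)).mul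
        (by fun_prop)
    · intro x hx
      obtain ⟨hq0, hqQ⟩ := hq x hx
      have key : 2 * max (w x) 0 * p x + 2 * max (p x) 0 * (q x * w x) ≤
          (1 + Q) * ((max (w x) 0) ^ 2 + (max (p x) 0) ^ 2) := by
        set W := max (w x) 0
        set P := max (p x) 0
        have hW : 0 ≤ W := le_max_right _ _
        have hP : 0 ≤ P := le_max_right _ _
        have h1 : W * p x ≤ W * P := mul_le_mul_of_nonneg_left (le_max_left _ _) hW
        have h2 : q x * w x ≤ q x * W := mul_le_mul_of_nonneg_left (le_max_left _ _) hq0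
        have h3 : P * (q x * w x) ≤ P * (Q * W) :=
          mul_le_mul_of_nonneg_left (h2.trans (mul_le_mul_of_nonneg_right hqQ hW)) hP
        have h4 : 2 * (W * P) ≤ W ^ 2 + P ^ 2 := by nlinarith [sq_nonneg (W - P)]
        have h5 : (1 + Q) * (2 * (W * P)) ≤ (1 + Q) * (W ^ 2 + P ^ 2) :=
          mul_le_mul_of_nonneg_left h4 (by linarith)
        nlinarith
      have := mul_le_mul_of_nonneg_right key (Real.exp_pos (-(1 + Q) * x)).le
      linarith
  have hEa : E a = 0 := by simp [hE, max_eq_right hw, max_eq_right hp]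
  have hEx : E x ≤ 0 := hEa ▸ hanti (left_mem_Icc.2 hab) hx hx.1
  have hsum : (max (w x) 0) ^ 2 + (max (p x) 0) ^ 2 ≤ 0 := by
    by_contra hcon
    exact absurd hEx (not_le.2 (mul_pos (not_le.1 hcon) (Real.exp_pos _)))
  constructor
  · by_contra hcon
    have : 0 < max (w x) 0 := lt_max_of_lt_left (not_le.1 hcon)
    nlinarith [sq_nonneg (max (p x) 0)]
  · by_contra hcon
    have : 0 < max (p x) 0 := lt_max_of_lt_left (not_le.1 hcon)
    nlinarith [sq_nonneg (max (w x) 0)]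

lemma eq_zero_of_init (h : EdgeSol q a b w p) {Q : ℝ} (hq : ∀ x ∈ Ioo a b, 0 ≤ q x ∧ q x ≤ Q)
    (hw : w a = 0) (hp : p a = 0) : ∀ x ∈ Icc a b, w x = 0 := by
  intro x hx
  have h1 := (h.nonpos_of_init hq hw.le hp.le x hx).1
  have h2 := (h.neg.nonpos_of_init hq (by simp [hw]) (by simp [hp]) x hx).1
  linarith

lemma antitoneOn_of_nonpos (h : EdgeSol q a b w p) (hp : ∀ x ∈ Ioo a b, p x ≤ 0) :
    AntitoneOn w (Icc a b) := antitoneOn_Icc_of_hasDerivAt h.contW h.derivW hp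

lemma nonneg_reflect {Q : ℝ} (hq : ∀ x ∈ Ioo a b, 0 ≤ q x ∧ q x ≤ Q) :
    ∀ x ∈ Ioo (-b) (-a), 0 ≤ q (-x) ∧ q (-x) ≤ Q :=
  fun x hx => hq (-x) ⟨by linarith [hx.2], by linarith [hx.1]⟩

/-- A solution which is positive at both ends is positive. -/
lemma pos_of_ends (h : EdgeSol q a b w p) {Q : ℝ} (hq : ∀ x ∈ Ioo a b, 0 ≤ q x ∧ q x ≤ Q)
    (ha : 0 < w a) (hb : 0 < w b) : ∀ x ∈ Icc a b, 0 < w x := by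
  intro x hx
  by_contra hcon
  rw [not_lt] at hcon
  rcases le_total (p x) 0 with hp | hp
  · have := ((h.mono hx.1 le_rfl).nonpos_of_init
      (fun y hy => hq y ⟨hx.1.trans_lt hy.1, hy.2⟩) hcon hp b (right_mem_Icc.2 hx.2)).1
    linarith
  · have h' := (h.mono le_rfl hx.2).reflect
    have := (h'.nonpos_of_init (nonneg_reflect (fun y hy => hq y ⟨hy.1, hy.2.trans_le hx.2⟩))
      (by simpa using hcon) (by simpa using hp) (-a)
      (right_mem_Icc.2 (by linarith [hx.1]))).1
    simp at this
    linarith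

lemma eq_zero_of_ends (h : EdgeSol q a b w p) {Q : ℝ} (hq : ∀ x ∈ Ioo a b, 0 ≤ q x ∧ q x ≤ Q)
    (ha : w a = 0) (hb : w b = 0) : ∀ x ∈ Icc a b, w x = 0 := by
  have key : ∀ w p : ℝ → ℝ, EdgeSol q a b w p → w a = 0 → w b = 0 → p a ≤ 0 →
      ∀ x ∈ Icc a b, w x = 0 := by
    intro w p h ha hb hp x hx
    have h1 := h.nonpos_of_init hq ha.le hp
    have hanti := h.antitoneOn_of_nonpos fun y hy => (h1 y (Ioo_subset_Icc_self hy)).2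
    have := hanti hx (right_mem_Icc.2 (hx.1.trans hx.2)) hx.2
    linarith [(h1 x hx).1]
  intro x hx
  rcases le_total (p a) 0 with hp | hp
  · exact key w p h ha hb hp x hx
  · have := key _ _ h.neg (by simpa using ha) (by simpa using hb) (by simpa using hp) x hx
    simpa using this

/-- At a negative minimum over the ends, the solution increases. -/
lemma deriv_pos_of_min_neg (h : EdgeSol q a b w p) {Q : ℝ}
    (hq : ∀ x ∈ Ioo a b, 0 < q x ∧ q x ≤ Q) (hab : a < b) (ha : w a < 0) (hb : w a ≤ w b) :
    0 < p a := by
  by_contra hcon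
  rw [not_lt] at hcon
  have h1 := h.nonpos_of_init (fun x hx => ⟨(hq x hx).1.le, (hq x hx).2⟩) ha.le hcon
  have hanti := h.antitoneOn_of_nonpos fun y hy => (h1 y (Ioo_subset_Icc_self hy)).2
  have hpanti : StrictAntiOn p (Icc a b) := by
    refine strictAntiOn_Icc_of_hasDerivAt h.contP h.derivP fun x hx => ?_
    have : w x ≤ w a := hanti (left_mem_Icc.2 hab.le) (Ioo_subset_Icc_self hx) hx.1.le
    exact mul_neg_of_pos_of_neg (hq x hx).1 (by linarith)
  have hwanti : StrictAntiOn w (Icc a b) := by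
    refine strictAntiOn_Icc_of_hasDerivAt h.contW h.derivW fun x hx => ?_
    exact (hpanti (left_mem_Icc.2 hab.le) (Ioo_subset_Icc_self hx) hx.1).trans_le hcon
  exact absurd (hwanti (left_mem_Icc.2 hab.le) (right_mem_Icc.2 hab.le) hab) (not_lt.2 hb)

/-- At a zero minimum over the ends, the solution does not decrease. -/
lemma deriv_nonneg_of_min_zero (h : EdgeSol q a b w p) {Q : ℝ}
    (hq : ∀ x ∈ Ioo a b, 0 < q x ∧ q x ≤ Q) (hab : a < b) (ha : w a = 0) (hb : 0 ≤ w b) :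
    0 ≤ p a := by
  by_contra hcon
  rw [not_le] at hcon
  have h1 := h.nonpos_of_init (fun x hx => ⟨(hq x hx).1.le, (hq x hx).2⟩) ha.le hcon.le
  have hpanti : AntitoneOn p (Icc a b) := by
    refine antitoneOn_Icc_of_hasDerivAt h.contP h.derivP fun x hx => ?_
    exact mul_nonpos_of_nonneg_of_nonpos (hq x hx).1.le (h1 x (Ioo_subset_Icc_self hx)).1
  have hwanti : StrictAntiOn w (Icc a b) := by
    refine strictAntiOn_Icc_of_hasDerivAt h.contW h.derivW fun x hx => ?_
    exact (hpanti (left_mem_Icc.2 hab.le) (Ioo_subset_Icc_self hx) hx.1.le).trans_lt hcon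
  have := hwanti (left_mem_Icc.2 hab.le) (right_mem_Icc.2 hab.le) hab
  linarith

end EdgeSol

/-- `w` solves `w'' = q w` on `[0, l]`, with derivative `p` and one-sided derivatives at the
ends. -/
structure ClosedEdgeSol (q : ℝ → ℝ) (l : ℝ) (w p : ℝ → ℝ) : Prop where
  derivW : ∀ x ∈ Icc 0 l, HasDerivWithinAt w (p x) (Icc 0 l) x
  derivP : ∀ x ∈ Icc 0 l, HasDerivWithinAt p (q x * w x) (Icc 0 l) x

namespace ClosedEdgeSol

variable {q w p w₁ p₁ : ℝ → ℝ} {l : ℝ}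

lemma edgeSol (h : ClosedEdgeSol q l w p) : EdgeSol q 0 l w p :=
  ⟨fun x hx => (h.derivW x hx).continuousWithinAt, fun x hx => (h.derivP x hx).continuousWithinAt,
    fun x hx => (h.derivW x (Ioo_subset_Icc_self hx)).hasDerivAt (Icc_mem_nhds hx.1 hx.2),
    fun x hx => (h.derivP x (Ioo_subset_Icc_self hx)).hasDerivAt (Icc_mem_nhds hx.1 hx.2)⟩

lemma lincomb (h : ClosedEdgeSol q l w p) (h₁ : ClosedEdgeSol q l w₁ p₁) (c d : ℝ) :
    ClosedEdgeSol q l (fun x => c * w x + d * w₁ x) (fun x => c * p x + d * p₁ x) :=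
  ⟨fun x hx => ((h.derivW x hx).const_mul c).add ((h₁.derivW x hx).const_mul d),
    fun x hx => by
      exact (((h.derivP x hx).const_mul c).add ((h₁.derivP x hx).const_mul d)).congr_deriv
        (by ring)⟩

lemma contDiffOn (h : ClosedEdgeSol q l w p) (hl : 0 < l) (hq : Continuous q) :
    ContDiffOn ℝ 2 w (Icc 0 l) := by
  have hu := uniqueDiffOn_Icc hl
  have h1 : EqOn (derivWithin w (Icc 0 l)) p (Icc 0 l) := fun x hx =>
    (h.derivW x hx).derivWithin (hu x hx)
  have h2 : EqOn (derivWithin p (Icc 0 l)) (fun x => q x * w x) (Icc 0 l) := fun x hx =>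
    (h.derivP x hx).derivWithin (hu x hx)
  rw [show (2 : WithTop ℕ∞) = 1 + 1 by norm_num, contDiffOn_succ_iff_derivWithin hu]
  refine ⟨fun x hx => (h.derivW x hx).differentiableWithinAt, by simp, ?_⟩
  rw [contDiffOn_congr h1, contDiffOn_one_iff_derivWithin hu]
  exact ⟨fun x hx => (h.derivP x hx).differentiableWithinAt,
    (hq.continuousOn.mul h.edgeSol.contW).congr h2⟩

end ClosedEdgeSol

/-- Truncation to `[-R, R]` as a function. -/
def clampReal (R y : ℝ) : ℝ := max (-R) (min R y)

lemma abs_clampReal_le {R : ℝ} (hR : 0 ≤ R) (y : ℝ) : |clampReal R y| ≤ R := by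
  rw [abs_le]
  exact ⟨le_max_left _ _, max_le (by linarith) (min_le_left _ _)⟩

lemma abs_clampReal_le_abs {R : ℝ} (hR : 0 ≤ R) (y : ℝ) : |clampReal R y| ≤ |y| := by
  rw [abs_le]
  refine ⟨le_max_of_le_right (le_min (by linarith [abs_nonneg y]) (neg_abs_le y)),
    max_le (by linarith [abs_nonneg y]) ((min_le_right _ _).trans (le_abs_self y))⟩

lemma clampReal_eq {R y : ℝ} (h : |y| ≤ R) : clampReal R y = y := by
  rw [abs_le] at h
  rw [clampReal, min_eq_right h.2, max_eq_right h.1]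

lemma lipschitzWith_clampReal (R : ℝ) : LipschitzWith 1 (clampReal R) :=
  (LipschitzWith.id.const_min R).const_max (-R)

/-- Solvability of the initial value problem for `w'' = q w`. -/
lemma exists_closedEdgeSol {q : ℝ → ℝ} (hq : Continuous q) {Q : ℝ} (hQ : ∀ x, |q x| ≤ Q) {l : ℝ}
    (hl : 0 < l) (y₀ p₀ : ℝ) : ∃ w p, ClosedEdgeSol q l w p ∧ w 0 = y₀ ∧ p 0 = p₀ := by
  have hQ0 : 0 ≤ Q := (abs_nonneg _).trans (hQ 0)
  set C : ℝ := 1 + Q with hC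
  set z₀ : ℝ × ℝ := (y₀, p₀)
  set R : ℝ := ‖z₀‖ * Real.exp (C * l) with hRdef
  have hR : 0 ≤ R := by positivity
  set v : ℝ → ℝ × ℝ → ℝ × ℝ := fun t z => (clampReal R z.2, q t * clampReal R z.1) with hv
  have hC0 : 0 ≤ C := by positivity
  have hnorm : ∀ t z, ‖v t z‖ ≤ C * R := by
    intro t z
    rw [Prod.norm_def]
    refine max_le ?_ ?_
    · have := abs_clampReal_le hR z.2
      simp only [hv, Real.norm_eq_abs]
      nlinarith
    · have := abs_clampReal_le hR z.1
      simp only [hv, Real.norm_eq_abs, abs_mul]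
      have := mul_le_mul (hQ t) this (abs_nonneg _) hQ0
      nlinarith
  have hgrow : ∀ t z, ‖v t z‖ ≤ C * ‖z‖ := by
    intro t z
    have h1 : |z.1| ≤ ‖z‖ := norm_fst_le z
    have h2 : |z.2| ≤ ‖z‖ := norm_snd_le z
    have h0 : 0 ≤ ‖z‖ := norm_nonneg z
    rw [Prod.norm_def]
    refine max_le ?_ ?_
    · have := abs_clampReal_le_abs hR z.2
      simp only [hv, Real.norm_eq_abs]
      nlinarith
    · have := abs_clampReal_le_abs hR z.1
      simp only [hv, Real.norm_eq_abs, abs_mul]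
      have := mul_le_mul (hQ t) (this.trans h1) (abs_nonneg _) hQ0
      nlinarith
  have hlip : ∀ t, LipschitzWith (Real.toNNReal C) (v t) := by
    intro t
    refine LipschitzWith.of_dist_le_mul fun z z' => ?_
    have hd1 : |clampReal R z.1 - clampReal R z'.1| ≤ dist z z' := by
      have := (lipschitzWith_clampReal R).dist_le_mul z.1 z'.1
      rw [Real.dist_eq] at this
      refine this.trans ?_
      rw [NNReal.coe_one, one_mul]; exact le_max_left _ _
    have hd2 : |clampReal R z.2 - clampReal R z'.2| ≤ dist z z' := by
      have := (lipschitzWith_clampReal R).dist_le_mul z.2 z'.2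
      rw [Real.dist_eq] at this
      refine this.trans ?_
      rw [NNReal.coe_one, one_mul]; exact le_max_right _ _
    have h0 : 0 ≤ dist z z' := dist_nonneg
    rw [Real.coe_toNNReal _ hC0, Prod.dist_eq]
    refine max_le ?_ ?_
    · rw [Real.dist_eq]; simp only [hv]; nlinarith
    · rw [Real.dist_eq]; simp only [hv]
      rw [← mul_sub, abs_mul]
      have := mul_le_mul (hQ t) hd1 (abs_nonneg _) hQ0
      nlinarith
  have hPL : IsPicardLindelof v (⟨0, left_mem_Icc.2 hl.le⟩ : Icc (0 : ℝ) l) z₀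
      (Real.toNNReal (C * R * l)) 0 (Real.toNNReal (C * R)) (Real.toNNReal C) := by
    refine ⟨fun t _ => (hlip t).lipschitzOnWith, fun x _ => ?_, fun t _ x _ => ?_, ?_⟩
    · simp only [hv]; fun_prop
    · rw [Real.coe_toNNReal _ (by positivity)]; exact hnorm t x
    · rw [Real.coe_toNNReal _ (by positivity), Real.coe_toNNReal _ (by positivity)]
      simp [hl.le]
  obtain ⟨z, hz0, hz⟩ := hPL.exists_eq_forall_mem_Icc_hasDerivWithinAt₀
  simp only at hz0
  have hbound : ∀ t ∈ Icc 0 l, ‖z t‖ ≤ R := by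
    intro t ht
    have := norm_le_gronwallBound_of_norm_deriv_right_le (f := z) (f' := fun t => v t (z t))
      (δ := ‖z₀‖) (K := C) (ε := 0) (a := 0) (b := l)
      (fun x hx => (hz x hx).continuousWithinAt)
      (fun x hx => (hz x (Ico_subset_Icc_self hx)).mono_of_mem_nhdsWithin
        (Icc_mem_nhdsGE_of_mem hx))
      (by rw [hz0]) (fun x _ => by simpa using hgrow x (z x)) t ht
    rw [gronwallBound_ε0, sub_zero] at this
    refine this.trans ?_
    rw [hRdef]
    gcongr
    exact ht.2
  refine ⟨fun t => (z t).1, fun t => (z t).2, ⟨fun x hx => ?_, fun x hx => ?_⟩, by simp [hz0, z₀],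
    by simp [hz0, z₀]⟩
  · have := (hz x hx).fst
    simp only [hv] at this
    rwa [clampReal_eq ((norm_snd_le (z x)).trans (hbound x hx))] at this
  · have := (hz x hx).snd
    simp only [hv] at this
    rwa [clampReal_eq ((norm_fst_le (z x)).trans (hbound x hx))] at this

/-- A basis of solutions of `w'' = q w` adapted to Dirichlet data. -/
lemma exists_dirichlet_basis {q : ℝ → ℝ} (hq : Continuous q) {Q : ℝ} (hQ : ∀ x, 0 ≤ q x ∧ q x ≤ Q)
    {l : ℝ} (hl : 0 < l) : ∃ w₀ p₀ w₁ p₁, ClosedEdgeSol q l w₀ p₀ ∧ ClosedEdgeSol q l w₁ p₁ ∧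
      w₀ 0 = 1 ∧ w₀ l = 0 ∧ w₁ 0 = 0 ∧ w₁ l = 1 := by
  have habs : ∀ x, |q x| ≤ Q := fun x => by rw [abs_of_nonneg (hQ x).1]; exact (hQ x).2
  obtain ⟨y, r, hy, hy0, -⟩ := exists_closedEdgeSol hq habs hl 1 0
  obtain ⟨w, p, hw, hw0, hp0⟩ := exists_closedEdgeSol hq habs hl 0 1
  have hwl : w l ≠ 0 := by
    intro hwl
    have h0 := hw.edgeSol.eq_zero_of_ends (fun x _ => hQ x) hw0 hwl
    have h1 := hw.derivW 0 (left_mem_Icc.2 hl.le)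
    have h2 : HasDerivWithinAt w 0 (Icc 0 l) 0 :=
      (hasDerivWithinAt_const (0 : ℝ) (Icc 0 l) (0 : ℝ)).congr h0 (h0 0 (left_mem_Icc.2 hl.le))
    have := (uniqueDiffOn_Icc hl 0 (left_mem_Icc.2 hl.le)).eq_deriv _ h1 h2
    rw [hp0] at this
    exact one_ne_zero this
  refine ⟨_, _, _, _, hy.lincomb hw 1 (-(y l / w l)), hy.lincomb hw 0 (1 / w l), ?_, ?_, ?_, ?_⟩
  · simp [hy0, hw0]
  · field_simp; ring
  · simp [hw0]
  · field_simp; ring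

namespace EdgeSol

variable {q w p z z' z'' : ℝ → ℝ} {a b : ℝ}

lemma wronskian_monotoneOn (h : EdgeSol q a b w p) (hw : ∀ x ∈ Ioo a b, 0 ≤ w x)
    (hz : ∀ x, HasDerivAt z (z' x) x) (hz' : ∀ x, HasDerivAt z' (z'' x) x)
    (hle : ∀ x ∈ Ioo a b, z'' x ≤ q x * z x) :
    MonotoneOn (fun x => p x * z x - w x * z' x) (Icc a b) := by
  have hzc : Continuous z := continuous_iff_continuousAt.2 fun x => (hz x).continuousAt
  have hzc' : Continuous z' := continuous_iff_continuousAt.2 fun x => (hz' x).continuousAt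
  refine monotoneOn_Icc_of_hasDerivAt
    ((h.contP.mul hzc.continuousOn).sub (h.contW.mul hzc'.continuousOn))
    (fun x hx => ((h.derivP x hx).mul (hz x)).sub ((h.derivW x hx).mul (hz' x))) fun x hx => ?_
  have := mul_le_mul_of_nonneg_left (hle x hx) (hw x hx)
  nlinarith

lemma wronskian_antitoneOn (h : EdgeSol q a b w p) (hw : ∀ x ∈ Ioo a b, 0 ≤ w x)
    (hz : ∀ x, HasDerivAt z (z' x) x) (hz' : ∀ x, HasDerivAt z' (z'' x) x)
    (hle : ∀ x ∈ Ioo a b, q x * z x ≤ z'' x) :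
    AntitoneOn (fun x => p x * z x - w x * z' x) (Icc a b) := by
  have hzc : Continuous z := continuous_iff_continuousAt.2 fun x => (hz x).continuousAt
  have hzc' : Continuous z' := continuous_iff_continuousAt.2 fun x => (hz' x).continuousAt
  refine antitoneOn_Icc_of_hasDerivAt
    ((h.contP.mul hzc.continuousOn).sub (h.contW.mul hzc'.continuousOn))
    (fun x hx => ((h.derivP x hx).mul (hz x)).sub ((h.derivW x hx).mul (hz' x))) fun x hx => ?_
  have := mul_le_mul_of_nonneg_left (hle x hx) (hw x hx)
  nlinarith

lemma div_monotoneOn (h : EdgeSol q a b w p) (hz : ∀ x, HasDerivAt z (z' x) x)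
    (hpos : ∀ x ∈ Icc a b, 0 < z x) (hW : ∀ x ∈ Icc a b, 0 ≤ p x * z x - w x * z' x) :
    MonotoneOn (fun x => w x / z x) (Icc a b) := by
  have hzc : Continuous z := continuous_iff_continuousAt.2 fun x => (hz x).continuousAt
  refine monotoneOn_Icc_of_hasDerivAt
    (h.contW.div hzc.continuousOn fun x hx => (hpos x hx).ne')
    (fun x hx => (h.derivW x hx).div (hz x) (hpos x (Ioo_subset_Icc_self hx)).ne') fun x hx => ?_
  exact div_nonneg (hW x (Ioo_subset_Icc_self hx)) (sq_nonneg _)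

lemma div_antitoneOn (h : EdgeSol q a b w p) (hz : ∀ x, HasDerivAt z (z' x) x)
    (hpos : ∀ x ∈ Icc a b, 0 < z x) (hW : ∀ x ∈ Icc a b, p x * z x - w x * z' x ≤ 0) :
    AntitoneOn (fun x => w x / z x) (Icc a b) := by
  have hzc : Continuous z := continuous_iff_continuousAt.2 fun x => (hz x).continuousAt
  refine antitoneOn_Icc_of_hasDerivAt
    (h.contW.div hzc.continuousOn fun x hx => (hpos x hx).ne')
    (fun x hx => (h.derivW x hx).div (hz x) (hpos x (Ioo_subset_Icc_self hx)).ne') fun x hx => ?_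
  exact div_nonpos_of_nonpos_of_nonneg (hW x (Ioo_subset_Icc_self hx)) (sq_nonneg _)

end EdgeSol

/-- Smooth interpolation between two positive multiples of a continuous positive function. -/
lemma exists_smooth_between {f : ℝ → ℝ} (hf : Continuous f) {α : ℝ} (hα : 0 < α)
    (hfα : ∀ x, α ≤ f x) {r s : ℝ} (hrs : r < s) (a b : ℝ) :
    ∃ G g g' : ℝ → ℝ, ∃ D : ℝ, 0 ≤ D ∧ (∀ x, HasDerivAt G (g x) x) ∧
      (∀ x, HasDerivAt g (g' x) x) ∧
      ∀ x ∈ Icc a b, r * f x ≤ g x ∧ g x ≤ s * f x ∧ |g' x| ≤ D := by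
  obtain ⟨P, hP⟩ := exists_polynomial_near_of_continuousOn a b (fun x => (r + s) / 2 * f x)
    (by fun_prop) ((s - r) / 2 * α) (by have := sub_pos.2 hrs; positivity)
  obtain ⟨D, hD⟩ := isCompact_Icc.exists_bound_of_continuousOn (s := Icc a b)
    (f := fun x => P.derivative.eval x) (by fun_prop)
  refine ⟨fun x => ∫ y in (0 : ℝ)..x, P.eval y, fun x => P.eval x, fun x => P.derivative.eval x,
    max D 0, le_max_right _ _, fun x => ?_, fun x => P.hasDerivAt x, fun x hx => ?_⟩
  · exact intervalIntegral.integral_hasDerivAt_right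
      (P.continuous.intervalIntegrable _ _)
      (P.continuous.stronglyMeasurableAtFilter _ _)
      P.continuous.continuousAt
  · have h1 := abs_lt.1 (hP x hx)
    have h2 : (s - r) / 2 * α ≤ (s - r) / 2 * f x :=
      mul_le_mul_of_nonneg_left (hfα x) (by linarith)
    exact ⟨by linarith, by linarith, (hD x hx).trans (le_max_left _ _)⟩

/-- Comparison of increments from comparison of derivatives. -/
lemma sub_le_sub_of_hasDerivAt_le {F G f g : ℝ → ℝ} {a b : ℝ} (hF : ∀ x, HasDerivAt F (f x) x)
    (hG : ∀ x, HasDerivAt G (g x) x) (hle : ∀ x ∈ Icc a b, f x ≤ g x) {x y : ℝ} (hx : a ≤ x)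
    (hxy : x ≤ y) (hy : y ≤ b) : F y - F x ≤ G y - G x := by
  have hm : MonotoneOn (fun t => G t - F t) (Icc a b) := by
    refine monotoneOn_Icc_of_hasDerivAt (h' := fun t => g t - f t) ?_
      (fun t _ => (hG t).sub (hF t)) fun t ht => sub_nonneg.2 (hle t (Ioo_subset_Icc_self ht))
    exact fun t _ => ((hG t).sub (hF t)).continuousAt.continuousWithinAt
  have := hm ⟨hx, hxy.trans hy⟩ ⟨hx.trans hxy, hy⟩ hxy
  simp only at this
  linarith

/-- If the slope at the left end is nonnegative then the solution grows at almost the eikonal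
rate. -/
lemma exists_eps_growth_right {f F : ℝ → ℝ} (hf : Continuous f) {α : ℝ} (hα : 0 < α)
    (hfα : ∀ x, α ≤ f x) (hF : ∀ x, HasDerivAt F (f x) x) {θ : ℝ} (hθ : 0 < θ) (hθ1 : θ < 1)
    (a b : ℝ) : ∃ ε₀ > 0, ∀ ε, 0 < ε → ε < ε₀ → ∀ (x₀ : ℝ) (w p : ℝ → ℝ), a ≤ x₀ → x₀ ≤ b →
      EdgeSol (fun x => f x ^ 2 / ε ^ 2) x₀ b w p → (∀ x ∈ Icc x₀ b, 0 ≤ w x) → 0 ≤ p x₀ →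
      w x₀ * Real.exp ((1 - θ) * (F b - F x₀) / ε) ≤ 2 * w b := by
  obtain ⟨G, g, g', D, hD, hG, hg, hb⟩ := exists_smooth_between hf hα hfα
    (show 1 - θ < 1 - θ / 2 by linarith) a b
  refine ⟨α ^ 2 * θ / (2 * (D + 1)), by positivity, fun ε hε hεlt x₀ w p hax hxb h hw hp => ?_⟩
  rw [lt_div_iff₀ (by positivity)] at hεlt
  have hs : ∀ x, HasDerivAt (fun x => (G x - G x₀) / ε) (g x / ε) x := fun x =>
    ((hG x).sub_const _).div_const ε
  have hz : ∀ x, HasDerivAt (fun x => Real.cosh ((G x - G x₀) / ε))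
      (g x / ε * Real.sinh ((G x - G x₀) / ε)) x := fun x =>
    ((hs x).cosh).congr_deriv (by ring)
  have hz' : ∀ x, HasDerivAt (fun x => g x / ε * Real.sinh ((G x - G x₀) / ε))
      ((g x / ε) ^ 2 * Real.cosh ((G x - G x₀) / ε) + g' x / ε * Real.sinh ((G x - G x₀) / ε)) x :=
    fun x => (((hg x).div_const ε).mul (hs x).sinh).congr_deriv (by ring)
  have hle : ∀ x ∈ Ioo x₀ b, (g x / ε) ^ 2 * Real.cosh ((G x - G x₀) / ε) +
      g' x / ε * Real.sinh ((G x - G x₀) / ε) ≤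
      f x ^ 2 / ε ^ 2 * Real.cosh ((G x - G x₀) / ε) := by
    intro x hx
    obtain ⟨h1, h2, h3⟩ := hb x ⟨hax.trans hx.1.le, hx.2.le⟩
    set C := Real.cosh ((G x - G x₀) / ε)
    set S := Real.sinh ((G x - G x₀) / ε)
    have hC : 0 < C := Real.cosh_pos _
    have hS : |S| ≤ C := by
      rw [← abs_of_pos hC]
      exact sq_le_sq.1 (by have := Real.cosh_sq ((G x - G x₀) / ε); simp only [C, S]; linarith)
    have h4 : g' x * S ≤ D * C := by
      refine (le_abs_self _).trans ?_
      rw [abs_mul]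
      exact mul_le_mul h3 hS (abs_nonneg _) hD
    have hfx := hfα x
    have h5 : g x ^ 2 + ε * D ≤ f x ^ 2 := by
      have hg0 : 0 ≤ g x := le_trans (mul_nonneg (by linarith) (by linarith)) h1
      have h6 : g x ^ 2 ≤ ((1 - θ / 2) * f x) ^ 2 := pow_le_pow_left₀ hg0 h2 2
      have h7 : α ^ 2 ≤ f x ^ 2 := pow_le_pow_left₀ hα.le hfx 2
      nlinarith [mul_nonneg hε.le hD, mul_nonneg (sub_nonneg.2 hθ1.le) (sq_nonneg (f x)),
        mul_le_mul_of_nonneg_left h7 hθ.le,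
        mul_nonneg hθ.le (mul_nonneg (sub_nonneg.2 hθ1.le) (sq_nonneg (f x)))]
    have h8 : (g x / ε) ^ 2 * C + g' x / ε * S = (g x ^ 2 * C + ε * (g' x * S)) / ε ^ 2 := by
      field_simp
    rw [h8, div_mul_eq_mul_div]
    gcongr
    nlinarith [mul_le_mul_of_nonneg_left h4 hε.le, mul_le_mul_of_nonneg_right h5 hC.le]
  have hW := h.wronskian_monotoneOn (fun x hx => hw x (Ioo_subset_Icc_self hx)) hz hz' hle
  have hm := h.div_monotoneOn hz (fun x _ => Real.cosh_pos _) (fun x hx => by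
    have := hW (left_mem_Icc.2 hxb) hx hx.1
    simp only [sub_self, zero_div, Real.cosh_zero, Real.sinh_zero, mul_zero, mul_one,
      sub_zero] at this
    exact hp.trans this)
  have hfin := hm (left_mem_Icc.2 hxb) (right_mem_Icc.2 hxb) hxb
  simp only [sub_self, zero_div, Real.cosh_zero, div_one] at hfin
  rw [le_div_iff₀ (Real.cosh_pos _)] at hfin
  have hinc : (1 - θ) * (F b - F x₀) ≤ G b - G x₀ := by
    have := sub_le_sub_of_hasDerivAt_le (fun x => (hF x).const_mul (1 - θ)) hG
      (fun x hx => (hb x hx).1) hax hxb le_rfl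
    linarith
  have hexp : Real.exp ((1 - θ) * (F b - F x₀) / ε) ≤ 2 * Real.cosh ((G b - G x₀) / ε) := by
    rw [Real.cosh_eq]
    have : Real.exp ((1 - θ) * (F b - F x₀) / ε) ≤ Real.exp ((G b - G x₀) / ε) :=
      Real.exp_le_exp.2 (by gcongr)
    linarith [Real.exp_pos (-((G b - G x₀) / ε))]
  have := mul_le_mul_of_nonneg_left hexp (hw x₀ (left_mem_Icc.2 hxb))
  linarith

/-- If the slope at the right end is nonpositive then the solution grows backwards at almost the
eikonal rate. -/
lemma exists_eps_growth_left {f F : ℝ → ℝ} (hf : Continuous f) {α : ℝ} (hα : 0 < α)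
    (hfα : ∀ x, α ≤ f x) (hF : ∀ x, HasDerivAt F (f x) x) {θ : ℝ} (hθ : 0 < θ) (hθ1 : θ < 1)
    (a b : ℝ) : ∃ ε₀ > 0, ∀ ε, 0 < ε → ε < ε₀ → ∀ (x₀ : ℝ) (w p : ℝ → ℝ), a ≤ x₀ → x₀ ≤ b →
      EdgeSol (fun x => f x ^ 2 / ε ^ 2) a x₀ w p → (∀ x ∈ Icc a x₀, 0 ≤ w x) → p x₀ ≤ 0 →
      w x₀ * Real.exp ((1 - θ) * (F x₀ - F a) / ε) ≤ 2 * w a := by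
  obtain ⟨ε₀, hε₀, H⟩ := exists_eps_growth_right (f := fun x => f (-x)) (F := fun x => -F (-x))
    (by fun_prop) hα (fun x => hfα _)
    (fun x => by simpa using ((hF (-x)).scomp x (hasDerivAt_neg x)).fun_neg) hθ hθ1 (-b) (-a)
  refine ⟨ε₀, hε₀, fun ε hε hεlt x₀ w p hax hxb h hw hp => ?_⟩
  have := H ε hε hεlt (-x₀) (fun x => w (-x)) (fun x => -p (-x)) (by linarith) (by linarith)
    h.reflect (fun x hx => hw _ ⟨by linarith [hx.2], by linarith [hx.1]⟩) (by simpa using hp)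
  simp only [neg_neg] at this
  convert this using 4
  ring

/-- A positive solution cannot decrease too fast at the left end. -/
lemma slope_ge_of_pos {f : ℝ → ℝ} {ε M a b : ℝ} {w p : ℝ → ℝ} (hε : 0 < ε)
    (hab : a ≤ b) (hM : 0 < M) (hf : ∀ x ∈ Icc a b, 0 ≤ f x ∧ f x ≤ M) (hs : ε ≤ M * (b - a))
    (h : EdgeSol (fun x => f x ^ 2 / ε ^ 2) a b w p) (hw : ∀ x ∈ Icc a b, 0 < w x) :
    -(2 * M * w a / ε) ≤ p a := by
  have hd : ∀ x, HasDerivAt (fun x => M * (b - x) / ε) (-(M / ε)) x := fun x =>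
    ((((hasDerivAt_id x).const_sub b).const_mul M).div_const ε).congr_deriv (by ring)
  have hz : ∀ x, HasDerivAt (fun x => Real.sinh (M * (b - x) / ε))
      (-(M / ε) * Real.cosh (M * (b - x) / ε)) x := fun x => ((hd x).sinh).congr_deriv (by ring)
  have hz' : ∀ x, HasDerivAt (fun x => -(M / ε) * Real.cosh (M * (b - x) / ε))
      ((M / ε) ^ 2 * Real.sinh (M * (b - x) / ε)) x := fun x =>
    (((hd x).cosh).const_mul _).congr_deriv (by ring)
  have hW := h.wronskian_antitoneOn (fun x hx => (hw x (Ioo_subset_Icc_self hx)).le) hz hz'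
    (fun x hx => by
      obtain ⟨h1, h2⟩ := hf x (Ioo_subset_Icc_self hx)
      have hS : 0 ≤ Real.sinh (M * (b - x) / ε) :=
        Real.sinh_nonneg_iff.2 (div_nonneg (mul_nonneg hM.le (by linarith [hx.2])) hε.le)
      refine mul_le_mul_of_nonneg_right ?_ hS
      rw [div_pow]
      gcongr)
  have hW' := hW (left_mem_Icc.2 hab) (right_mem_Icc.2 hab) hab
  simp only [sub_self, mul_zero, zero_div, Real.sinh_zero, Real.cosh_zero, mul_one] at hW'
  have hwb := hw b (right_mem_Icc.2 hab)
  have hwa := hw a (left_mem_Icc.2 hab)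
  set s := M * (b - a) / ε
  have hs1 : 1 ≤ s := by rw [le_div_iff₀ hε]; linarith
  have hcs : Real.cosh s ≤ 2 * Real.sinh s := by
    rw [Real.cosh_eq, Real.sinh_eq, Real.exp_neg]
    have h2 : 2 ≤ Real.exp s := by linarith [Real.add_one_le_exp s]
    have h3 : (Real.exp s)⁻¹ ≤ 2⁻¹ := inv_anti₀ (by norm_num) h2
    linarith
  have hsinh : 0 < Real.sinh s := Real.sinh_pos_iff.2 (by linarith)
  have hMε : 0 < M / ε := by positivity
  have h1 : 0 ≤ p a * Real.sinh s + w a * (M / ε) * Real.cosh s := by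
    have : 0 ≤ w b * (M / ε) := by positivity
    linarith
  have h2 : 0 ≤ (p a + 2 * M * w a / ε) * Real.sinh s := by
    have := mul_le_mul_of_nonneg_left hcs (mul_pos hwa hMε).le
    calc 0 ≤ p a * Real.sinh s + w a * (M / ε) * (2 * Real.sinh s) := by linarith
      _ = _ := by ring
  have := nonneg_of_mul_nonneg_left h2 hsinh
  linarith

/-- A positive solution with controlled slope at the left end grows at most slightly faster than
the eikonal rate. -/
lemma exists_eps_growth_le_right {f F : ℝ → ℝ} (hf : Continuous f) {α : ℝ} (hα : 0 < α)
    (hfα : ∀ x, α ≤ f x) (hF : ∀ x, HasDerivAt F (f x) x) {θ : ℝ} (hθ : 0 < θ) (K : ℝ)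
    {a b : ℝ} (hab : a < b) : ∃ ε₀ > 0, ∀ ε, 0 < ε → ε < ε₀ → ∀ w p : ℝ → ℝ,
      EdgeSol (fun x => f x ^ 2 / ε ^ 2) a b w p → (∀ x ∈ Icc a b, 0 < w x) →
      p a ≤ K * w a / ε → w b ≤ w a * Real.exp ((1 + θ) * (F b - F a) / ε) := by
  obtain ⟨G, g, g', D, hD, hG, hg, hb⟩ := exists_smooth_between hf hα hfα
    (show 1 + θ / 4 < 1 + θ / 2 by linarith) a b
  set k : ℝ := max 1 (K / α) with hk
  have hk1 : 1 ≤ k := le_max_left _ _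
  have hkK : K ≤ k * α := by
    rw [← div_le_iff₀ hα]; exact le_max_right _ _
  have hΔ : 0 < F b - F a := by
    have := sub_le_sub_of_hasDerivAt_le (fun x => (hasDerivAt_id x).const_mul α) hF
      (fun x _ => by simpa using hfα x) le_rfl hab.le le_rfl
    simp only [id] at this
    nlinarith [mul_pos hα (sub_pos.2 hab)]
  refine ⟨min (α ^ 2 * θ / (2 * (D * k + 1))) (θ / 2 * (F b - F a) / k), by positivity,
    fun ε hε hεlt w p h hw hp => ?_⟩
  obtain ⟨hε1, hε2⟩ := lt_min_iff.1 hεlt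
  rw [lt_div_iff₀ (by positivity)] at hε1 hε2
  have hgmono : ∀ x ∈ Icc a b, 0 ≤ G x - G a := by
    intro x hx
    have := sub_le_sub_of_hasDerivAt_le (fun x => (hasDerivAt_const x (0 : ℝ))) hG
      (fun x hx => le_trans (mul_nonneg (by linarith) (by linarith [hfα x])) (hb x hx).1)
      le_rfl hx.1 hx.2
    linarith
  have hs : ∀ x, HasDerivAt (fun x => (G x - G a) / ε) (g x / ε) x := fun x =>
    ((hG x).sub_const _).div_const ε
  have hz : ∀ x, HasDerivAt (fun x => Real.cosh ((G x - G a) / ε) + k * Real.sinh ((G x - G a) / ε))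
      (g x / ε * (Real.sinh ((G x - G a) / ε) + k * Real.cosh ((G x - G a) / ε))) x := fun x =>
    ((hs x).cosh.fun_add ((hs x).sinh.const_mul k)).congr_deriv (by ring)
  have hz' : ∀ x, HasDerivAt
      (fun x => g x / ε * (Real.sinh ((G x - G a) / ε) + k * Real.cosh ((G x - G a) / ε)))
      ((g x / ε) ^ 2 * (Real.cosh ((G x - G a) / ε) + k * Real.sinh ((G x - G a) / ε)) +
        g' x / ε * (Real.sinh ((G x - G a) / ε) + k * Real.cosh ((G x - G a) / ε))) x :=
    fun x => (((hg x).div_const ε).mul ((hs x).sinh.fun_add ((hs x).cosh.const_mul k))).congr_deriv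
      (by ring)
  have hS0 : ∀ x ∈ Icc a b, 0 ≤ Real.sinh ((G x - G a) / ε) := fun x hx =>
    Real.sinh_nonneg_iff.2 (div_nonneg (hgmono x hx) hε.le)
  have hzpos : ∀ x ∈ Icc a b, 0 < Real.cosh ((G x - G a) / ε) + k * Real.sinh ((G x - G a) / ε) :=
    fun x hx => add_pos_of_pos_of_nonneg (Real.cosh_pos _) (mul_nonneg (by linarith) (hS0 x hx))
  have hle : ∀ x ∈ Ioo a b, f x ^ 2 / ε ^ 2 *
      (Real.cosh ((G x - G a) / ε) + k * Real.sinh ((G x - G a) / ε)) ≤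
      (g x / ε) ^ 2 * (Real.cosh ((G x - G a) / ε) + k * Real.sinh ((G x - G a) / ε)) +
        g' x / ε * (Real.sinh ((G x - G a) / ε) + k * Real.cosh ((G x - G a) / ε)) := by
    intro x hx
    have hx' := Ioo_subset_Icc_self hx
    obtain ⟨h1, h2, h3⟩ := hb x hx'
    have hZ := hzpos x hx'
    have hS := hS0 x hx'
    have hC : 0 < Real.cosh ((G x - G a) / ε) := Real.cosh_pos _
    set C := Real.cosh ((G x - G a) / ε)
    set S := Real.sinh ((G x - G a) / ε)
    have hfx := hfα x
    have h4 : S + k * C ≤ k * (C + k * S) := by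
      nlinarith [mul_le_mul hk1 hk1 (by norm_num) (by linarith)]
    have h5 : -(D * (k * (C + k * S))) ≤ g' x * (S + k * C) := by
      have : |g' x * (S + k * C)| ≤ D * (k * (C + k * S)) := by
        rw [abs_mul, abs_of_nonneg (a := S + k * C) (by positivity)]
        exact mul_le_mul h3 h4 (by positivity) hD
      exact (abs_le.1 this).1
    have h6 : f x ^ 2 ≤ g x ^ 2 - ε * (D * k) := by
      have h7 : ((1 + θ / 4) * f x) ^ 2 ≤ g x ^ 2 :=
        pow_le_pow_left₀ (mul_nonneg (by linarith) (by linarith)) h1 2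
      have h8 : α ^ 2 ≤ f x ^ 2 := pow_le_pow_left₀ hα.le hfx 2
      nlinarith [mul_le_mul_of_nonneg_left h8 hθ.le, mul_nonneg (sq_nonneg θ) (sq_nonneg (f x))]
    have h8 : (g x / ε) ^ 2 * (C + k * S) + g' x / ε * (S + k * C) =
        (g x ^ 2 * (C + k * S) + ε * (g' x * (S + k * C))) / ε ^ 2 := by
      field_simp
    rw [h8, div_mul_eq_mul_div]
    gcongr
    nlinarith [mul_le_mul_of_nonneg_left h5 hε.le, mul_le_mul_of_nonneg_right h6 hZ.le]
  have hW := h.wronskian_antitoneOn (fun x hx => (hw x (Ioo_subset_Icc_self hx)).le) hz hz' hle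
  have hwa := hw a (left_mem_Icc.2 hab.le)
  have hga : α ≤ g a := by
    have := (hb a (left_mem_Icc.2 hab.le)).1
    nlinarith [hfα a]
  have hm := h.div_antitoneOn hz hzpos (fun x hx => by
    have := hW (left_mem_Icc.2 hab.le) hx hx.1
    simp only [sub_self, zero_div, Real.cosh_zero, Real.sinh_zero, mul_zero, mul_one,
      add_zero, zero_add] at this
    refine this.trans ?_
    have h1 : K * w a / ε ≤ w a * (g a / ε * k) := by
      rw [show w a * (g a / ε * k) = k * g a * w a / ε by ring]
      have : K ≤ k * g a := hkK.trans (mul_le_mul_of_nonneg_left hga (by linarith))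
      gcongr
    linarith)
  have hfin := hm (left_mem_Icc.2 hab.le) (right_mem_Icc.2 hab.le) hab.le
  simp only [sub_self, zero_div, Real.cosh_zero, Real.sinh_zero, mul_zero, add_zero, div_one]
    at hfin
  rw [div_le_iff₀ (hzpos b (right_mem_Icc.2 hab.le))] at hfin
  refine hfin.trans (mul_le_mul_of_nonneg_left ?_ hwa.le)
  set s := (G b - G a) / ε with hsdef
  have hs0 : 0 ≤ s := div_nonneg (hgmono b (right_mem_Icc.2 hab.le)) hε.le
  have h1 : Real.cosh s ≤ Real.exp s := by
    rw [Real.cosh_eq]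
    have : Real.exp (-s) ≤ Real.exp s := Real.exp_le_exp.2 (by linarith)
    linarith
  have h2 : Real.sinh s ≤ Real.exp s := by
    rw [Real.sinh_eq]
    linarith [Real.exp_pos s, Real.exp_pos (-s)]
  have h3 : s ≤ (1 + θ / 2) * (F b - F a) / ε := by
    have := sub_le_sub_of_hasDerivAt_le hG (fun x => (hF x).const_mul (1 + θ / 2))
      (fun x hx => (hb x hx).2.1) le_rfl hab.le le_rfl
    rw [hsdef]; gcongr; linarith
  have h4 : 1 + k ≤ Real.exp (θ / 2 * (F b - F a) / ε) := by
    have : k ≤ θ / 2 * (F b - F a) / ε := by rw [le_div_iff₀ hε]; linarith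
    linarith [Real.add_one_le_exp (θ / 2 * (F b - F a) / ε)]
  calc Real.cosh s + k * Real.sinh s ≤ (1 + k) * Real.exp s := by nlinarith
    _ ≤ Real.exp (θ / 2 * (F b - F a) / ε) * Real.exp ((1 + θ / 2) * (F b - F a) / ε) :=
        mul_le_mul h4 (Real.exp_le_exp.2 h3) (Real.exp_pos _).le (Real.exp_pos _).le
    _ = Real.exp ((1 + θ) * (F b - F a) / ε) := by
        rw [← Real.exp_add]; congr 1; ring

/-- Lower bound inside an edge from a lower bound at its right end. -/
lemma exists_eps_lower_right {f F : ℝ → ℝ} (hf : Continuous f) {α : ℝ} (hα : 0 < α)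
    (hfα : ∀ x, α ≤ f x) (hF : ∀ x, HasDerivAt F (f x) x) {θ : ℝ} (hθ : 0 < θ)
    (a b : ℝ) : ∃ ε₀ > 0, ∀ ε, 0 < ε → ε < ε₀ → ∀ w p : ℝ → ℝ,
      EdgeSol (fun x => f x ^ 2 / ε ^ 2) a b w p → (∀ x ∈ Icc a b, 0 < w x) →
      w a ≤ w b * Real.exp ((1 + θ) * (F b - F a) / ε) →
      ∀ x ∈ Icc a b, w a ≤ w x * Real.exp ((1 + 2 * θ) * (F x - F a) / ε) := by
  obtain ⟨G, g, g', D, hD, hG, hg, hb⟩ := exists_smooth_between hf hα hfα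
    (show 1 + θ < 1 + 2 * θ by linarith) a b
  refine ⟨α ^ 2 * θ / (D + 1), by positivity, fun ε hε hεlt w p h hw hwb x hx => ?_⟩
  rw [lt_div_iff₀ (by positivity)] at hεlt
  have hab : a ≤ b := hx.1.trans hx.2
  have hs : ∀ x, HasDerivAt (fun x => -((G x - G a) / ε)) (-(g x / ε)) x := fun x =>
    (((hG x).sub_const _).div_const ε).fun_neg
  have hz : ∀ x, HasDerivAt (fun x => Real.exp (-((G x - G a) / ε)))
      (-(g x / ε) * Real.exp (-((G x - G a) / ε))) x := fun x =>
    ((hs x).exp).congr_deriv (by ring)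
  have hz' : ∀ x, HasDerivAt (fun x => -(g x / ε) * Real.exp (-((G x - G a) / ε)))
      (((g x / ε) ^ 2 - g' x / ε) * Real.exp (-((G x - G a) / ε))) x :=
    fun x => ((((hg x).div_const ε).fun_neg).mul (hs x).exp).congr_deriv (by ring)
  have hle : ∀ x ∈ Ioo a b, f x ^ 2 / ε ^ 2 * Real.exp (-((G x - G a) / ε)) ≤
      ((g x / ε) ^ 2 - g' x / ε) * Real.exp (-((G x - G a) / ε)) := by
    intro x hx
    obtain ⟨h1, h2, h3⟩ := hb x (Ioo_subset_Icc_self hx)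
    refine mul_le_mul_of_nonneg_right ?_ (Real.exp_pos _).le
    have hfx := hfα x
    have h7 : ((1 + θ) * f x) ^ 2 ≤ g x ^ 2 :=
      pow_le_pow_left₀ (mul_nonneg (by linarith) (by linarith)) h1 2
    have h8 : α ^ 2 ≤ f x ^ 2 := pow_le_pow_left₀ hα.le hfx 2
    have h9 := mul_le_mul_of_nonneg_left ((le_abs_self _).trans h3) hε.le
    rw [show (g x / ε) ^ 2 - g' x / ε = (g x ^ 2 - ε * g' x) / ε ^ 2 by field_simp]
    gcongr
    nlinarith [mul_le_mul_of_nonneg_left h8 hθ.le, mul_nonneg (sq_nonneg θ) (sq_nonneg (f x))]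
  have hW := h.wronskian_antitoneOn (fun x hx => (hw x (Ioo_subset_Icc_self hx)).le) hz hz' hle
  have hratio : w a ≤ w x / Real.exp (-((G x - G a) / ε)) := by
    rcases le_total 0 (p x * Real.exp (-((G x - G a) / ε)) -
        w x * (-(g x / ε) * Real.exp (-((G x - G a) / ε)))) with hx0 | hx0
    · have hm := (h.mono le_rfl hx.2).div_monotoneOn hz (fun x _ => Real.exp_pos _)
        (fun y hy => hx0.trans (hW ⟨hy.1, hy.2.trans hx.2⟩ hx hy.2))
      have := hm (left_mem_Icc.2 hx.1) (right_mem_Icc.2 hx.1) hx.1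
      simpa using this
    · have hm := (h.mono hx.1 le_rfl).div_antitoneOn hz (fun x _ => Real.exp_pos _)
        (fun y hy => (hW hx ⟨hx.1.trans hy.1, hy.2⟩ hy.1).trans hx0)
      have h1 := hm (left_mem_Icc.2 hx.2) (right_mem_Icc.2 hx.2) hx.2
      refine le_trans ?_ h1
      simp only
      rw [Real.exp_neg, div_inv_eq_mul]
      refine hwb.trans (mul_le_mul_of_nonneg_left ?_ (hw b (right_mem_Icc.2 hab)).le)
      have := sub_le_sub_of_hasDerivAt_le (fun x => (hF x).const_mul (1 + θ)) hG
        (fun x hx => (hb x hx).1) le_rfl hab le_rfl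
      refine Real.exp_le_exp.2 ?_
      gcongr; linarith
  refine hratio.trans ?_
  rw [Real.exp_neg, div_inv_eq_mul]
  refine mul_le_mul_of_nonneg_left ?_ (hw x hx).le
  have := sub_le_sub_of_hasDerivAt_le hG (fun x => (hF x).const_mul (1 + 2 * θ))
    (fun x hx => (hb x hx).2.1) le_rfl hx.1 hx.2
  refine Real.exp_le_exp.2 ?_
  gcongr; linarith

/-- A positive solution cannot increase too fast at the right end. -/
lemma slope_le_of_pos {f : ℝ → ℝ} {ε M a b : ℝ} {w p : ℝ → ℝ} (hε : 0 < ε)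
    (hab : a ≤ b) (hM : 0 < M) (hf : ∀ x ∈ Icc a b, 0 ≤ f x ∧ f x ≤ M) (hs : ε ≤ M * (b - a))
    (h : EdgeSol (fun x => f x ^ 2 / ε ^ 2) a b w p) (hw : ∀ x ∈ Icc a b, 0 < w x) :
    p b ≤ 2 * M * w b / ε := by
  have := slope_ge_of_pos (f := fun x => f (-x)) (a := -b) (b := -a) hε (by linarith) hM
    (fun x hx => hf _ ⟨by linarith [hx.2], by linarith [hx.1]⟩) (by linarith) h.reflect
    (fun x hx => hw _ ⟨by linarith [hx.2], by linarith [hx.1]⟩)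
  simp only [neg_neg] at this
  linarith

/-- A positive solution with controlled slope at the right end grows backwards at most slightly
faster than the eikonal rate. -/
lemma exists_eps_growth_le_left {f F : ℝ → ℝ} (hf : Continuous f) {α : ℝ} (hα : 0 < α)
    (hfα : ∀ x, α ≤ f x) (hF : ∀ x, HasDerivAt F (f x) x) {θ : ℝ} (hθ : 0 < θ) (K : ℝ)
    {a b : ℝ} (hab : a < b) : ∃ ε₀ > 0, ∀ ε, 0 < ε → ε < ε₀ → ∀ w p : ℝ → ℝ,
      EdgeSol (fun x => f x ^ 2 / ε ^ 2) a b w p → (∀ x ∈ Icc a b, 0 < w x) →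
      -(K * w b / ε) ≤ p b → w a ≤ w b * Real.exp ((1 + θ) * (F b - F a) / ε) := by
  obtain ⟨ε₀, hε₀, H⟩ := exists_eps_growth_le_right (f := fun x => f (-x)) (F := fun x => -F (-x))
    (by fun_prop) hα (fun x => hfα _)
    (fun x => by simpa using ((hF (-x)).scomp x (hasDerivAt_neg x)).fun_neg) hθ K
    (neg_lt_neg hab)
  refine ⟨ε₀, hε₀, fun ε hε hεlt w p h hw hp => ?_⟩
  have := H ε hε hεlt (fun x => w (-x)) (fun x => -p (-x)) h.reflect
    (fun x hx => hw _ ⟨by linarith [hx.2], by linarith [hx.1]⟩)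
    (by simp only [neg_neg]; linarith)
  simp only [neg_neg] at this
  convert this using 4
  ring

/-- Lower bound inside an interval for positive solutions dominated at the right end. -/
lemma exists_eps_lower_left {f F : ℝ → ℝ} (hf : Continuous f) {α : ℝ} (hα : 0 < α)
    (hfα : ∀ x, α ≤ f x) (hF : ∀ x, HasDerivAt F (f x) x) {θ : ℝ} (hθ : 0 < θ)
    (a b : ℝ) : ∃ ε₀ > 0, ∀ ε, 0 < ε → ε < ε₀ → ∀ w p : ℝ → ℝ,
      EdgeSol (fun x => f x ^ 2 / ε ^ 2) a b w p → (∀ x ∈ Icc a b, 0 < w x) →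
      w b ≤ w a * Real.exp ((1 + θ) * (F b - F a) / ε) →
      ∀ x ∈ Icc a b, w b ≤ w x * Real.exp ((1 + 2 * θ) * (F b - F x) / ε) := by
  obtain ⟨ε₀, hε₀, H⟩ := exists_eps_lower_right (f := fun x => f (-x)) (F := fun x => -F (-x))
    (by fun_prop) hα (fun x => hfα _)
    (fun x => by simpa using ((hF (-x)).scomp x (hasDerivAt_neg x)).fun_neg) hθ (-b) (-a)
  refine ⟨ε₀, hε₀, fun ε hε hεlt w p h hw hp x hx => ?_⟩
  have := H ε hε hεlt (fun x => w (-x)) (fun x => -p (-x)) h.reflect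
    (fun x hx => hw _ ⟨by linarith [hx.2], by linarith [hx.1]⟩)
    (by simp only [neg_neg]; convert hp using 4; ring) (-x)
    ⟨by linarith [hx.2], by linarith [hx.1]⟩
  simp only [neg_neg] at this
  convert this using 4
  ring

/-- The edge condition for viscosity subsolutions of `|u'| = f`. -/
def EdgeSub (f : ℝ → ℝ) (l : ℝ) (u : ℝ → ℝ) : Prop :=
  ∀ y ∈ Ioo 0 l, ∀ (g : ℝ → ℝ) (d : ℝ), ContinuousOn g (Icc 0 l) → HasDerivAt g d y →
    IsLocalMax (fun x => u x - g x) y → |d| ≤ f y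

/-- The edge condition for viscosity supersolutions of `|u'| = f`. -/
def EdgeSuper (f : ℝ → ℝ) (l : ℝ) (u : ℝ → ℝ) : Prop :=
  ∀ y ∈ Ioo 0 l, ∀ (g : ℝ → ℝ) (d : ℝ), ContinuousOn g (Icc 0 l) → HasDerivAt g d y →
    IsLocalMin (fun x => u x - g x) y → f y ≤ |d|

lemma EdgeSub.reflect {f u : ℝ → ℝ} {l : ℝ} (h : EdgeSub f l u) :
    EdgeSub (fun x => f (l - x)) l (fun x => u (l - x)) := by
  intro y hy g d hg hd hmax
  have hy' : l - y ∈ Ioo 0 l := ⟨by linarith [hy.2], by linarith [hy.1]⟩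
  have hlin : ∀ x, HasDerivAt (fun x => l - x) (-1) x := fun x =>
    (hasDerivAt_id x).const_sub l
  have := h (l - y) hy' (fun x => g (l - x)) (-d)
    (hg.comp (by fun_prop) fun x hx => ⟨by linarith [hx.2], by linarith [hx.1]⟩)
    (by
      have hd' : HasDerivAt g d (l - (l - y)) := by simpa using hd
      exact (hd'.scomp (l - y) (hlin (l - y))).congr_deriv (by simp))
    (by
      have ht : Filter.Tendsto (fun x => l - x) (nhds (l - y)) (nhds y) := by
        have := (hlin (l - y)).continuousAt.tendsto
        simpa using this
      have := ht.eventually hmax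
      simpa [IsLocalMax, IsMaxFilter] using this)
  simpa using this

lemma sub_le_of_edgeSub_of_lt {f F u : ℝ → ℝ} {α l : ℝ} (hα : 0 < α) (hfα : ∀ x, α ≤ f x)
    (hF : ∀ x, HasDerivAt F (f x) x) (hu : ContinuousOn u (Icc 0 l)) (h : EdgeSub f l u)
    {x y : ℝ} (hx : 0 ≤ x) (hxy : x ≤ y) (hy : y < l) : u y - u x ≤ F y - F x := by
  have key : ∀ δ > 0, u y - u x ≤ (1 + δ) * (F y - F x) := by
    intro δ hδ
    set K : ℝ := max 0 ((u l - u x - (1 + δ) * (F l - F x)) / (l - y) ^ 2)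
    have hK : 0 ≤ K := le_max_left _ _
    have hK' : u l - u x - (1 + δ) * (F l - F x) ≤ K * (l - y) ^ 2 := by
      rw [← div_le_iff₀ (by have := sub_pos.2 hy; positivity)]
      exact le_max_right _ _
    set φ : ℝ → ℝ := fun z => (1 + δ) * F z + K * max (z - y) 0 ^ 2
    have hFc : Continuous F := continuous_iff_continuousAt.2 fun x => (hF x).continuousAt
    have hφ : ∀ z, HasDerivAt φ ((1 + δ) * f z + K * (2 * max (z - y) 0)) z := fun z => by
      have h1 := (hasDerivAt_sq_max_zero (z - y)).comp_sub_const z y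
      exact ((hF z).const_mul _).fun_add (h1.const_mul K)
    have hφc : Continuous φ := continuous_iff_continuousAt.2 fun x => (hφ x).continuousAt
    have hxl : x ≤ l := hxy.trans hy.le
    obtain ⟨z, hz, hmax⟩ := isCompact_Icc.exists_isMaxOn (nonempty_Icc.2 hxl)
      (f := fun z => u z - φ z)
      ((hu.mono (Icc_subset_Icc_left hx)).sub hφc.continuousOn)
    have hφx : φ x = (1 + δ) * F x := by simp [φ, hxy]
    have hφy : φ y = (1 + δ) * F y := by simp [φ]
    have hφl : φ l = (1 + δ) * F l + K * (l - y) ^ 2 := by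
      simp only [φ]; rw [max_eq_left (by linarith)]
    have hyx : u y - φ y ≤ u x - φ x := by
      rcases hz.1.eq_or_lt with rfl | h1
      · exact hmax ⟨hxy, hy.le⟩
      rcases hz.2.eq_or_lt with rfl | h2
      · have := hmax (a := y) ⟨hxy, hy.le⟩
        simp only [mem_ofPred_eq] at this
        linarith
      exfalso
      have := h z ⟨by linarith, h2⟩ φ _ hφc.continuousOn (hφ z) (by
        filter_upwards [Ioo_mem_nhds h1 h2] with w hw
        exact hmax (Ioo_subset_Icc_self hw))
      have h3 := (le_abs_self _).trans this
      have h4 : 0 ≤ K * (2 * max (z - y) 0) := by positivity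
      nlinarith [hfα z]
    linarith
  refine le_of_forall_pos_le_add fun η hη => ?_
  have h0 := key 1 one_pos
  have := key (η / (|F y - F x| + 1)) (by positivity)
  refine this.trans ?_
  have h1 : η / (|F y - F x| + 1) * (F y - F x) ≤ η := by
    rw [div_mul_eq_mul_div, div_le_iff₀ (by positivity)]
    exact mul_le_mul_of_nonneg_left (by linarith [le_abs_self (F y - F x)]) hη.le
  linarith

/-- Subsolutions of the eikonal equation on an edge are one-sided Lipschitz with respect to the
weighted length. -/
lemma sub_le_of_edgeSub {f F u : ℝ → ℝ} {α l : ℝ} (hα : 0 < α) (hfα : ∀ x, α ≤ f x)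
    (hF : ∀ x, HasDerivAt F (f x) x) (hu : ContinuousOn u (Icc 0 l)) (h : EdgeSub f l u)
    {x y : ℝ} (hx : 0 ≤ x) (hxy : x ≤ y) (hy : y ≤ l) : u y - u x ≤ F y - F x := by
  rcases hy.lt_or_eq with hy | rfl
  · exact sub_le_of_edgeSub_of_lt hα hfα hF hu h hx hxy hy
  rcases hxy.eq_or_lt with rfl | hxy
  · simp
  have hFc : Continuous F := continuous_iff_continuousAt.2 fun x => (hF x).continuousAt
  have hcl : y ∈ closure (Ioo x y) := by
    rw [closure_Ioo hxy.ne]; exact right_mem_Icc.2 hxy.le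
  have hc : ContinuousOn u (Icc x y) := hu.mono (Icc_subset_Icc_left hx)
  refine ContinuousWithinAt.closure_le hcl
    (((hc y (right_mem_Icc.2 hxy.le)).mono Ioo_subset_Icc_self).sub continuousWithinAt_const)
    ((hFc.continuousWithinAt).sub continuousWithinAt_const) fun z hz => ?_
  exact sub_le_of_edgeSub_of_lt hα hfα hF hu h hx hz.1.le hz.2

lemma sub_le_of_edgeSub' {f F u : ℝ → ℝ} {α l : ℝ} (hα : 0 < α) (hfα : ∀ x, α ≤ f x)
    (hF : ∀ x, HasDerivAt F (f x) x) (hu : ContinuousOn u (Icc 0 l)) (h : EdgeSub f l u)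
    {x y : ℝ} (hx : 0 ≤ x) (hxy : x ≤ y) (hy : y ≤ l) : u x - u y ≤ F y - F x := by
  have := sub_le_of_edgeSub (F := fun x => - F (l - x)) hα (fun x => hfα (l - x))
    (fun x => by
      simpa using ((hF (l - x)).scomp x ((hasDerivAt_id x).const_sub l)).fun_neg)
    (hu.comp (by fun_prop) fun x hx => ⟨by linarith [hx.2], by linarith [hx.1]⟩) h.reflect
    (x := l - y) (y := l - x) (by linarith) (by linarith) (by linarith)
  simp only [Function.comp, sub_sub_cancel] at this
  linarith

/-- Supersolutions of the eikonal equation on an edge dominate the distance function from the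
ends. -/
lemma min_le_of_edgeSuper {f F u : ℝ → ℝ} {α l : ℝ} (hα : 0 < α) (hfα : ∀ x, α ≤ f x)
    (hF : ∀ x, HasDerivAt F (f x) x) (hu : ContinuousOn u (Icc 0 l)) (h : EdgeSuper f l u)
    {y : ℝ} (hy : y ∈ Ioo 0 l) : min (u 0 + F y - F 0) (u l + F l - F y) ≤ u y := by
  by_contra! hlt
  obtain ⟨h0, hl⟩ := lt_min_iff.1 hlt
  have hFm : StrictMono F := strictMono_of_hasDerivAt_pos hF fun x => hα.trans_le (hfα x)
  have hFc : Continuous F := continuous_iff_continuousAt.2 fun x => (hF x).continuousAt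
  have hA : 0 < F y - F 0 := sub_pos.2 (hFm hy.1)
  have hB : 0 < F l - F y := sub_pos.2 (hFm hy.2)
  obtain ⟨c, hc, hc1⟩ := exists_between
    (show max 0 (max ((u y - u 0) / (F y - F 0)) ((u y - u l) / (F l - F y))) < 1 by
      refine max_lt one_pos (max_lt ?_ ?_)
      · rw [div_lt_one hA]; linarith
      · rw [div_lt_one hB]; linarith)
  obtain ⟨hc0, hc'⟩ := max_lt_iff.1 hc
  obtain ⟨hcA, hcB⟩ := max_lt_iff.1 hc'
  rw [div_lt_iff₀ hA] at hcA
  rw [div_lt_iff₀ hB] at hcB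
  obtain ⟨η, hη, hη'⟩ := exists_between
    (show 0 < min (c * (F y - F 0) - (u y - u 0)) (c * (F l - F y) - (u y - u l)) from
      lt_min (by linarith) (by linarith))
  obtain ⟨hηA, hηB⟩ := lt_min_iff.1 hη'
  set ψ : ℝ → ℝ := fun z => -c * √((F z - F y) ^ 2 + η ^ 2)
  have hpos : ∀ z, 0 < (F z - F y) ^ 2 + η ^ 2 := fun z => by positivity
  have hψ : ∀ z, HasDerivAt ψ
      (-c * (2 * (F z - F y) * f z / (2 * √((F z - F y) ^ 2 + η ^ 2)))) z := fun z => by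
    have := (((((hF z).sub_const (F y)).fun_pow 2).add_const (η ^ 2)).sqrt (hpos z).ne').const_mul
      (-c)
    exact this.congr_deriv (by simp)
  have hψc : Continuous ψ := continuous_iff_continuousAt.2 fun x => (hψ x).continuousAt
  have habs : ∀ z, |F z - F y| ≤ √((F z - F y) ^ 2 + η ^ 2) := fun z =>
    Real.abs_le_sqrt (by nlinarith)
  have hl0 : 0 ≤ l := (hy.1.trans hy.2).le
  obtain ⟨z, hz, hmin⟩ := isCompact_Icc.exists_isMinOn (nonempty_Icc.2 hl0)
    (f := fun z => u z - ψ z) (hu.sub hψc.continuousOn)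
  have hzy : u z - ψ z ≤ u y - ψ y := hmin (Ioo_subset_Icc_self hy)
  have hψy : ψ y = -c * η := by simp [ψ, Real.sqrt_sq hη.le]
  have hcη : c * η ≤ η := by nlinarith
  rcases hz.1.eq_or_lt with rfl | h1
  · have h2 := mul_le_mul_of_nonneg_left (habs 0) hc0.le
    rw [abs_sub_comm, abs_of_pos hA] at h2
    simp only [hψy, ψ] at hzy
    linarith
  rcases hz.2.eq_or_lt with rfl | h2
  · have h2 := mul_le_mul_of_nonneg_left (habs z) hc0.le
    rw [abs_of_pos hB] at h2
    simp only [hψy, ψ] at hzy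
    linarith
  have h3 := h z ⟨h1, h2⟩ ψ _ hψc.continuousOn (hψ z) (by
    filter_upwards [Icc_mem_nhds h1 h2] with w hw
    exact hmin hw)
  have hs : 0 < √((F z - F y) ^ 2 + η ^ 2) := Real.sqrt_pos.2 (hpos z)
  have hfz : 0 < f z := hα.trans_le (hfα z)
  have h4 : |(-c * (2 * (F z - F y) * f z / (2 * √((F z - F y) ^ 2 + η ^ 2))))| ≤ c * f z := by
    rw [abs_mul, abs_neg, abs_of_pos hc0]
    refine mul_le_mul_of_nonneg_left ?_ hc0.le
    rw [abs_div, abs_of_pos (mul_pos two_pos hs), div_le_iff₀ (by positivity), abs_mul, abs_mul,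
      abs_two, abs_of_pos hfz]
    nlinarith [mul_le_mul_of_nonneg_left (habs z) hfz.le]
  nlinarith

lemma deriv_nonneg_of_le_right {h : ℝ → ℝ} {d x b : ℝ} (hb : x < b)
    (hd : HasDerivWithinAt h d (Ioo x b) x) (hle : ∀ y ∈ Ioo x b, h x ≤ h y) : 0 ≤ d := by
  rw [hasDerivWithinAt_iff_tendsto_slope' (by simp)] at hd
  have : (nhdsWithin x (Ioo x b)).NeBot := by
    rw [nhdsWithin_Ioo_eq_nhdsGT hb]; infer_instance
  refine ge_of_tendsto hd ?_
  filter_upwards [self_mem_nhdsWithin] with y hy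
  rw [slope_def_field]
  exact div_nonneg (sub_nonneg.2 (hle y hy)) (sub_nonneg.2 hy.1.le)

lemma deriv_nonpos_of_le_left {h : ℝ → ℝ} {d x a : ℝ} (ha : a < x)
    (hd : HasDerivWithinAt h d (Ioo a x) x) (hle : ∀ y ∈ Ioo a x, h x ≤ h y) : d ≤ 0 := by
  rw [hasDerivWithinAt_iff_tendsto_slope' (by simp)] at hd
  have : (nhdsWithin x (Ioo a x)).NeBot := by
    rw [nhdsWithin_Ioo_eq_nhdsLT ha]; infer_instance
  refine le_of_tendsto hd ?_
  filter_upwards [self_mem_nhdsWithin] with y hy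
  rw [slope_def_field]
  exact div_nonpos_of_nonneg_of_nonpos (sub_nonneg.2 (hle y hy)) (sub_nonpos.2 hy.2.le)

lemma deriv_le_mul_of_right {F g : ℝ → ℝ} {c d e l : ℝ} (hl : 0 < l)
    (hg : HasDerivWithinAt g d (Icc 0 l) 0) (hF : HasDerivAt F e 0)
    (h : ∃ δ > 0, ∀ x ∈ Icc 0 l, |x - 0| < δ → g x - g 0 ≤ c * (F x - F 0)) : d ≤ c * e := by
  obtain ⟨δ, hδ, h⟩ := h
  have hb : 0 < min δ l := lt_min hδ hl
  have hsub : Ioo 0 (min δ l) ⊆ Icc 0 l := fun x hx => ⟨hx.1.le, hx.2.le.trans (min_le_right _ _)⟩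
  have := deriv_nonneg_of_le_right hb
    ((hF.const_mul c).hasDerivWithinAt.fun_sub (hg.mono hsub)) fun y hy => by
      have := h y (hsub hy) (by
        rw [sub_zero, abs_of_pos hy.1]; exact hy.2.trans_le (min_le_left _ _))
      linarith
  linarith

lemma neg_deriv_le_mul_of_left {F g : ℝ → ℝ} {c d e l : ℝ} (hl : 0 < l)
    (hg : HasDerivWithinAt g d (Icc 0 l) l) (hF : HasDerivAt F e l)
    (h : ∃ δ > 0, ∀ x ∈ Icc 0 l, |x - l| < δ → g x - g l ≤ c * (F l - F x)) : -d ≤ c * e := by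
  obtain ⟨δ, hδ, h⟩ := h
  have hb : max (l - δ) 0 < l := max_lt (by linarith) hl
  have hsub : Ioo (max (l - δ) 0) l ⊆ Icc 0 l := fun x hx =>
    ⟨(le_max_right _ _).trans hx.1.le, hx.2.le⟩
  have := deriv_nonpos_of_le_left hb
    ((hF.const_mul (-c)).hasDerivWithinAt.fun_sub (hg.mono hsub)) fun y hy => by
      have := h y (hsub hy) (by
        rw [abs_of_neg (sub_neg.2 hy.2)]
        have := (le_max_left _ _).trans_lt hy.1
        linarith)
      linarith
  linarith

lemma edgeSub_of_abs_sub_le {f F u : ℝ → ℝ} {l : ℝ} (hF : ∀ x, HasDerivAt F (f x) x)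
    (hu : ∀ x ∈ Icc 0 l, ∀ y ∈ Icc 0 l, x ≤ y → |u x - u y| ≤ F y - F x) :
    EdgeSub f l u := by
  intro y hy g d _ hd hmax
  have hy' := Ioo_subset_Icc_self hy
  obtain ⟨δ, hδ, hm⟩ := Metric.eventually_nhds_iff.1 (hmax.and (Ioo_mem_nhds hy.1 hy.2))
  refine abs_le.2 ⟨?_, ?_⟩
  · have := deriv_nonneg_of_le_right (show y < y + δ by linarith)
      ((hF y).fun_add hd).hasDerivWithinAt fun z hz => by
        obtain ⟨h1, h2⟩ := hm (y := z) (by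
          rw [Real.dist_eq, abs_of_pos (sub_pos.2 hz.1)]; linarith [hz.2])
        have h3 := (abs_le.1 (hu y hy' z (Ioo_subset_Icc_self h2) hz.1.le)).2
        linarith
    linarith
  · have := deriv_nonpos_of_le_left (show y - δ < y by linarith)
      (hd.fun_sub (hF y)).hasDerivWithinAt fun z hz => by
        obtain ⟨h1, h2⟩ := hm (y := z) (by
          rw [Real.dist_eq, abs_of_neg (sub_neg.2 hz.2)]; linarith [hz.1])
        have h3 := (abs_le.1 (hu z (Ioo_subset_Icc_self h2) y hy' hz.2.le)).1
        linarith
    linarith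

lemma edgeSuper_min {f F : ℝ → ℝ} {l A B : ℝ} (hF : ∀ x, HasDerivAt F (f x) x) :
    EdgeSuper f l (fun x => min (A + F x) (B - F x)) := by
  intro y _ g d _ hd hmin
  rcases le_total (A + F y) (B - F y) with h | h
  · have : IsLocalMin (fun x => A + F x - g x) y := by
      filter_upwards [hmin] with x hx
      simp only [min_eq_left h] at hx
      linarith [min_le_left (A + F x) (B - F x)]
    have := this.hasDerivAt_eq_zero (((hF y).const_add A).fun_sub hd)
    rw [sub_eq_zero.1 this]
    exact le_abs_self _
  · have : IsLocalMin (fun x => B - F x - g x) y := by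
      filter_upwards [hmin] with x hx
      simp only [min_eq_right h] at hx
      linarith [min_le_right (A + F x) (B - F x)]
    have := this.hasDerivAt_eq_zero (((hF y).const_sub B).fun_sub hd)
    rw [← sub_eq_zero.1 this, abs_neg]
    exact le_abs_self _

namespace Network

variable {N : Network}

lemma param_s (j : N.J) : N.param (N.s j) j = 0 := by simp [param]

lemma param_t (j : N.J) : N.param (N.t j) j = N.l j := by simp [param, N.st_ne j]

lemma sgn_s (j : N.J) : N.sgn (N.s j) j = 1 := by simp [sgn]

lemma sgn_t (j : N.J) : N.sgn (N.t j) j = -1 := by simp [sgn, N.st_ne j]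

lemma s_mem_Inc (j : N.J) : j ∈ N.Inc (N.s j) := Or.inl rfl

lemma t_mem_Inc (j : N.J) : j ∈ N.Inc (N.t j) := Or.inr rfl

lemma abs_sgn (i : N.I) (j : N.J) : |N.sgn i j| = 1 := by
  unfold sgn; split_ifs <;> simp

lemma left_mem_edge (j : N.J) : 0 ∈ N.edge j := left_mem_Icc.2 (N.l_pos j).le

lemma right_mem_edge (j : N.J) : N.l j ∈ N.edge j := right_mem_Icc.2 (N.l_pos j).le

lemma param_mem_edge (i : N.I) (j : N.J) : N.param i j ∈ N.edge j := by
  unfold param; split_ifs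
  exacts [left_mem_edge j, right_mem_edge j]

lemma uniqueDiffOn_edge (j : N.J) : UniqueDiffOn ℝ (N.edge j) := uniqueDiffOn_Icc (N.l_pos j)

lemma pd_eq {u : N.J → ℝ → ℝ} {j : N.J} {x d : ℝ} (h : HasDerivWithinAt (u j) d (N.edge j) x)
    (hx : x ∈ N.edge j) : N.pd u j x = d :=
  h.derivWithin (uniqueDiffOn_edge j x hx)

lemma edge_mem_nhds {j : N.J} {y : ℝ} (hy : y ∈ Ioo 0 (N.l j)) : N.edge j ∈ nhds y :=
  Icc_mem_nhds hy.1 hy.2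

lemma apply_param_of_vertex {u : N.J → ℝ → ℝ} {m : N.I → ℝ}
    (h : ∀ j, u j 0 = m (N.s j) ∧ u j (N.l j) = m (N.t j)) {i : N.I} {j : N.J}
    (hj : j ∈ N.Inc i) : u j (N.param i j) = m i := by
  rcases hj with rfl | rfl
  · rw [param_s]; exact (h j).1
  · rw [param_t]; exact (h j).2

lemma compat_of_vertex {u : N.J → ℝ → ℝ} {m : N.I → ℝ}
    (h : ∀ j, u j 0 = m (N.s j) ∧ u j (N.l j) = m (N.t j)) : N.Compat u := fun i j hj k hk => by
  rw [apply_param_of_vertex h hj, apply_param_of_vertex h hk]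

lemma exists_mem_Inc (i : N.I) : ∃ j, j ∈ N.Inc i := by
  obtain ⟨j₀⟩ := N.neJ
  rcases (N.conn i (N.s j₀)).cases_head with h | ⟨k, ⟨j, h⟩, _⟩
  · exact ⟨j₀, Or.inl h.symm⟩
  · exact ⟨j, h.imp (fun h => h.1) (fun h => h.2)⟩

lemma Compat.exists_vertex {u : N.J → ℝ → ℝ} (h : N.Compat u) :
    ∃ m : N.I → ℝ, ∀ j, u j 0 = m (N.s j) ∧ u j (N.l j) = m (N.t j) := by
  choose e he using N.exists_mem_Inc
  refine ⟨fun i => u (e i) (N.param i (e i)), fun j => ⟨?_, ?_⟩⟩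
  · have := h _ _ (s_mem_Inc j) _ (he _)
    rwa [param_s] at this
  · have := h _ _ (t_mem_Inc j) _ (he _)
    rwa [param_t] at this

lemma exists_ne_mem_Inc {i : N.I} (hi : i ∈ N.IT) (j : N.J) : ∃ k ∈ N.Inc i, k ≠ j := by
  by_contra! h
  obtain ⟨j₀, hj₀⟩ := N.exists_mem_Inc i
  obtain rfl := h _ hj₀
  refine hi (N.deg_one_bd i ?_)
  rw [ncard_eq_one]
  exact ⟨j₀, Subset.antisymm (fun k hk => h k hk) (by rintro _ rfl; exact hj₀)⟩

/-- A continuous function on one edge extends to a continuous function on the network. -/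
lemma exists_isCont_extension (j : N.J) {g : ℝ → ℝ} (hg : ContinuousOn g (N.edge j)) :
    ∃ φ, N.IsCont φ ∧ φ j = g := by
  classical
  let m : N.I → ℝ := fun i => if i = N.s j then g 0 else if i = N.t j then g (N.l j) else 0
  have hs : m (N.s j) = g 0 := if_pos rfl
  have ht : m (N.t j) = g (N.l j) := by
    simp [m, (N.st_ne j).symm]
  refine ⟨fun k => if k = j then g else
    fun x => m (N.s k) + x / N.l k * (m (N.t k) - m (N.s k)),
    ⟨compat_of_vertex (m := m) fun k => ?_,
    fun k => ?_⟩, if_pos rfl⟩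
  · by_cases hk : k = j
    · subst hk
      simp only [if_true, hs, ht, and_self]
    · simp only [if_neg hk, div_self (N.l_pos k).ne']
      constructor <;> ring
  · by_cases hk : k = j
    · subst hk
      simpa using hg
    · simp only [if_neg hk]
      fun_prop

/-- The edge `j` joins the vertices `i` and `k`. -/
def Link (j : N.J) (i k : N.I) : Prop :=
  (N.s j = i ∧ N.t j = k) ∨ (N.t j = i ∧ N.s j = k)

lemma link_st (j : N.J) : N.Link j (N.s j) (N.t j) := Or.inl ⟨rfl, rfl⟩

lemma link_ts (j : N.J) : N.Link j (N.t j) (N.s j) := Or.inr ⟨rfl, rfl⟩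

lemma Link.ne {j : N.J} {i k : N.I} (h : N.Link j i k) : i ≠ k := by
  rcases h with ⟨rfl, rfl⟩ | ⟨rfl, rfl⟩
  exacts [N.st_ne j, (N.st_ne j).symm]

lemma exists_link_of_mem_Inc {i : N.I} {j : N.J} (h : j ∈ N.Inc i) : ∃ k, N.Link j i k := by
  rcases h with rfl | rfl
  exacts [⟨_, link_st j⟩, ⟨_, link_ts j⟩]

lemma Link.mem_Inc {j : N.J} {i k : N.I} (h : N.Link j i k) : j ∈ N.Inc i :=
  h.imp And.left And.left

/-- Comparison principle for the discrete eikonal equation on the vertices. -/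
lemma le_of_link {L : N.J → ℝ} (hL : ∀ j, 0 < L j) {a b : N.I → ℝ}
    (ha : ∀ i ∈ N.IT, ∀ j k, N.Link j i k → a i ≤ a k + L j)
    (hb : ∀ i ∈ N.IT, ∃ j k, N.Link j i k ∧ b k + L j ≤ b i)
    (hB : ∀ i ∈ N.IB, a i ≤ b i) (i : N.I) : a i ≤ b i := by
  classical
  by_contra! hi
  obtain ⟨i₀, hi₀⟩ := Finite.exists_max fun i => a i - b i
  obtain ⟨i₁, h₁, hmin⟩ := Finset.exists_min_image
    (Finset.univ.filter fun i => a i₀ - b i₀ ≤ a i - b i) b ⟨i₀, by simp⟩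
  simp only [Finset.mem_filter, Finset.mem_univ, true_and] at h₁ hmin
  have hT : i₁ ∈ N.IT := fun h => by linarith [hB i₁ h, hi₀ i]
  obtain ⟨j, k, hl, hk⟩ := hb i₁ hT
  have := hmin k (by linarith [ha i₁ hT j k hl])
  linarith [hL j]

/-- The discrete eikonal equation has a solution. -/
lemma exists_vertex_dist {L : N.J → ℝ} (hL : ∀ j, 0 < L j) :
    ∃ d : N.I → ℝ, (∀ i ∈ N.IB, d i = 0) ∧ (∀ j i k, N.Link j i k → d i ≤ d k + L j) ∧
      (∀ i ∈ N.IT, ∃ j k, N.Link j i k ∧ d k + L j = d i) := by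
  classical
  set S : Set (N.I → ℝ) := {d | (∀ i ∈ N.IB, d i = 0) ∧ ∀ j i k, N.Link j i k → d i ≤ d k + L j}
    with hS
  obtain ⟨i₀, hi₀⟩ := N.IB_ne
  have hbd : ∀ i, ∃ C, ∀ d ∈ S, |d i| ≤ C := by
    intro i
    induction N.conn i₀ i with
    | refl => exact ⟨0, fun d hd => by simp [hd.1 _ hi₀]⟩
    | tail _ h ih =>
      obtain ⟨C, hC⟩ := ih
      obtain ⟨j, hj⟩ := h
      refine ⟨C + L j, fun d hd => abs_le.2 ?_⟩
      have h1 := abs_le.1 (hC d hd)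
      have h2 := hd.2 j _ _ (link_st j)
      have h3 := hd.2 j _ _ (link_ts j)
      rcases hj with ⟨rfl, rfl⟩ | ⟨rfl, rfl⟩ <;> constructor <;> linarith
  choose C hC using hbd
  have hcl : IsClosed S := by
    have : S = (⋂ i ∈ N.IB, {d | d i = 0}) ∩
        ⋂ j, ⋂ i, ⋂ k, ⋂ (_ : N.Link j i k), {d | d i ≤ d k + L j} := by
      ext d; simp [hS]
    rw [this]
    refine (isClosed_biInter fun i _ => isClosed_eq (by fun_prop) (by fun_prop)).inter
      (isClosed_iInter fun j => isClosed_iInter fun i => isClosed_iInter fun k =>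
        isClosed_iInter fun _ => isClosed_le (by fun_prop) (by fun_prop))
  have hcpt : IsCompact S := by
    refine (isCompact_univ_pi fun i => isCompact_Icc (a := -C i) (b := C i)).of_isClosed_subset hcl
      fun d hd i _ => abs_le.1 (hC i d hd)
  obtain ⟨d, hd, hmax⟩ := hcpt.exists_isMaxOn
    ⟨0, fun _ _ => rfl, fun j _ _ _ => by simpa using (hL j).le⟩
    (f := fun d => ∑ i, d i) (by fun_prop)
  refine ⟨d, hd.1, hd.2, fun i hi => ?_⟩
  by_contra! hne
  have hev : ∀ᶠ η in nhdsWithin (0 : ℝ) (Ioi 0), ∀ j k, N.Link j i k → d i + η < d k + L j := by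
    rw [Filter.eventually_all]; intro j
    rw [Filter.eventually_all]; intro k
    by_cases hl : N.Link j i k
    · have hlt := (hd.2 j i k hl).lt_of_ne (hne j k hl).symm
      have : Filter.Tendsto (fun η => d i + η) (nhdsWithin (0 : ℝ) (Ioi 0)) (nhds (d i)) := by
        refine Filter.Tendsto.mono_left ?_ nhdsWithin_le_nhds
        have : Continuous fun η : ℝ => d i + η := by fun_prop
        simpa using this.tendsto 0
      filter_upwards [this.eventually_lt_const hlt] with η hη _ using hη
    · exact Filter.Eventually.of_forall fun _ h => absurd h hl
  obtain ⟨η, hη, hpos⟩ := (hev.and self_mem_nhdsWithin).exists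
  have hpos : 0 < η := hpos
  have hmem : Function.update d i (d i + η) ∈ S := by
    refine ⟨fun k hk => ?_, fun j k k' hl => ?_⟩
    · rw [Function.update_of_ne (by rintro rfl; exact hi hk)]
      exact hd.1 k hk
    · by_cases h1 : k = i
      · subst h1
        rw [Function.update_self, Function.update_of_ne hl.ne.symm]
        exact (hη j k' hl).le
      · rw [Function.update_of_ne h1]
        by_cases h2 : k' = i
        · subst h2
          rw [Function.update_self]
          linarith [hd.2 j k k' hl]
        · rw [Function.update_of_ne h2]
          exact hd.2 j k k' hl
  have h1 : ∑ k, Function.update d i (d i + η) k ≤ ∑ k, d k := hmax hmem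
  have h2 : ∑ k, d k < ∑ k, Function.update d i (d i + η) k := by
    refine Finset.sum_lt_sum (fun k _ => ?_) ⟨i, Finset.mem_univ _, by simp [hpos]⟩
    by_cases h1 : k = i
    · subst h1; simp [hpos.le]
    · rw [Function.update_of_ne h1]
  linarith

end Network

namespace Network

variable {N : Network}

lemma IsViscSol.congr {H H' : N.J → ℝ → ℝ → ℝ → ℝ} {u : N.J → ℝ → ℝ}
    (hH : ∀ j, ∀ x ∈ N.edge j, ∀ r p, H j x r p = H' j x r p) (h : N.IsViscSol H u) :
    N.IsViscSol H' u := by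
  obtain ⟨hc, ⟨h1, h2, h3⟩, ⟨h4, h5, h6⟩⟩ := h
  refine ⟨hc, ⟨h1, fun j y hy φ a b c => ?_, fun i hi j hj k hk hjk φ a b => ?_⟩,
    ⟨h4, fun j y hy φ a b c => ?_, fun i hi j hj => ?_⟩⟩
  · rw [← hH j y (Ioo_subset_Icc_self hy)]
    exact h2 j y hy φ a b c
  · rw [← hH j _ (param_mem_edge i j)]
    exact h3 i hi j hj k hk hjk φ a b
  · rw [← hH j y (Ioo_subset_Icc_self hy)]
    exact h5 j y hy φ a b c
  · obtain ⟨k, hk, hkj, hφ⟩ := h6 i hi j hj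
    refine ⟨k, hk, hkj, fun φ a b => ?_⟩
    rw [← hH j _ (param_mem_edge i j)]
    exact hφ φ a b

lemma IsViscSol.edgeSub {f u : N.J → ℝ → ℝ} (h : N.IsViscSol (fun j x _ p => |p| - f j x) u)
    (j : N.J) : EdgeSub (f j) (N.l j) (u j) := by
  intro y hy g d hg hd hmax
  obtain ⟨φ, hφ, rfl⟩ := exists_isCont_extension j hg
  obtain ⟨δ, hδ, hm⟩ := Metric.eventually_nhds_iff.1 hmax
  have := h.2.1.2.1 j y hy φ hφ hd.differentiableAt.differentiableWithinAt
    ⟨δ, hδ, fun x _ hx => hm hx⟩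
  rw [pd_eq hd.hasDerivWithinAt (Ioo_subset_Icc_self hy)] at this
  linarith

lemma IsViscSol.edgeSuper {f u : N.J → ℝ → ℝ} (h : N.IsViscSol (fun j x _ p => |p| - f j x) u)
    (j : N.J) : EdgeSuper (f j) (N.l j) (u j) := by
  intro y hy g d hg hd hmin
  obtain ⟨φ, hφ, rfl⟩ := exists_isCont_extension j hg
  obtain ⟨δ, hδ, hm⟩ := Metric.eventually_nhds_iff.1 hmin
  have := h.2.2.2.1 j y hy φ hφ hd.differentiableAt.differentiableWithinAt
    ⟨δ, hδ, fun x _ hx => hm hx⟩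
  rw [pd_eq hd.hasDerivWithinAt (Ioo_subset_Icc_self hy)] at this
  linarith

lemma pd_hasDerivAt {φ : N.J → ℝ → ℝ} {j : N.J} {y : ℝ} (hy : y ∈ Ioo 0 (N.l j))
    (h : DifferentiableWithinAt ℝ (φ j) (N.edge j) y) : HasDerivAt (φ j) (N.pd φ j y) y :=
  h.hasDerivWithinAt.hasDerivAt (edge_mem_nhds hy)

lemma sgn_mul_le {F f : N.J → ℝ → ℝ} (hF : ∀ j x, HasDerivAt (F j) (f j x) x)
    (hFm : ∀ j, Monotone (F j)) {g : ℝ → ℝ} {c d : ℝ} {i : N.I} {j : N.J} (hj : j ∈ N.Inc i)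
    (hg : HasDerivWithinAt g d (N.edge j) (N.param i j))
    (h : ∃ δ > 0, ∀ x ∈ N.edge j, |x - N.param i j| < δ →
      g x - g (N.param i j) ≤ c * |F j x - F j (N.param i j)|) :
    N.sgn i j * d ≤ c * f j (N.param i j) := by
  obtain ⟨δ, hδ, h⟩ := h
  rcases hj with rfl | rfl
  · rw [param_s] at *
    rw [sgn_s, one_mul]
    refine deriv_le_mul_of_right (N.l_pos j) hg (hF j 0) ⟨δ, hδ, fun x hx hxδ => ?_⟩
    have := h x hx hxδ
    rwa [abs_of_nonneg (sub_nonneg.2 (hFm j hx.1))] at this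
  · rw [param_t] at *
    rw [sgn_t, neg_one_mul]
    refine neg_deriv_le_mul_of_left (N.l_pos j) hg (hF j _) ⟨δ, hδ, fun x hx hxδ => ?_⟩
    have := h x hx hxδ
    rwa [abs_sub_comm, abs_of_nonneg (sub_nonneg.2 (hFm j hx.2))] at this

/-- The distance-like function on the network with vertex values `d` and edge weights `F`. -/
def distFun (N : Network) (F : N.J → ℝ → ℝ) (d : N.I → ℝ) (j : N.J) (x : ℝ) : ℝ :=
  min (d (N.s j) + F j x) (d (N.t j) + F j (N.l j) - F j x)

section

variable {F f : N.J → ℝ → ℝ} {d : N.I → ℝ}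

lemma distFun_vertex (hF0 : ∀ j, F j 0 = 0)
    (hd : ∀ j i k, N.Link j i k → d i ≤ d k + F j (N.l j)) (j : N.J) :
    N.distFun F d j 0 = d (N.s j) ∧ N.distFun F d j (N.l j) = d (N.t j) := by
  have h1 := hd j _ _ (link_st j)
  have h2 := hd j _ _ (link_ts j)
  simp only [distFun, hF0]
  constructor
  · rw [min_eq_left (by linarith)]; ring
  · rw [min_eq_right (by linarith)]; ring

lemma abs_distFun_sub_le (hFm : ∀ j, Monotone (F j)) (j : N.J) {x y : ℝ} (hxy : x ≤ y) :
    |N.distFun F d j x - N.distFun F d j y| ≤ F j y - F j x := by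
  refine (abs_min_sub_min_le_max _ _ _ _).trans (max_le ?_ ?_)
  · rw [abs_le]; constructor <;> linarith [hFm j hxy]
  · rw [abs_le]; constructor <;> linarith [hFm j hxy]

lemma distFun_isViscSol (hF : ∀ j x, HasDerivAt (F j) (f j x) x) (hf : ∀ j x, 0 < f j x)
    (hfc : N.Compat f) (hF0 : ∀ j, F j 0 = 0)
    (hd : ∀ j i k, N.Link j i k → d i ≤ d k + F j (N.l j))
    (hd' : ∀ i ∈ N.IT, ∃ j k, N.Link j i k ∧ d k + F j (N.l j) = d i) :
    N.IsViscSol (fun j x _ p => |p| - f j x) (N.distFun F d) := by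
  have hFm : ∀ j, Monotone (F j) := fun j => (strictMono_of_hasDerivAt_pos (hF j) (hf j)).monotone
  have hFc : ∀ j, Continuous (F j) := fun j =>
    continuous_iff_continuousAt.2 fun x => (hF j x).continuousAt
  have hcompat : N.Compat (N.distFun F d) := compat_of_vertex (distFun_vertex hF0 hd)
  have hcont : ∀ j, ContinuousOn (N.distFun F d j) (N.edge j) := fun j => by
    have := hFc j
    unfold distFun
    fun_prop
  refine ⟨⟨hcompat, hcont⟩, ⟨⟨hcompat, fun j => (hcont j).upperSemicontinuousOn⟩, ?_, ?_⟩,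
    ⟨⟨hcompat, fun j => (hcont j).lowerSemicontinuousOn⟩, ?_, ?_⟩⟩
  · rintro j y hy φ hφ hφd ⟨δ, hδ, hmax⟩
    refine sub_nonpos.2 (edgeSub_of_abs_sub_le (u := N.distFun F d j) (hF j)
      (fun x _ y _ h => abs_distFun_sub_le hFm j h)
      y hy (φ j) _ (hφ.2 j) (pd_hasDerivAt hy hφd) ?_)
    filter_upwards [edge_mem_nhds hy, Metric.ball_mem_nhds y hδ] with x hx hx' using hmax x hx hx'
  · rintro i hi j hj k hk - φ ⟨hφ, hφj, hφk, hsum⟩ ⟨δ, hδ, hmj, hmk⟩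
    have key : ∀ m ∈ N.Inc i, DifferentiableWithinAt ℝ (φ m) (N.edge m) (N.param i m) →
        (∀ x ∈ N.edge m, |x - N.param i m| < δ → N.distFun F d m x - φ m x ≤
          N.distFun F d m (N.param i m) - φ m (N.param i m)) →
        -f m (N.param i m) ≤ N.sgn i m * N.pd φ m (N.param i m) := by
      intro m hm hφm hmax
      have := sgn_mul_le hF hFm (c := 1) hm hφm.hasDerivWithinAt.fun_neg
        ⟨δ, hδ, fun x hx hxδ => by
          have h1 := hmax x hx hxδ
          have h2 : |N.distFun F d m x - N.distFun F d m (N.param i m)| ≤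
              |F m x - F m (N.param i m)| := by
            rcases le_total x (N.param i m) with h | h
            · exact (abs_distFun_sub_le hFm m h).trans
                (by rw [abs_sub_comm]; exact le_abs_self _)
            · rw [abs_sub_comm]
              exact (abs_distFun_sub_le hFm m h).trans (le_abs_self _)
          linarith [(abs_le.1 h2).1]⟩
      simp only [pd]
      linarith
    have h1 := key j hj hφj hmj
    have h2 := key k hk hφk hmk
    have h3 := hfc i j hj k hk
    have : |N.sgn i j * N.pd φ j (N.param i j)| ≤ f j (N.param i j) :=
      abs_le.2 ⟨h1, by linarith⟩
    rw [abs_mul, abs_sgn, one_mul] at this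
    simpa using this
  · rintro j y hy φ hφ hφd ⟨δ, hδ, hmin⟩
    refine sub_nonneg.2 (edgeSuper_min (A := d (N.s j)) (B := d (N.t j) + F j (N.l j)) (hF j)
      y hy (φ j) _ (hφ.2 j) (pd_hasDerivAt hy hφd) ?_)
    filter_upwards [edge_mem_nhds hy, Metric.ball_mem_nhds y hδ] with x hx hx' using hmin x hx hx'
  · intro i hi j hj
    obtain ⟨k, i', hl, hk⟩ := hd' i hi
    have key : ∀ φ : N.J → ℝ → ℝ, DifferentiableWithinAt ℝ (φ k) (N.edge k) (N.param i k) →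
        (∃ δ > 0, ∀ x ∈ N.edge k, |x - N.param i k| < δ →
          N.distFun F d k (N.param i k) - φ k (N.param i k) ≤ N.distFun F d k x - φ k x) →
        f k (N.param i k) ≤ |N.pd φ k (N.param i k)| := by
      rintro φ hφk ⟨δ, hδ, hmin⟩
      have hv := apply_param_of_vertex (distFun_vertex hF0 hd) hl.mem_Inc
      have := sgn_mul_le hF hFm (c := -1) hl.mem_Inc hφk.hasDerivWithinAt
        ⟨δ, hδ, fun x hx hxδ => by
          have h1 := hmin x hx hxδ
          rw [hv] at h1
          have h2 : N.distFun F d k x ≤ d i - |F k x - F k (N.param i k)| := by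
            rcases hl with ⟨rfl, rfl⟩ | ⟨rfl, rfl⟩
            · rw [param_s, hF0, sub_zero, abs_of_nonneg (by rw [← hF0 k]; exact hFm k hx.1)]
              exact (min_le_right _ _).trans (by linarith)
            · rw [param_t, abs_sub_comm, abs_of_nonneg (sub_nonneg.2 (hFm k hx.2))]
              exact (min_le_left _ _).trans (by linarith)
          linarith⟩
      have h3 : |N.sgn i k * N.pd φ k (N.param i k)| = |N.pd φ k (N.param i k)| := by
        rw [abs_mul, abs_sgn, one_mul]
      rw [← h3]
      refine le_trans ?_ (neg_le_abs _)
      unfold pd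
      linarith
    by_cases hjk : k = j
    · subst hjk
      obtain ⟨k', hk', hne⟩ := exists_ne_mem_Inc hi k
      refine ⟨k', hk', hne, ?_⟩
      rintro φ ⟨-, hφ, -, -⟩ ⟨δ, hδ, h, -⟩
      exact sub_nonneg.2 (key φ hφ ⟨δ, hδ, h⟩)
    · refine ⟨k, hl.mem_Inc, hjk, ?_⟩
      rintro φ ⟨-, -, hφ, hsum⟩ ⟨δ, hδ, -, h⟩
      have h1 := key φ hφ ⟨δ, hδ, h⟩
      have h2 : |N.sgn i j * N.pd φ j (N.param i j)| = |N.sgn i k * N.pd φ k (N.param i k)| := by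
        rw [eq_neg_of_add_eq_zero_left hsum, abs_neg]
      rw [abs_mul, abs_mul, abs_sgn, abs_sgn, one_mul, one_mul] at h2
      rw [sub_nonneg, h2, hfc i j hj k hl.mem_Inc]
      exact h1

/-- Uniqueness for the Dirichlet problem of the eikonal equation on the network. -/
lemma IsViscSol.eq_distFun {u : N.J → ℝ → ℝ}
    (hu : N.IsViscSol (fun j x _ p => |p| - f j x) u) {α : ℝ} (hα : 0 < α)
    (hfα : ∀ j x, α ≤ f j x) (hF : ∀ j x, HasDerivAt (F j) (f j x) x) (hF0 : ∀ j, F j 0 = 0)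
    (hd0 : ∀ i ∈ N.IB, d i = 0)
    (hd : ∀ j i k, N.Link j i k → d i ≤ d k + F j (N.l j))
    (hd' : ∀ i ∈ N.IT, ∃ j k, N.Link j i k ∧ d k + F j (N.l j) = d i)
    (hu0 : ∀ i ∈ N.IB, ∀ j ∈ N.Inc i, u j (N.param i j) = 0) (j : N.J) {x : ℝ}
    (hx : x ∈ N.edge j) : u j x = N.distFun F d j x := by
  have hFm : ∀ j, StrictMono (F j) := fun j =>
    strictMono_of_hasDerivAt_pos (hF j) fun x => hα.trans_le (hfα j x)
  have hL : ∀ j, 0 < F j (N.l j) := fun j => by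
    rw [← hF0 j]; exact hFm j (N.l_pos j)
  obtain ⟨m, hm⟩ := hu.1.1.exists_vertex
  have hub := fun j {x y : ℝ} => sub_le_of_edgeSub hα (hfα j) (hF j) (hu.1.2 j) (hu.edgeSub j)
    (x := x) (y := y)
  have hub' := fun j {x y : ℝ} => sub_le_of_edgeSub' hα (hfα j) (hF j) (hu.1.2 j) (hu.edgeSub j)
    (x := x) (y := y)
  have hlb := fun j {y : ℝ} => min_le_of_edgeSuper hα (hfα j) (hF j) (hu.1.2 j) (hu.edgeSuper j)
    (y := y)
  have hmB : ∀ i ∈ N.IB, m i = 0 := fun i hi => by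
    obtain ⟨j, hj⟩ := N.exists_mem_Inc i
    rw [← apply_param_of_vertex hm hj, hu0 i hi j hj]
  have hmL : ∀ j i k, N.Link j i k → m i ≤ m k + F j (N.l j) := by
    rintro j i k (⟨rfl, rfl⟩ | ⟨rfl, rfl⟩)
    · have := hub' j le_rfl (N.l_pos j).le le_rfl
      rw [(hm j).1, (hm j).2, hF0] at this
      linarith
    · have := hub j le_rfl (N.l_pos j).le le_rfl
      rw [(hm j).1, (hm j).2, hF0] at this
      linarith
  have hmT : ∀ i ∈ N.IT, ∃ j k, N.Link j i k ∧ m k + F j (N.l j) ≤ m i := by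
    intro i hi
    by_contra! hlt
    have hmin : ∀ j ∈ N.Inc i, ∃ δ > 0, ∀ x ∈ N.edge j, |x - N.param i j| < δ →
        u j (N.param i j) ≤ u j x := by
      intro j hj
      rw [apply_param_of_vertex hm hj]
      have hFc : Continuous (F j) := continuous_iff_continuousAt.2 fun x => (hF j x).continuousAt
      obtain ⟨k, hl⟩ := exists_link_of_mem_Inc hj
      have hlt := hlt j k hl
      rcases hl with ⟨rfl, rfl⟩ | ⟨rfl, rfl⟩
      · rw [param_s]
        have : ∀ᶠ x in nhds 0, m (N.s j) < m (N.t j) + F j (N.l j) - F j x := by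
          have hc : Continuous fun x => m (N.t j) + F j (N.l j) - F j x := by fun_prop
          exact hc.continuousAt.eventually_const_lt (by simp only [hF0]; linarith)
        obtain ⟨δ, hδ, h⟩ := Metric.eventually_nhds_iff.1 this
        refine ⟨min δ (N.l j), lt_min hδ (N.l_pos j), fun x hx hxδ => ?_⟩
        obtain ⟨h1, h2⟩ := lt_min_iff.1 hxδ
        rcases hx.1.eq_or_lt with rfl | hx0
        · exact (hm j).1.ge
        have h3 := hlb j (y := x) ⟨hx0, by rwa [sub_zero, abs_of_pos hx0] at h2⟩
        refine le_trans (le_min ?_ ?_) h3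
        · rw [(hm j).1]; linarith [hFm j hx0]
        · rw [(hm j).2]; exact (h h1).le
      · rw [param_t]
        have : ∀ᶠ x in nhds (N.l j), m (N.t j) < m (N.s j) + F j x := by
          have hc : Continuous fun x => m (N.s j) + F j x := by fun_prop
          exact hc.continuousAt.eventually_const_lt (by linarith)
        obtain ⟨δ, hδ, h⟩ := Metric.eventually_nhds_iff.1 this
        refine ⟨min δ (N.l j), lt_min hδ (N.l_pos j), fun x hx hxδ => ?_⟩
        obtain ⟨h1, h2⟩ := lt_min_iff.1 hxδ
        rcases hx.2.eq_or_lt with rfl | hx0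
        · exact (hm j).2.ge
        have h3 := hlb j (y := x) ⟨by
          rw [abs_of_neg (sub_neg.2 hx0)] at h2; linarith, hx0⟩
        refine le_trans (le_min ?_ ?_) h3
        · rw [(hm j).1, hF0]; linarith [h h1]
        · rw [(hm j).2]; linarith [hFm j hx0]
    obtain ⟨j, hj⟩ := N.exists_mem_Inc i
    obtain ⟨k, hk, -, hφ⟩ := hu.2.2.2.2 i hi j hj
    obtain ⟨δ, hδ, h1⟩ := hmin j hj
    obtain ⟨δ', hδ', h2⟩ := hmin k hk
    have hpd : ∀ k y, N.pd (fun _ _ => (0 : ℝ)) k y = 0 := fun k y => by simp [pd]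
    have := hφ (fun _ _ => 0) ⟨⟨fun _ _ _ _ _ => rfl, fun _ => continuousOn_const⟩,
      differentiableWithinAt_const _, differentiableWithinAt_const _, by simp [hpd]⟩
      ⟨min δ δ', lt_min hδ hδ',
        fun x hx hxδ => by simpa using h1 x hx (hxδ.trans_le (min_le_left _ _)),
        fun x hx hxδ => by simpa using h2 x hx (hxδ.trans_le (min_le_right _ _))⟩
    simp only [hpd, abs_zero] at this
    linarith [hfα j (N.param i j)]
  have hle := le_of_link hL (fun i _ j k hl => hmL j i k hl)
    (fun i hi => (hd' i hi).imp fun j => Exists.imp fun k h => ⟨h.1, h.2.le⟩)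
    (fun i hi => by rw [hmB i hi, hd0 i hi])
  have hge := le_of_link hL (fun i _ j k hl => hd j i k hl) hmT
    (fun i hi => by rw [hmB i hi, hd0 i hi])
  obtain rfl : m = d := funext fun i => le_antisymm (hle i) (hge i)
  rcases hx.1.eq_or_lt with rfl | hx0
  · rw [(hm j).1, (distFun_vertex hF0 hd j).1]
  rcases hx.2.eq_or_lt with rfl | hxl
  · rw [(hm j).2, (distFun_vertex hF0 hd j).2]
  refine le_antisymm (le_min ?_ ?_) ?_
  · have := hub j le_rfl hx.1 hx.2
    rw [(hm j).1, hF0] at this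
    linarith
  · have := hub' j hx.1 hx.2 le_rfl
    rw [(hm j).2] at this
    linarith
  · have := hlb j ⟨hx0, hxl⟩
    rwa [(hm j).1, (hm j).2, hF0, sub_zero] at this

end

end Network

namespace Network

variable {N : Network}

lemma incSum_pos {i : N.I} {f : N.J → ℝ} (h : ∀ j ∈ N.Inc i, 0 < f j) : 0 < N.incSum i f := by
  obtain ⟨j, hj⟩ := N.exists_mem_Inc i
  unfold incSum
  refine Finset.sum_pos' (fun k _ => ?_) ⟨j, Finset.mem_univ _, by rw [if_pos hj]; exact h j hj⟩
  split_ifs with hk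
  exacts [(h k hk).le, le_rfl]

lemma eq_zero_of_incSum_eq_zero {i : N.I} {f : N.J → ℝ} (h : ∀ j ∈ N.Inc i, 0 ≤ f j)
    (h0 : N.incSum i f = 0) : ∀ j ∈ N.Inc i, f j = 0 := by
  intro j hj
  have := (Finset.sum_eq_zero_iff_of_nonneg (fun k _ => by
    split_ifs with hk
    exacts [h k hk, le_rfl])).1 h0 j (Finset.mem_univ _)
  rwa [if_pos hj] at this

open scoped Classical in
lemma le_incSum {i : N.I} {f : N.J → ℝ} (h : ∀ j ∈ N.Inc i, 0 ≤ f j) {j : N.J}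
    (hj : j ∈ N.Inc i) : f j ≤ N.incSum i f := by
  unfold incSum
  have h0 : ∀ k ∈ Finset.univ, 0 ≤ if k ∈ N.Inc i then f k else 0 := fun k _ => by
    split_ifs with hk
    exacts [h k hk, le_rfl]
  simpa only [if_pos hj] using Finset.single_le_sum h0 (Finset.mem_univ j)

lemma incSum_congr {i : N.I} {f g : N.J → ℝ} (h : ∀ j ∈ N.Inc i, f j = g j) :
    N.incSum i f = N.incSum i g := by
  unfold incSum
  refine Finset.sum_congr rfl fun k _ => ?_
  split_ifs with hk
  exacts [h k hk, rfl]

lemma incSum_lincomb (i : N.I) (f g : N.J → ℝ) (c d : ℝ) :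
    N.incSum i (fun j => c * f j + d * g j) = c * N.incSum i f + d * N.incSum i g := by
  unfold incSum
  rw [Finset.mul_sum, Finset.mul_sum, ← Finset.sum_add_distrib]
  refine Finset.sum_congr rfl fun k _ => ?_
  split_ifs <;> simp

lemma incSum_const_mul (i : N.I) (f : N.J → ℝ) (c : ℝ) :
    N.incSum i (fun j => c * f j) = c * N.incSum i f := by
  simpa using incSum_lincomb i f f c 0

/-- Solutions `w` (with derivative `p` and vertex values `m`) of `w'' = q w` on the network,
subject to the Kirchhoff conditions. -/
structure NetSol (N : Network) (β : N.I → N.J → ℝ) (q : N.J → ℝ → ℝ) (w p : N.J → ℝ → ℝ)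
    (m : N.I → ℝ) : Prop where
  sol : ∀ j, EdgeSol (q j) 0 (N.l j) (w j) (p j)
  vertex : ∀ j, w j 0 = m (N.s j) ∧ w j (N.l j) = m (N.t j)
  kirchhoff : ∀ i ∈ N.IT, N.incSum i (fun j => β i j * N.sgn i j * p j (N.param i j)) = 0

namespace NetSol

variable {β : N.I → N.J → ℝ} {q : N.J → ℝ → ℝ} {w p w₁ p₁ : N.J → ℝ → ℝ} {m m₁ : N.I → ℝ}

lemma lincomb (h : NetSol N β q w p m) (h₁ : NetSol N β q w₁ p₁ m₁) (c d : ℝ) :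
    NetSol N β q (fun j x => c * w j x + d * w₁ j x) (fun j x => c * p j x + d * p₁ j x)
      (fun i => c * m i + d * m₁ i) := by
  refine ⟨fun j => (h.sol j).lincomb (h₁.sol j) c d, fun j => ?_, fun i hi => ?_⟩
  · simp only [(h.vertex j).1, (h.vertex j).2, (h₁.vertex j).1, (h₁.vertex j).2, and_self]
  · have := incSum_lincomb i (fun j => β i j * N.sgn i j * p j (N.param i j))
      (fun j => β i j * N.sgn i j * p₁ j (N.param i j)) c d
    rw [h.kirchhoff i hi, h₁.kirchhoff i hi] at this
    rw [← incSum_congr fun j _ => ?_] at this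
    · simpa using this
    · ring

/-- Every edge can be parametrized so that it starts at a given end. -/
lemma exists_edgeSol_of_link (h : NetSol N β q w p m) {Q : N.J → ℝ}
    (hq : ∀ j x, 0 < q j x ∧ q j x ≤ Q j) {j : N.J} {i k : N.I} (hl : N.Link j i k) :
    ∃ (q' : ℝ → ℝ) (a b : ℝ) (w' p' : ℝ → ℝ), EdgeSol q' a b w' p' ∧ a < b ∧
      (∀ x, 0 < q' x ∧ q' x ≤ Q j) ∧ w' a = m i ∧ w' b = m k ∧
      p' a = N.sgn i j * p j (N.param i j) := by
  rcases hl with ⟨rfl, rfl⟩ | ⟨rfl, rfl⟩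
  · exact ⟨q j, 0, N.l j, w j, p j, h.sol j, N.l_pos j, hq j, (h.vertex j).1, (h.vertex j).2,
      by rw [sgn_s, param_s, one_mul]⟩
  · exact ⟨_, _, _, _, _, (h.sol j).reflect, neg_lt_neg (N.l_pos j), fun x => hq j (-x),
      by simpa using (h.vertex j).2, by simpa using (h.vertex j).1,
      by rw [sgn_t, param_t, neg_one_mul, neg_neg]⟩

lemma le_of_boundary_le (h : NetSol N β q w p m) (hβ : ∀ i ∈ N.IT, ∀ j ∈ N.Inc i, 0 < β i j)
    {Q : N.J → ℝ} (hq : ∀ j x, 0 < q j x ∧ q j x ≤ Q j) {c : ℝ} (hc : 0 ≤ c)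
    (hB : ∀ i ∈ N.IB, m i ≤ c) (i : N.I) : m i ≤ c := by
  by_contra! hi
  obtain ⟨i₀, hi₀⟩ := Finite.exists_max m
  have hlt : c < m i₀ := hi.trans_le (hi₀ i)
  have hT : i₀ ∈ N.IT := fun hB' => (hB i₀ hB').not_gt hlt
  have hpos := incSum_pos (i := i₀) (f := fun j => -1 * (β i₀ j * N.sgn i₀ j * p j (N.param i₀ j)))
    fun j hj => by
      obtain ⟨k, hl⟩ := exists_link_of_mem_Inc hj
      obtain ⟨q', a, b, w', p', hs, hab, hq', ha, hb, hp⟩ := h.exists_edgeSol_of_link hq hl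
      have := hs.neg.deriv_pos_of_min_neg (fun x _ => hq' x) hab (by rw [ha]; linarith)
        (by rw [ha, hb]; exact neg_le_neg (hi₀ k))
      rw [hp] at this
      have := mul_pos (hβ i₀ hT j hj) this
      linarith
  rw [incSum_const_mul, h.kirchhoff i₀ hT] at hpos
  simp at hpos

lemma nonneg (h : NetSol N β q w p m) (hβ : ∀ i ∈ N.IT, ∀ j ∈ N.Inc i, 0 < β i j)
    {Q : N.J → ℝ} (hq : ∀ j x, 0 < q j x ∧ q j x ≤ Q j)
    (hB : ∀ i ∈ N.IB, 0 ≤ m i) (i : N.I) : 0 ≤ m i := by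
  have := (h.lincomb h (-1) 0).le_of_boundary_le hβ hq le_rfl (fun i hi => by
    have := hB i hi; linarith) i
  linarith

lemma eq_of_boundary_eq (h : NetSol N β q w p m) (h₁ : NetSol N β q w₁ p₁ m₁)
    (hβ : ∀ i ∈ N.IT, ∀ j ∈ N.Inc i, 0 < β i j)
    {Q : N.J → ℝ} (hq : ∀ j x, 0 < q j x ∧ q j x ≤ Q j)
    (hB : ∀ i ∈ N.IB, m i = m₁ i) (j : N.J) {x : ℝ} (hx : x ∈ N.edge j) : w j x = w₁ j x := by
  have hd := h.lincomb h₁ 1 (-1)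
  have h0 : ∀ i, 1 * m i + -1 * m₁ i = 0 := fun i => le_antisymm
    (hd.le_of_boundary_le hβ hq le_rfl (fun i hi => by rw [hB i hi]; linarith) i)
    (hd.nonneg hβ hq (fun i hi => by rw [hB i hi]; linarith) i)
  have := (hd.sol j).eq_zero_of_ends (fun x _ => ⟨(hq j x).1.le, (hq j x).2⟩)
    ((hd.vertex j).1.trans (h0 _)) ((hd.vertex j).2.trans (h0 _)) x hx
  linarith

lemma vertex_pos (h : NetSol N β q w p m) (hβ : ∀ i ∈ N.IT, ∀ j ∈ N.Inc i, 0 < β i j)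
    {Q : N.J → ℝ} (hq : ∀ j x, 0 < q j x ∧ q j x ≤ Q j)
    (hB : ∀ i ∈ N.IB, 0 < m i) (i : N.I) : 0 < m i := by
  have hm := h.nonneg hβ hq fun i hi => (hB i hi).le
  refine (hm i).lt_of_ne fun h0 => ?_
  have hstep : ∀ i, m i = 0 → ∀ j k, N.Link j i k → m k = 0 := by
    intro i hi j k hl
    have hT : i ∈ N.IT := fun hB' => (hB i hB').ne' hi
    have hnn : ∀ j ∈ N.Inc i, 0 ≤ β i j * N.sgn i j * p j (N.param i j) := by
      intro j hj
      obtain ⟨k, hl⟩ := exists_link_of_mem_Inc hj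
      obtain ⟨q', a, b, w', p', hs, hab, hq', ha, hb, hp⟩ := h.exists_edgeSol_of_link hq hl
      have := hs.deriv_nonneg_of_min_zero (fun x _ => hq' x) hab (ha.trans hi) (hb ▸ hm k)
      rw [hp] at this
      have := mul_nonneg (hβ i hT j hj).le this
      linarith
    have hz := eq_zero_of_incSum_eq_zero hnn (h.kirchhoff i hT) j hl.mem_Inc
    obtain ⟨q', a, b, w', p', hs, hab, hq', ha, hb, hp⟩ := h.exists_edgeSol_of_link hq hl
    rw [mul_assoc, ← hp] at hz
    have hp0 := (mul_eq_zero.1 hz).resolve_left (hβ i hT j hl.mem_Inc).ne'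
    rw [← hb]
    exact hs.eq_zero_of_init (fun x _ => ⟨(hq' x).1.le, (hq' x).2⟩) (ha.trans hi) hp0 b
      (right_mem_Icc.2 hab.le)
  obtain ⟨i₀, hi₀⟩ := N.IB_ne
  have : ∀ k, m k = 0 := fun k => by
    induction N.conn i k with
    | refl => exact h0.symm
    | tail _ hl ih =>
      obtain ⟨j, hj | ⟨h1, h2⟩⟩ := hl
      · exact hstep _ ih j _ (Or.inl hj)
      · exact hstep _ ih j _ (Or.inr ⟨h2, h1⟩)
  exact (hB i₀ hi₀).ne' (this i₀)

lemma pos (h : NetSol N β q w p m) (hβ : ∀ i ∈ N.IT, ∀ j ∈ N.Inc i, 0 < β i j)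
    {Q : N.J → ℝ} (hq : ∀ j x, 0 < q j x ∧ q j x ≤ Q j)
    (hB : ∀ i ∈ N.IB, 0 < m i) (j : N.J) : ∀ x ∈ Icc 0 (N.l j), 0 < w j x := by
  have hm := h.vertex_pos hβ hq hB
  exact (h.sol j).pos_of_ends (fun x _ => ⟨(hq j x).1.le, (hq j x).2⟩)
    (by rw [(h.vertex j).1]; exact hm _) (by rw [(h.vertex j).2]; exact hm _)

end NetSol

open scoped Classical in
/-- Existence for the linear Dirichlet problem on the network. -/
lemma exists_netSol {β : N.I → N.J → ℝ} (hβ : ∀ i ∈ N.IT, ∀ j ∈ N.Inc i, 0 < β i j)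
    {q : N.J → ℝ → ℝ} {Q : N.J → ℝ} (hqc : ∀ j, Continuous (q j))
    (hq : ∀ j x, 0 < q j x ∧ q j x ≤ Q j) (b : N.I → ℝ) :
    ∃ w p m, NetSol N β q w p m ∧ (∀ j, ClosedEdgeSol (q j) (N.l j) (w j) (p j)) ∧
      ∀ i ∈ N.IB, m i = b i := by
  choose w₀ p₀ w₁ p₁ h₀ h₁ h00 h0l h10 h1l using fun j =>
    exists_dirichlet_basis (hqc j) (fun x => ⟨(hq j x).1.le, (hq j x).2⟩) (N.l_pos j)
  set P : (N.I → ℝ) → N.J → ℝ → ℝ := fun m j x => m (N.s j) * p₀ j x + m (N.t j) * p₁ j x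
    with hP
  have hsol : ∀ m : N.I → ℝ, ∀ j, ClosedEdgeSol (q j) (N.l j)
      (fun x => m (N.s j) * w₀ j x + m (N.t j) * w₁ j x) (P m j) := fun m j =>
    (h₀ j).lincomb (h₁ j) _ _
  have hvert : ∀ m : N.I → ℝ, ∀ j,
      m (N.s j) * w₀ j 0 + m (N.t j) * w₁ j 0 = m (N.s j) ∧
      m (N.s j) * w₀ j (N.l j) + m (N.t j) * w₁ j (N.l j) = m (N.t j) := fun m j => by
    simp [h00, h0l, h10, h1l]
  have hPadd : ∀ m m' i, N.incSum i (fun j => β i j * N.sgn i j * P (m + m') j (N.param i j)) =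
      N.incSum i (fun j => β i j * N.sgn i j * P m j (N.param i j)) +
      N.incSum i (fun j => β i j * N.sgn i j * P m' j (N.param i j)) := fun m m' i => by
    have := incSum_lincomb i (fun j => β i j * N.sgn i j * P m j (N.param i j))
      (fun j => β i j * N.sgn i j * P m' j (N.param i j)) 1 1
    rw [one_mul, one_mul] at this
    rw [← this]
    refine incSum_congr fun j _ => ?_
    simp only [hP, Pi.add_apply]
    ring
  have hPsmul : ∀ (c : ℝ) m i, N.incSum i (fun j => β i j * N.sgn i j * P (c • m) j (N.param i j)) =
      c * N.incSum i (fun j => β i j * N.sgn i j * P m j (N.param i j)) := fun c m i => by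
    rw [← incSum_const_mul]
    refine incSum_congr fun j _ => ?_
    simp only [hP, Pi.smul_apply, smul_eq_mul]
    ring
  let T : (N.I → ℝ) →ₗ[ℝ] (N.I → ℝ) :=
    { toFun := fun m i => if i ∈ N.IB then m i else
        N.incSum i (fun j => β i j * N.sgn i j * P m j (N.param i j))
      map_add' := fun m m' => by
        ext i
        by_cases hi : i ∈ N.IB
        · simp [hi]
        · simp only [hi, if_false, Pi.add_apply]; exact hPadd m m' i
      map_smul' := fun c m => by
        ext i
        by_cases hi : i ∈ N.IB
        · simp [hi]
        · simp only [hi, if_false, Pi.smul_apply]; exact hPsmul c m i }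
  have hT : ∀ m i, T m i = if i ∈ N.IB then m i else
      N.incSum i (fun j => β i j * N.sgn i j * P m j (N.param i j)) := fun _ _ => rfl
  have hnet : ∀ m, (∀ i ∈ N.IT, T m i = 0) →
      NetSol N β q (fun j x => m (N.s j) * w₀ j x + m (N.t j) * w₁ j x) (P m) m := fun m hm =>
    ⟨fun j => (hsol m j).edgeSol, hvert m, fun i hi => by
      have := hm i hi
      rwa [hT, if_neg hi] at this⟩
  have hinj : Function.Injective T := by
    rw [← LinearMap.ker_eq_bot, LinearMap.ker_eq_bot']
    intro m hm
    have h := hnet m fun i _ => congrFun hm i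
    have hB : ∀ i ∈ N.IB, m i = 0 := fun i hi => by
      have := congrFun hm i
      rwa [hT, if_pos hi] at this
    ext i
    exact le_antisymm (h.le_of_boundary_le hβ hq le_rfl (fun i hi => (hB i hi).le) i)
      (h.nonneg hβ hq (fun i hi => (hB i hi).ge) i)
  obtain ⟨m, hm⟩ := (LinearMap.injective_iff_surjective.1 hinj) fun i =>
    if i ∈ N.IB then b i else 0
  refine ⟨_, _, m, hnet m fun i hi => ?_, hsol m, fun i hi => ?_⟩
  · rw [congrFun hm i, if_neg hi]
  · have := congrFun hm i
    rwa [hT, if_pos hi, if_pos hi] at this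

end Network

namespace Network

variable {N : Network} {f : N.J → ℝ → ℝ} {β : N.I → N.J → ℝ} {ε : ℝ}

lemma _root_.Network.EikViscSol.congr {f' u : N.J → ℝ → ℝ} (h : N.EikViscSol f β ε u)
    (hf : ∀ j, ∀ x ∈ N.edge j, f j x = f' j x) : N.EikViscSol f' β ε u :=
  ⟨h.1, fun j x hx => by rw [h.2.1 j x hx, hf j x (Ioo_subset_Icc_self hx)], h.2.2⟩

/-- The Hopf–Cole transform of a positive solution of the linear problem solves the viscous
eikonal problem. -/
lemma NetSol.eikViscSol {w p : N.J → ℝ → ℝ} {m : N.I → ℝ} (hε : 0 < ε)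
    (hf : ∀ j, Continuous (f j)) (h : NetSol N β (fun j x => f j x ^ 2 / ε ^ 2) w p m)
    (hcl : ∀ j, ClosedEdgeSol (fun x => f j x ^ 2 / ε ^ 2) (N.l j) (w j) (p j))
    (hpos : ∀ j, ∀ x ∈ N.edge j, 0 < w j x) (hB : ∀ i ∈ N.IB, m i = 1) :
    N.EikViscSol f β ε (fun j x => -ε * Real.log (w j x)) := by
  set u : N.J → ℝ → ℝ := fun j x => -ε * Real.log (w j x)
  have hd : ∀ j, ∀ x ∈ N.edge j, HasDerivWithinAt (u j) (-ε * (p j x / w j x)) (N.edge j) x :=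
    fun j x hx => (((hcl j).derivW x hx).log (hpos j x hx).ne').const_mul (-ε)
  have hpd : ∀ j, ∀ x ∈ N.edge j, N.pd u j x = -ε * (p j x / w j x) := fun j x hx =>
    pd_eq (hd j x hx) hx
  have hvert : ∀ j, u j 0 = -ε * Real.log (m (N.s j)) ∧ u j (N.l j) = -ε * Real.log (m (N.t j)) :=
    fun j => by simp only [u, (h.vertex j).1, (h.vertex j).2, and_self]
  refine ⟨⟨⟨compat_of_vertex (m := fun i => -ε * Real.log (m i)) hvert, fun j => ?_⟩,
    fun i hi => ?_⟩, fun j x hx => ?_, fun i hi j hj => ?_⟩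
  · have hq : Continuous fun x => f j x ^ 2 / ε ^ 2 := by have := hf j; fun_prop
    exact contDiffOn_const.mul (((hcl j).contDiffOn (N.l_pos j) hq).log
      fun x hx => (hpos j x hx).ne')
  · have : N.kir β u i = -ε / m i *
        N.incSum i (fun j => β i j * N.sgn i j * p j (N.param i j)) := by
      rw [← incSum_const_mul]
      refine incSum_congr fun j hj => ?_
      rw [hpd j _ (param_mem_edge i j), apply_param_of_vertex h.vertex hj]
      ring
    rw [this, h.kirchhoff i hi, mul_zero]
  · have hx' : x ∈ N.edge j := Ioo_subset_Icc_self hx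
    have hw := (hpos j x hx').ne'
    have h2 : HasDerivWithinAt (N.pd u j) (-ε * ((f j x ^ 2 / ε ^ 2 * w j x * w j x -
        p j x * p j x) / w j x ^ 2)) (N.edge j) x :=
      ((((hcl j).derivP x hx').div ((hcl j).derivW x hx') hw).const_mul (-ε)).congr
        (fun y hy => hpd j y hy) (hpd j x hx')
    have h3 : N.pd2 u j x = _ := h2.derivWithin (uniqueDiffOn_edge j x hx')
    rw [h3, hpd j x hx']
    field_simp
    ring
  · rw [apply_param_of_vertex (m := fun i => -ε * Real.log (m i)) hvert hj, hB i hi]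
    simp

/-- The inverse Hopf–Cole transform linearizes the viscous eikonal problem. -/
lemma _root_.Network.EikViscSol.exists_netSol {u : N.J → ℝ → ℝ} (hε : 0 < ε)
    (h : N.EikViscSol f β ε u) :
    ∃ w p m, NetSol N β (fun j x => f j x ^ 2 / ε ^ 2) w p m ∧ (∀ i ∈ N.IB, m i = 1) ∧
      ∀ j x, u j x = -ε * Real.log (w j x) := by
  obtain ⟨⟨⟨hc, hC2⟩, hkir⟩, heq, hB⟩ := h
  obtain ⟨m, hm⟩ := hc.exists_vertex
  have hC1 : ∀ j, ContDiffOn ℝ 1 (N.pd u j) (N.edge j) := fun j =>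
    (hC2 j).derivWithin (uniqueDiffOn_edge j) (by norm_num)
  have hdu : ∀ j, ∀ x ∈ Ioo 0 (N.l j), HasDerivAt (u j) (N.pd u j x) x := fun j x hx =>
    pd_hasDerivAt hx ((hC2 j).differentiableOn (by norm_num) x (Ioo_subset_Icc_self hx))
  have hdp : ∀ j, ∀ x ∈ Ioo 0 (N.l j), HasDerivAt (N.pd u j) (N.pd2 u j x) x := fun j x hx =>
    ((hC1 j).differentiableOn (by norm_num) x (Ioo_subset_Icc_self hx)).hasDerivWithinAt.hasDerivAt
      (edge_mem_nhds hx)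
  have hdw : ∀ j, ∀ x ∈ Ioo 0 (N.l j), HasDerivAt (fun x => Real.exp (-u j x / ε))
      (-N.pd u j x / ε * Real.exp (-u j x / ε)) x := fun j x hx =>
    (((hdu j x hx).fun_neg.div_const ε).exp).congr_deriv (by ring)
  have hcu := fun j => (hC2 j).continuousOn
  have hcp := fun j => (hC1 j).continuousOn
  refine ⟨fun j x => Real.exp (-u j x / ε), fun j x => -N.pd u j x / ε * Real.exp (-u j x / ε),
    fun i => Real.exp (-m i / ε), ⟨fun j => ⟨?_, ?_, hdw j, fun x hx => ?_⟩, fun j => ?_,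
    fun i hi => ?_⟩, fun i hi => ?_, fun j x => ?_⟩
  · have := hcu j
    exact Real.continuous_exp.comp_continuousOn (this.neg.div_const ε)
  · have := hcu j
    exact ((hcp j).neg.div_const ε).mul
      (Real.continuous_exp.comp_continuousOn (this.neg.div_const ε))
  · refine (((hdp j x hx).fun_neg.div_const ε).mul (hdw j x hx)).congr_deriv ?_
    rw [← heq j x hx]
    field_simp
  · simp only [(hm j).1, (hm j).2, and_self]
  · have : N.incSum i (fun j => β i j * N.sgn i j *
        (-N.pd u j (N.param i j) / ε * Real.exp (-u j (N.param i j) / ε))) =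
        -Real.exp (-m i / ε) / ε * N.kir β u i := by
      unfold kir
      rw [← incSum_const_mul]
      refine incSum_congr fun j hj => ?_
      rw [apply_param_of_vertex hm hj]
      ring
    rw [this, hkir i hi, mul_zero]
  · obtain ⟨j, hj⟩ := N.exists_mem_Inc i
    simp [← apply_param_of_vertex hm hj, hB i hi j hj]
  · rw [Real.log_exp]
    field_simp

end Network

section

open Filter

lemma eventually_nhdsGT_of_exists {P : ℝ → Prop}
    (h : ∃ ε₀ > 0, ∀ ε, 0 < ε → ε < ε₀ → P ε) : ∀ᶠ ε in nhdsWithin (0 : ℝ) (Ioi 0), P ε := by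
  obtain ⟨ε₀, hε₀, h⟩ := h
  filter_upwards [Ioo_mem_nhdsGT hε₀] with ε hε using h ε hε.1 hε.2

lemma neg_mul_log_add_le {ε A c w w' : ℝ} (hε : 0 < ε) (hc : 0 < c) (hw : 0 < w)
    (hw' : 0 < w') (h : w * Real.exp (A / ε) ≤ c * w') :
    -ε * Real.log w' + A ≤ -ε * Real.log w + ε * Real.log c := by
  have := Real.log_le_log (by positivity) h
  rw [Real.log_mul hw.ne' (Real.exp_pos _).ne', Real.log_mul hc.ne' hw'.ne', Real.log_exp] at this
  have := mul_le_mul_of_nonneg_left this hε.le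
  rw [mul_add, mul_div_cancel₀ _ hε.ne'] at this
  linarith

lemma neg_mul_log_le_add {ε A w w' : ℝ} (hε : 0 < ε) (hw : 0 < w)
    (hw' : 0 < w') (h : w ≤ w' * Real.exp (A / ε)) :
    -ε * Real.log w' ≤ -ε * Real.log w + A := by
  have := Real.log_le_log hw h
  rw [Real.log_mul hw'.ne' (Real.exp_pos _).ne', Real.log_exp] at this
  have := mul_le_mul_of_nonneg_left this hε.le
  rw [mul_add, mul_div_cancel₀ _ hε.ne'] at this
  linarith

lemma le_mul_exp_of_neg_mul_log_le {ε A w w' : ℝ} (hε : 0 < ε) (hw : 0 < w)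
    (hw' : 0 < w') (h : -ε * Real.log w' ≤ -ε * Real.log w + A) :
    w ≤ w' * Real.exp (A / ε) := by
  rw [← Real.log_le_log_iff hw (by positivity), Real.log_mul hw'.ne' (Real.exp_pos _).ne',
    Real.log_exp]
  refine le_of_mul_le_mul_left ?_ hε
  rw [mul_add, mul_div_cancel₀ _ hε.ne']
  linarith

namespace Network

/-- The slowness `f` on the edges, bounded and bounded away from zero, and its primitive `F`. -/
structure EdgeWeight (N : Network) (f F : N.J → ℝ → ℝ) (α M : ℝ) : Prop where
  pos : 0 < α
  cont : ∀ j, Continuous (f j)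
  ge : ∀ j x, α ≤ f j x
  le : ∀ j x, f j x ≤ M
  deriv : ∀ j x, HasDerivAt (F j) (f j x) x
  zero : ∀ j, F j 0 = 0

namespace EdgeWeight

variable {N : Network} {f F : N.J → ℝ → ℝ} {α M : ℝ} {β : N.I → N.J → ℝ}

lemma strictMono (h : EdgeWeight N f F α M) (j : N.J) : StrictMono (F j) :=
  strictMono_of_hasDerivAt_pos (h.deriv j) fun x => h.pos.trans_le (h.ge j x)

lemma length_pos (h : EdgeWeight N f F α M) (j : N.J) : 0 < F j (N.l j) := by
  rw [← h.zero j]; exact h.strictMono j (N.l_pos j)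

lemma upper_pos (h : EdgeWeight N f F α M) : 0 < M := by
  obtain ⟨j⟩ := N.neJ
  exact h.pos.trans_le ((h.ge j 0).trans (h.le j 0))

lemma coeff_bounds (h : EdgeWeight N f F α M) {ε : ℝ} (hε : 0 < ε) (j : N.J) (x : ℝ) :
    0 < f j x ^ 2 / ε ^ 2 ∧ f j x ^ 2 / ε ^ 2 ≤ M ^ 2 / ε ^ 2 := by
  have h1 : 0 < f j x := h.pos.trans_le (h.ge j x)
  have h2 := h.le j x
  exact ⟨by positivity, by gcongr⟩

/-- A solution grows at almost the eikonal rate in the direction of its increase. -/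
lemma eventually_lower (h : EdgeWeight N f F α M) (hβ : ∀ i ∈ N.IT, ∀ j ∈ N.Inc i, 0 < β i j)
    {θ : ℝ} (hθ : 0 < θ) (hθ1 : θ < 1) :
    ∀ᶠ ε in nhdsWithin (0 : ℝ) (Ioi 0), ∀ w p m,
      NetSol N β (fun j x => f j x ^ 2 / ε ^ 2) w p m → (∀ i ∈ N.IB, m i = 1) →
      ∀ j, ∀ x ∈ N.edge j,
        (0 ≤ p j x → -ε * Real.log (m (N.t j)) + (1 - θ) * (F j (N.l j) - F j x) ≤
          -ε * Real.log (w j x) + ε * Real.log 2) ∧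
        (p j x ≤ 0 → -ε * Real.log (m (N.s j)) + (1 - θ) * F j x ≤
          -ε * Real.log (w j x) + ε * Real.log 2) := by
  have h1 := eventually_all.2 fun j => eventually_nhdsGT_of_exists
    (exists_eps_growth_right (h.cont j) h.pos (h.ge j) (h.deriv j) hθ hθ1 0 (N.l j))
  have h2 := eventually_all.2 fun j => eventually_nhdsGT_of_exists
    (exists_eps_growth_left (h.cont j) h.pos (h.ge j) (h.deriv j) hθ hθ1 0 (N.l j))
  filter_upwards [h1, h2, self_mem_nhdsWithin] with ε h1 h2 hε w p m hs hB j x hx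
  have hε : 0 < ε := hε
  have hpos := hs.pos hβ (h.coeff_bounds hε) (fun i hi => by rw [hB i hi]; exact one_pos) j
  refine ⟨fun hp => ?_, fun hp => ?_⟩
  · have := h1 j x (w j) (p j) hx.1 hx.2 ((hs.sol j).mono hx.1 le_rfl)
      (fun y hy => (hpos y ⟨hx.1.trans hy.1, hy.2⟩).le) hp
    rw [← (hs.vertex j).2]
    exact neg_mul_log_add_le hε two_pos (hpos x hx) (hpos _ (right_mem_edge j)) this
  · have := h2 j x (w j) (p j) hx.1 hx.2 ((hs.sol j).mono le_rfl hx.2)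
      (fun y hy => (hpos y ⟨hy.1, hy.2.trans hx.2⟩).le) hp
    rw [h.zero, sub_zero] at this
    rw [← (hs.vertex j).1]
    exact neg_mul_log_add_le hε two_pos (hpos x hx) (hpos _ (left_mem_edge j)) this

/-- Bounds on the slopes at the transition vertices from the Kirchhoff conditions. -/
lemma slope_le (h : EdgeWeight N f F α M) (hβ : ∀ i ∈ N.IT, ∀ j ∈ N.Inc i, 0 < β i j)
    {ε : ℝ} (hε : 0 < ε) (hεM : ∀ j, ε ≤ M * N.l j) {w p : N.J → ℝ → ℝ} {m : N.I → ℝ}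
    (hs : NetSol N β (fun j x => f j x ^ 2 / ε ^ 2) w p m) (hB : ∀ i ∈ N.IB, m i = 1)
    {i : N.I} (hi : i ∈ N.IT) {j : N.J} (hj : j ∈ N.Inc i) :
    N.sgn i j * p j (N.param i j) ≤ 2 * M * N.incSum i (β i) / β i j * m i / ε := by
  have hpos := hs.pos hβ (h.coeff_bounds hε) (fun i hi => by rw [hB i hi]; exact one_pos)
  have hf : ∀ j, ∀ x ∈ Icc 0 (N.l j), 0 ≤ f j x ∧ f j x ≤ M := fun j x _ =>
    ⟨h.pos.le.trans (h.ge j x), h.le j x⟩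
  set c : ℝ := 2 * M * m i / ε with hc
  have hge : ∀ k ∈ N.Inc i, -c ≤ N.sgn i k * p k (N.param i k) := by
    rintro k (rfl | rfl)
    · have := slope_ge_of_pos hε (N.l_pos k).le h.upper_pos (hf k) (by simpa using hεM k)
        (hs.sol k) (hpos k)
      rw [(hs.vertex k).1] at this
      rwa [sgn_s, one_mul, param_s]
    · have := slope_le_of_pos hε (N.l_pos k).le h.upper_pos (hf k) (by simpa using hεM k)
        (hs.sol k) (hpos k)
      rw [(hs.vertex k).2] at this
      rw [sgn_t, neg_one_mul, param_t]
      exact neg_le_neg this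
  have hsum : N.incSum i (fun k => β i k * (N.sgn i k * p k (N.param i k) + c)) =
      c * N.incSum i (β i) := by
    have := incSum_lincomb i (fun k => β i k * N.sgn i k * p k (N.param i k)) (β i) 1 c
    rw [hs.kirchhoff i hi, mul_zero, zero_add] at this
    rw [← this]
    exact incSum_congr fun k _ => by ring
  have hle : β i j * (N.sgn i j * p j (N.param i j) + c) ≤ c * N.incSum i (β i) := by
    rw [← hsum]
    exact le_incSum (f := fun k => β i k * (N.sgn i k * p k (N.param i k) + c))
      (fun k hk => mul_nonneg (hβ i hi k hk).le (by linarith [hge k hk])) hj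
  have hb := hβ i hi j hj
  have hc0 : 0 < c := by
    have := hs.vertex_pos hβ (h.coeff_bounds hε) (fun i hi => by rw [hB i hi]; exact one_pos) i
    have := h.upper_pos
    positivity
  have hle' : N.sgn i j * p j (N.param i j) + c ≤ c * N.incSum i (β i) / β i j := by
    rw [le_div_iff₀ hb]; linarith
  calc N.sgn i j * p j (N.param i j) ≤ c * N.incSum i (β i) / β i j := by linarith
    _ = _ := by rw [hc]; ring

lemma eventually_vertex_upper (h : EdgeWeight N f F α M)
    (hβ : ∀ i ∈ N.IT, ∀ j ∈ N.Inc i, 0 < β i j) {θ : ℝ} (hθ : 0 < θ) :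
    ∀ᶠ ε in nhdsWithin (0 : ℝ) (Ioi 0), ∀ w p m,
      NetSol N β (fun j x => f j x ^ 2 / ε ^ 2) w p m → (∀ i ∈ N.IB, m i = 1) →
      ∀ i j k, N.Link j i k →
        -ε * Real.log (m i) ≤ -ε * Real.log (m k) + (1 + θ) * F j (N.l j) := by
  have h1 := eventually_all.2 fun j => eventually_nhdsGT_of_exists
    (exists_eps_growth_le_right (h.cont j) h.pos (h.ge j) (h.deriv j) hθ
      (2 * M * N.incSum (N.s j) (β (N.s j)) / β (N.s j) j) (N.l_pos j))
  have h2 := eventually_all.2 fun j => eventually_nhdsGT_of_exists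
    (exists_eps_growth_le_left (h.cont j) h.pos (h.ge j) (h.deriv j) hθ
      (2 * M * N.incSum (N.t j) (β (N.t j)) / β (N.t j) j) (N.l_pos j))
  have h3 : ∀ᶠ ε in nhdsWithin (0 : ℝ) (Ioi 0), ∀ j, ε ≤ M * N.l j :=
    eventually_all.2 fun j => eventually_nhdsGT_of_exists
      ⟨M * N.l j, mul_pos h.upper_pos (N.l_pos j), fun ε _ hε => hε.le⟩
  filter_upwards [h1, h2, h3, self_mem_nhdsWithin] with ε h1 h2 h3 hε w p m hs hB i j k hl
  have hε : 0 < ε := hε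
  have hB' : ∀ i ∈ N.IB, 0 < m i := fun i hi => by rw [hB i hi]; exact one_pos
  have hpos := hs.pos hβ (h.coeff_bounds hε) hB'
  have hm := hs.vertex_pos hβ (h.coeff_bounds hε) hB'
  by_cases hi : i ∈ N.IB
  · have hk1 : m k ≤ 1 := hs.le_of_boundary_le hβ (h.coeff_bounds hε) zero_le_one
      (fun i hi => (hB i hi).le) k
    have := mul_nonneg_of_nonpos_of_nonpos (neg_nonpos.2 hε.le)
      (Real.log_nonpos (hm k).le hk1)
    have := h.length_pos j
    rw [hB i hi, Real.log_one, mul_zero]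
    positivity
  · have hsl := h.slope_le hβ hε h3 hs hB hi hl.mem_Inc
    refine neg_mul_log_le_add hε (hm k) (hm i) ?_
    rcases hl with ⟨rfl, rfl⟩ | ⟨rfl, rfl⟩
    · rw [sgn_s, param_s, one_mul] at hsl
      have := h1 j (w j) (p j) (hs.sol j) (hpos j) (by rwa [(hs.vertex j).1])
      rwa [(hs.vertex j).1, (hs.vertex j).2, h.zero, sub_zero] at this
    · rw [sgn_t, param_t, neg_one_mul] at hsl
      have := h2 j (w j) (p j) (hs.sol j) (hpos j) (by rw [(hs.vertex j).2]; linarith)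
      rwa [(hs.vertex j).1, (hs.vertex j).2, h.zero, sub_zero] at this

/-- Upper bounds inside the edges. -/
lemma eventually_upper (h : EdgeWeight N f F α M)
    (hβ : ∀ i ∈ N.IT, ∀ j ∈ N.Inc i, 0 < β i j) {θ : ℝ} (hθ : 0 < θ) :
    ∀ᶠ ε in nhdsWithin (0 : ℝ) (Ioi 0), ∀ w p m,
      NetSol N β (fun j x => f j x ^ 2 / ε ^ 2) w p m → (∀ i ∈ N.IB, m i = 1) →
      ∀ j, ∀ x ∈ N.edge j,
        -ε * Real.log (w j x) ≤ -ε * Real.log (m (N.s j)) + (1 + 2 * θ) * F j x ∧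
        -ε * Real.log (w j x) ≤
          -ε * Real.log (m (N.t j)) + (1 + 2 * θ) * (F j (N.l j) - F j x) := by
  have h1 := eventually_all.2 fun j => eventually_nhdsGT_of_exists
    (exists_eps_lower_right (h.cont j) h.pos (h.ge j) (h.deriv j) hθ 0 (N.l j))
  have h2 := eventually_all.2 fun j => eventually_nhdsGT_of_exists
    (exists_eps_lower_left (h.cont j) h.pos (h.ge j) (h.deriv j) hθ 0 (N.l j))
  filter_upwards [h1, h2, h.eventually_vertex_upper hβ hθ, self_mem_nhdsWithin] with
    ε h1 h2 h3 hε w p m hs hB j x hx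
  have hε : 0 < ε := hε
  have hB' : ∀ i ∈ N.IB, 0 < m i := fun i hi => by rw [hB i hi]; exact one_pos
  have hpos := hs.pos hβ (h.coeff_bounds hε) hB'
  have hm := hs.vertex_pos hβ (h.coeff_bounds hε) hB'
  have hv := h3 w p m hs hB
  refine ⟨neg_mul_log_le_add hε (hm _) (hpos j x hx) ?_,
    neg_mul_log_le_add hε (hm _) (hpos j x hx) ?_⟩
  · have := h1 j (w j) (p j) (hs.sol j) (hpos j) (by
      rw [(hs.vertex j).1, (hs.vertex j).2, h.zero, sub_zero]
      exact le_mul_exp_of_neg_mul_log_le hε (hm _) (hm _) (hv _ _ _ (link_ts j))) x hx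
    rwa [(hs.vertex j).1, h.zero, sub_zero] at this
  · have := h2 j (w j) (p j) (hs.sol j) (hpos j) (by
      rw [(hs.vertex j).1, (hs.vertex j).2, h.zero, sub_zero]
      exact le_mul_exp_of_neg_mul_log_le hε (hm _) (hm _) (hv _ _ _ (link_st j))) x hx
    rwa [(hs.vertex j).2] at this

lemma vertex_dist_nonneg (h : EdgeWeight N f F α M) {d : N.I → ℝ} (hd0 : ∀ i ∈ N.IB, d i = 0)
    (hd' : ∀ i ∈ N.IT, ∃ j k, N.Link j i k ∧ d k + F j (N.l j) = d i) (i : N.I) : 0 ≤ d i :=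
  le_of_link h.length_pos (a := fun _ => 0)
    (fun i _ j _ _ => by simpa using (h.length_pos j).le)
    (fun i hi => (hd' i hi).imp fun j => Exists.imp fun k h => ⟨h.1, h.2.le⟩)
    (fun i hi => (hd0 i hi).ge) i

/-- Two-sided comparison of the viscous solutions with the distance function. -/
lemma eventually_bounds (h : EdgeWeight N f F α M)
    (hβ : ∀ i ∈ N.IT, ∀ j ∈ N.Inc i, 0 < β i j) {d : N.I → ℝ} (hd0 : ∀ i ∈ N.IB, d i = 0)
    (hd : ∀ j i k, N.Link j i k → d i ≤ d k + F j (N.l j))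
    (hd' : ∀ i ∈ N.IT, ∃ j k, N.Link j i k ∧ d k + F j (N.l j) = d i)
    {θ : ℝ} (hθ : 0 < θ) (hθ1 : 2 * θ < 1) :
    ∀ᶠ ε in nhdsWithin (0 : ℝ) (Ioi 0), ∀ w p m,
      NetSol N β (fun j x => f j x ^ 2 / ε ^ 2) w p m → (∀ i ∈ N.IB, m i = 1) →
      ∀ j, ∀ x ∈ N.edge j,
        (1 - 2 * θ) * N.distFun F d j x ≤ -ε * Real.log (w j x) + ε * Real.log 2 ∧
        -ε * Real.log (w j x) ≤ (1 + 2 * θ) * N.distFun F d j x := by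
  have hlog2 : 0 < Real.log 2 := Real.log_pos one_lt_two
  have hlog : ∀ᶠ ε in nhdsWithin (0 : ℝ) (Ioi 0), ∀ j, ε * Real.log 2 ≤ θ * F j (N.l j) :=
    eventually_all.2 fun j => eventually_nhdsGT_of_exists
      ⟨θ * F j (N.l j) / Real.log 2, div_pos (mul_pos hθ (h.length_pos j)) hlog2,
        fun ε _ hε => by rw [lt_div_iff₀ hlog2] at hε; exact hε.le⟩
  filter_upwards [h.eventually_lower hβ hθ (by linarith), h.eventually_vertex_upper hβ hθ,
    h.eventually_upper hβ hθ, hlog, self_mem_nhdsWithin] with ε h1 h2 h3 hlog hε w p m hs hB j x hx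
  have hε : 0 < ε := hε
  have h1 := h1 w p m hs hB
  have hdn := h.vertex_dist_nonneg hd0 hd'
  have hge := le_of_link (L := fun j => (1 - 2 * θ) * F j (N.l j))
    (fun j => mul_pos (by linarith) (h.length_pos j)) (a := fun i => (1 - 2 * θ) * d i)
    (b := fun i => -ε * Real.log (m i))
    (fun i _ j k hl => by
      have := mul_le_mul_of_nonneg_left (hd j i k hl) (show 0 ≤ 1 - 2 * θ by linarith)
      linarith)
    (fun i hi => by
      obtain ⟨j, hj, hnn⟩ : ∃ j ∈ N.Inc i, 0 ≤ N.sgn i j * p j (N.param i j) := by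
        by_contra! hneg
        have hpos := incSum_pos (i := i)
          (f := fun j => -1 * (β i j * N.sgn i j * p j (N.param i j))) fun j hj => by
            have := mul_neg_of_pos_of_neg (hβ i hi j hj) (hneg j hj)
            linarith
        rw [incSum_const_mul, hs.kirchhoff i hi] at hpos
        simp at hpos
      have hlog := hlog j
      rcases hj with rfl | rfl
      · refine ⟨j, _, link_st j, ?_⟩
        rw [sgn_s, one_mul, param_s] at hnn
        have := (h1 j 0 (left_mem_edge j)).1 hnn
        rw [h.zero, (hs.vertex j).1] at this
        linarith
      · refine ⟨j, _, link_ts j, ?_⟩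
        rw [sgn_t, neg_one_mul, param_t] at hnn
        have := (h1 j _ (right_mem_edge j)).2 (by linarith)
        rw [(hs.vertex j).2] at this
        linarith)
    (fun i hi => by rw [hd0 i hi, hB i hi]; simp)
  have hle := le_of_link (L := fun j => (1 + θ) * F j (N.l j))
    (fun j => mul_pos (by linarith) (h.length_pos j)) (b := fun i => (1 + θ) * d i)
    (a := fun i => -ε * Real.log (m i))
    (fun i _ j k hl => h2 w p m hs hB i j k hl)
    (fun i hi => by
      obtain ⟨j, k, hl, hk⟩ := hd' i hi
      exact ⟨j, k, hl, by rw [← hk]; exact (mul_add _ _ _).ge.trans' (by linarith)⟩)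
    (fun i hi => by rw [hd0 i hi, hB i hi]; simp)
  have hF0 : 0 ≤ F j x := by rw [← h.zero j]; exact (h.strictMono j).monotone hx.1
  have hFl : 0 ≤ F j (N.l j) - F j x := sub_nonneg.2 ((h.strictMono j).monotone hx.2)
  have hmul : ∀ c, c * N.distFun F d j x = c * min (d (N.s j) + F j x)
    (d (N.t j) + F j (N.l j) - F j x) := fun _ => rfl
  constructor
  · have hc : 0 ≤ 1 - 2 * θ := by linarith
    rcases le_total 0 (p j x) with hp | hp
    · refine (mul_le_mul_of_nonneg_left (min_le_right _ _) hc).trans ?_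
      nlinarith [(h1 j x hx).1 hp, hge (N.t j)]
    · refine (mul_le_mul_of_nonneg_left (min_le_left _ _) hc).trans ?_
      nlinarith [(h1 j x hx).2 hp, hge (N.s j)]
  · rw [hmul, mul_min_of_nonneg _ _ (by linarith)]
    obtain ⟨h4, h5⟩ := h3 w p m hs hB j x hx
    refine le_min ?_ ?_
    · nlinarith [hle (N.s j), mul_nonneg hθ.le (hdn (N.s j))]
    · nlinarith [hle (N.t j), mul_nonneg hθ.le (hdn (N.t j))]

end EdgeWeight

end Network

end

lemma exists_continuous_extension_with_primitive {f : ℝ → ℝ} {l α : ℝ} (hl : 0 ≤ l)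
    (hf : ContinuousOn f (Icc 0 l)) (hα : ∀ x ∈ Icc 0 l, α ≤ f x) :
    ∃ g G : ℝ → ℝ, ∃ M, Continuous g ∧ (∀ x ∈ Icc 0 l, f x = g x) ∧ (∀ x, α ≤ g x) ∧
      (∀ x, g x ≤ M) ∧ (∀ x, HasDerivAt G (g x) x) ∧ G 0 = 0 := by
  have hc : Continuous (IccExtend hl ((Icc 0 l).domRestrict f)) :=
    (continuousOn_iff_continuous_domRestrict.1 hf).Icc_extend'
  obtain ⟨M, hM⟩ := isCompact_Icc.bddAbove_image hf
  refine ⟨_, fun x => ∫ y in (0 : ℝ)..x, IccExtend hl ((Icc 0 l).domRestrict f) y, M, hc,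
    fun x hx => (IccExtend_of_mem hl ((Icc 0 l).domRestrict f) hx).symm,
    fun x => hα _ (projIcc 0 l hl x).2,
    fun x => hM ⟨_, (projIcc 0 l hl x).2, rfl⟩,
    fun x => intervalIntegral.integral_hasDerivAt_right (hc.intervalIntegrable _ _)
      (hc.stronglyMeasurableAtFilter _ _) hc.continuousAt, intervalIntegral.integral_same⟩

namespace Network

variable {N : Network} {f F : N.J → ℝ → ℝ} {α M : ℝ} {β : N.I → N.J → ℝ}

lemma exists_edgeWeight (hfc : N.Compat f) (hf : ∀ j, ContinuousOn (f j) (N.edge j)) (hα : 0 < α)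
    (hfα : ∀ j, ∀ x ∈ N.edge j, α ≤ f j x) :
    ∃ g G : N.J → ℝ → ℝ, ∃ M, EdgeWeight N g G α M ∧ N.Compat g ∧
      ∀ j, ∀ x ∈ N.edge j, f j x = g j x := by
  choose g G M h1 h2 h3 h4 h5 h6 using fun j =>
    exists_continuous_extension_with_primitive (N.l_pos j).le (hf j) (hfα j)
  obtain ⟨C, hC⟩ := (Set.finite_range M).bddAbove
  refine ⟨g, G, C, ⟨hα, h1, h3, fun j x => (h4 j x).trans (hC ⟨j, rfl⟩), h5, h6⟩, ?_, h2⟩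
  intro i j hj k hk
  rw [← h2 j _ (param_mem_edge i j), ← h2 k _ (param_mem_edge i k), hfc i j hj k hk]

namespace EdgeWeight

lemma exists_unique_eikViscSol (h : EdgeWeight N f F α M)
    (hβ : ∀ i ∈ N.IT, ∀ j ∈ N.Inc i, 0 < β i j) {ε : ℝ} (hε : 0 < ε) :
    ∃ u, N.EikViscSol f β ε u ∧
      ∀ u', N.EikViscSol f β ε u' → ∀ j, ∀ x ∈ N.edge j, u' j x = u j x := by
  obtain ⟨w, p, m, hs, hcl, hB⟩ := exists_netSol hβ
    (fun j => ((h.cont j).pow 2).div_const (ε ^ 2)) (h.coeff_bounds hε) (fun _ => 1)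
  have hpos := hs.pos hβ (h.coeff_bounds hε) (fun i hi => by rw [hB i hi]; exact one_pos)
  refine ⟨_, hs.eikViscSol hε h.cont hcl hpos hB, fun u' hu' j x hx => ?_⟩
  obtain ⟨w', p', m', hs', hB', hu'⟩ := hu'.exists_netSol hε
  rw [hu' j x, hs'.eq_of_boundary_eq hs hβ (h.coeff_bounds hε)
    (fun i hi => by rw [hB i hi, hB' i hi]) j hx]

lemma tendstoUniformlyOn_distFun (h : EdgeWeight N f F α M)
    (hβ : ∀ i ∈ N.IT, ∀ j ∈ N.Inc i, 0 < β i j) {d : N.I → ℝ} (hd0 : ∀ i ∈ N.IB, d i = 0)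
    (hd : ∀ j i k, N.Link j i k → d i ≤ d k + F j (N.l j))
    (hd' : ∀ i ∈ N.IT, ∃ j k, N.Link j i k ∧ d k + F j (N.l j) = d i)
    {u : ℝ → N.J → ℝ → ℝ} (hu : ∀ ε, 0 < ε → N.EikViscSol f β ε (u ε)) (j : N.J) :
    TendstoUniformlyOn (fun ε => u ε j) (N.distFun F d j) (nhdsWithin 0 (Ioi 0)) (N.edge j) := by
  rw [Metric.tendstoUniformlyOn_iff]
  intro η hη
  have hdn := h.vertex_dist_nonneg hd0 hd'
  set C : ℝ := d (N.s j) + F j (N.l j) with hC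
  have hC0 : 0 < C := add_pos_of_nonneg_of_pos (hdn _) (h.length_pos j)
  obtain ⟨θ, hθ, hθ'⟩ := exists_between (lt_min (show 0 < η / (4 * C) by positivity)
    (show (0 : ℝ) < 1 / 2 by norm_num))
  rw [lt_min_iff, lt_div_iff₀ (by positivity)] at hθ'
  have hlog2 : 0 < Real.log 2 := Real.log_pos one_lt_two
  filter_upwards [h.eventually_bounds hβ hd0 hd hd' hθ (by linarith), self_mem_nhdsWithin,
    Ioo_mem_nhdsGT (show 0 < η / (2 * Real.log 2) by positivity)] with ε h1 hε h2 x hx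
  obtain ⟨w, p, m, hs, hB, hw⟩ := (hu ε hε).exists_netSol hε
  obtain ⟨h3, h4⟩ := h1 w p m hs hB j x hx
  rw [← hw j x] at h3 h4
  have hmono := (h.strictMono j).monotone
  have hFx : 0 ≤ F j x := by rw [← h.zero j]; exact hmono hx.1
  have hFl : F j x ≤ F j (N.l j) := hmono hx.2
  have hD : N.distFun F d j x ≤ C := (min_le_left _ _).trans (by linarith)
  have hD0 : 0 ≤ N.distFun F d j x :=
    le_min (by linarith [hdn (N.s j)]) (by linarith [hdn (N.t j)])
  have h5 := h2.2
  rw [lt_div_iff₀ (by positivity)] at h5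
  have h6 : θ * N.distFun F d j x ≤ θ * C := mul_le_mul_of_nonneg_left hD hθ.le
  rw [Real.dist_eq, abs_lt]
  constructor <;> nlinarith [mul_pos (show 0 < ε from hε) hlog2]

end EdgeWeight

end Network

open Network in
/-- **Section 6, Facts 2-4** (vanishing viscosity limit for the eikonal equation on a
network). -/
theorem eikonal_vanishing_viscosity
    (N : Network) (f : N.J → ℝ → ℝ) (hfc : N.Compat f)
    (hfLip : ∀ j, ∃ L : NNReal, LipschitzOnWith L (f j) (N.edge j))
    (α : ℝ) (hα : 0 < α) (hfα : ∀ j, ∀ x ∈ N.edge j, α ≤ f j x)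
    (β : N.I → N.J → ℝ)
    (hβ : ∀ i ∈ N.IT, ∀ j ∈ N.Inc i, 0 < β i j) :
    ∃ ufam : ℝ → N.J → ℝ → ℝ,
      (∀ ε : ℝ, 0 < ε → N.EikViscSol f β ε (ufam ε) ∧
        ∀ u' : N.J → ℝ → ℝ, N.EikViscSol f β ε u' →
          ∀ j, ∀ x ∈ N.edge j, u' j x = ufam ε j x) ∧
      ∃ u : N.J → ℝ → ℝ,
        N.IsViscSol (fun j _x r p => |p| - f j _x) u ∧
        (∀ i ∈ N.IB, ∀ j ∈ N.Inc i, u j (N.param i j) = 0) ∧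
        (∀ u' : N.J → ℝ → ℝ, N.IsViscSol (fun j _x r p => |p| - f j _x) u' →
          (∀ i ∈ N.IB, ∀ j ∈ N.Inc i, u' j (N.param i j) = 0) →
          ∀ j, ∀ x ∈ N.edge j, u' j x = u j x) ∧
        (∀ j, TendstoUniformlyOn (fun ε => ufam ε j) (u j)
          (nhdsWithin 0 (Set.Ioi (0 : ℝ))) (N.edge j)) := by
  obtain ⟨g, G, M, h, hgc, hfg⟩ := exists_edgeWeight hfc
    (fun j => (hfLip j).choose_spec.continuousOn) hα hfα
  have hgf : ∀ j, ∀ x ∈ N.edge j, g j x = f j x := fun j x hx => (hfg j x hx).symm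
  obtain ⟨d, hd0, hd, hd'⟩ := N.exists_vertex_dist h.length_pos
  have hex : ∀ ε : ℝ, ∃ u, 0 < ε → N.EikViscSol g β ε u ∧
      ∀ u', N.EikViscSol g β ε u' → ∀ j, ∀ x ∈ N.edge j, u' j x = u j x := fun ε => by
    by_cases hε : 0 < ε
    · exact (h.exists_unique_eikViscSol hβ hε).imp fun u hu _ => hu
    · exact ⟨0, fun h => absurd h hε⟩
  choose u hu using hex
  refine ⟨u, fun ε hε => ⟨(hu ε hε).1.congr hgf, fun u' hu' => (hu ε hε).2 u' (hu'.congr hfg)⟩,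
    N.distFun G d, ?_, ?_, ?_, h.tendstoUniformlyOn_distFun hβ hd0 hd hd' fun ε hε => (hu ε hε).1⟩
  · exact (distFun_isViscSol h.deriv (fun j x => hα.trans_le (h.ge j x)) hgc h.zero hd hd').congr
      fun j x hx _ _ => by rw [hgf j x hx]
  · intro i hi j hj
    rw [apply_param_of_vertex (distFun_vertex h.zero hd) hj, hd0 i hi]
  · intro u' hu' hu0 j x hx
    exact (hu'.congr fun j x hx _ _ => by rw [hfg j x hx]).eq_distFun hα h.ge h.deriv h.zero
      hd0 hd hd' hu0 j hx
end
end
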